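/- arXiv:1712.09855 — 2 statements merged into one kernel-verified Lean document; each statement's English description precedes it below -/
import Mathlib

section
/- For infinitely many values of n, there exists a bipartite 2-planar multigraph with n vertices and exactly 3.5n − 8 edges. -/
open Set

/-- A topological drawing in the plane of a multigraph with vertex set `V`, edge index
set `E`, and endpoint map `ends` (so parallel edges are allowed): vertices are mapped
to distinct points, each edge to a Jordan arc (parametrized over `[0,1]`) connecting
its two endpoints; no arc passes through a vertex other than its endpoints; edges
sharing an endpoint meet only at images of shared endpoints (adjacent edges do not
cross); independent edges meet in at most one point (no edge crosses another more than
once); and no two parallel edges are homotopic: both regions determined by two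
parallel edges contain the image of some vertex. -/
structure MultiDrawing {V E : Type*} (ends : E → Sym2 V) where
  vert : V → ℝ × ℝ
  vert_inj : Function.Injective vert
  arc : E → ℝ → ℝ × ℝ
  arc_cont : ∀ e, ContinuousOn (arc e) (Set.Icc 0 1)
  arc_inj : ∀ e, Set.InjOn (arc e) (Set.Icc 0 1)
  arc_ends : ∀ (e : E) (u v : V), ends e = s(u, v) →
      ({arc e 0, arc e 1} : Set (ℝ × ℝ)) = {vert u, vert v}
  arc_vertex : ∀ (e : E), ∀ t ∈ Set.Icc (0:ℝ) 1, ∀ w : V,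
      arc e t = vert w → w ∈ ends e
  adj_meet : ∀ e f : E, e ≠ f →
      (∃ w : V, w ∈ ends e ∧ w ∈ ends f) →
      ∀ p ∈ arc e '' Set.Icc (0:ℝ) 1, p ∈ arc f '' Set.Icc (0:ℝ) 1 →
        ∃ w : V, w ∈ ends e ∧ w ∈ ends f ∧ p = vert w
  nonadj_meet : ∀ e f : E,
      (¬ ∃ w : V, w ∈ ends e ∧ w ∈ ends f) →
      ((arc e '' Set.Icc (0:ℝ) 1) ∩ (arc f '' Set.Icc (0:ℝ) 1)).Subsingleton
  parallel_nonhomotopic : ∀ e f : E, e ≠ f → ends e = ends f →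
      ∀ p : ℝ × ℝ, p ∉ (arc e '' Set.Icc (0:ℝ) 1) ∪ (arc f '' Set.Icc (0:ℝ) 1) →
        ∃ w : V, vert w ∈
          connectedComponentIn ((arc e '' Set.Icc (0:ℝ) 1) ∪ (arc f '' Set.Icc (0:ℝ) 1))ᶜ p

/-- The image (point set) of an edge in a drawing of a multigraph. -/
def MultiDrawing.img {V E : Type*} {ends : E → Sym2 V} (D : MultiDrawing ends) (e : E) :
    Set (ℝ × ℝ) :=
  D.arc e '' Set.Icc (0:ℝ) 1

/-- Two edges of a multigraph cross in a drawing if they are distinct and meet at a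
point that is not the image of any vertex. -/
def MultiDrawing.Crosses {V E : Type*} {ends : E → Sym2 V} (D : MultiDrawing ends)
    (e f : E) : Prop :=
  e ≠ f ∧ ∃ p ∈ D.img e ∩ D.img f, ∀ w : V, D.vert w ≠ p

/-- In the drawing `D`, every edge is crossed at most `k` times. -/
def MultiDrawing.AtMostKCrossings {V E : Type*} {ends : E → Sym2 V}
    (D : MultiDrawing ends) (k : ℕ) : Prop :=
  ∀ e : E, {f : E | D.Crosses e f}.ncard ≤ k

/-- A multigraph (given by its endpoint map) is bipartite: its vertices can be split in
two parts such that every edge joins the two parts. -/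
def MultiIsBipartite {V E : Type*} (ends : E → Sym2 V) : Prop :=
  ∃ c : V → Bool, ∀ (e : E) (u v : V), ends e = s(u, v) → c u ≠ c v

/-- A multigraph has no self-loops. -/
def NoLoops {V E : Type*} (ends : E → Sym2 V) : Prop :=
  ∀ e : E, ¬ (ends e).IsDiag

/-- A multigraph is 2-planar if it admits a drawing in which every edge is crossed at
most 2 times. -/
def MultiIsTwoPlanar {V E : Type*} (ends : E → Sym2 V) : Prop :=
  ∃ D : MultiDrawing ends, D.AtMostKCrossings 2

namespace TPM

/-- vertex codes -/
inductive Vc | a | b | x (i : ℕ) | y (i : ℕ)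

/-- kinds of edges that are monotone in the vertical direction -/
inductive VK | S | M | LA | RA | LB | RB | A | B

/-- edge codes -/
inductive Ec | v (k : VK) (i : ℕ) | h (i : ℕ) | k (i : ℕ) | z

noncomputable def cc (q : ℕ) : ℝ := 8 * q + 12

lemma cc_pos (q : ℕ) : 0 < cc q := by unfold cc; positivity

def vval (q : ℕ) : Vc → Prop
  | .a => True | .b => True | .x i => i < 2 * q + 4 | .y i => i < 2 * q + 4

def evl (q : ℕ) : Ec → Prop
  | .v .S i => i < 2 * q + 4
  | .v .M i => i < 2 * q + 4
  | .v .LA i => i < 2 * q + 4 ∧ i % 2 = 0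
  | .v .RA i => i < 2 * q + 4 ∧ i % 2 = 0
  | .v .LB i => i < 2 * q + 4 ∧ i % 2 = 0
  | .v .RB i => i < 2 * q + 4 ∧ i % 2 = 0
  | .v .A i => i < 2 * q + 4 ∧ i % 2 = 1
  | .v .B i => i < 2 * q + 4 ∧ i % 2 = 1
  | .h i => i < 2 * q + 3
  | .k i => i < 2 * q + 3
  | .z => True

def lo : Ec → Vc
  | .v .S i => .y i
  | .v .M _ => .b
  | .v .LA i => .y i
  | .v .RA i => .y i
  | .v .LB _ => .b
  | .v .RB _ => .b
  | .v .A i => .x i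
  | .v .B _ => .b
  | .h i => .x i
  | .k i => .y i
  | .z => .x 0

def hi (q : ℕ) : Ec → Vc
  | .v .S i => .x i
  | .v .M _ => .a
  | .v .LA _ => .a
  | .v .RA _ => .a
  | .v .LB i => .x i
  | .v .RB i => .x i
  | .v .A _ => .a
  | .v .B i => .y i
  | .h i => .x (i + 1)
  | .k i => .y (i + 1)
  | .z => .x (2 * q + 3)

noncomputable def off : VK → ℝ → ℝ
  | .S, _ => 0
  | .M, _ => -4
  | .LA, y => -1 - y
  | .RA, y => 1 + y
  | .LB, y => -1 + y
  | .RB, y => 1 - y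
  | .A, _ => 0
  | .B, _ => 0

noncomputable def al : VK → ℝ
  | .S => -1 | .M => -2 | .LA => -1 | .RA => -1 | .LB => -2 | .RB => -2 | .A => 1 | .B => -2

noncomputable def be : VK → ℝ
  | .S => 1 | .M => 2 | .LA => 2 | .RA => 2 | .LB => 1 | .RB => 1 | .A => 2 | .B => -1

noncomputable def pos (q : ℕ) : Vc → ℝ × ℝ
  | .a => (0, 2)
  | .b => (0, -2)
  | .x i => (8 * i - cc q, 1)
  | .y i => (8 * i - cc q, -1)

noncomputable def gv (q : ℕ) (k : VK) (i : ℕ) (y : ℝ) : ℝ := (8 * i + off k y - cc q) * (2 - |y|)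

def On (q : ℕ) : Ec → ℝ × ℝ → Prop
  | .v k i, p => (al k ≤ p.2 ∧ p.2 ≤ be k) ∧ p.1 = gv q k i p.2
  | .h i, p => p.2 = 1 ∧ 8 * i - cc q ≤ p.1 ∧ p.1 ≤ 8 * i + 8 - cc q
  | .k i, p => p.2 = -1 ∧ 8 * i - cc q ≤ p.1 ∧ p.1 ≤ 8 * i + 8 - cc q
  | .z, p => |p.1| ≤ cc q ∧ cc q * p.2 = 3 * cc q - 2 * |p.1|

noncomputable def arc (q : ℕ) : Ec → ℝ → ℝ × ℝ
  | .v k i, t => (gv q k i (al k + t * (be k - al k)), al k + t * (be k - al k))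
  | .h i, t => (8 * i + 8 * t - cc q, 1)
  | .k i, t => (8 * i + 8 * t - cc q, -1)
  | .z, t => (cc q * (2 * t - 1), 3 - 2 * |2 * t - 1|)

lemma al_lt_be (k : VK) : al k < be k := by cases k <;> norm_num [al, be]

lemma off_cont (k : VK) : Continuous (off k) := by
  rw [show off k = fun y => off k y from rfl]
  cases k <;> simp only [off] <;> fun_prop

lemma gv_cont (q : ℕ) (k : VK) (i : ℕ) : Continuous (gv q k i) := by
  have := off_cont k
  unfold gv; fun_prop

lemma arc_cont (q : ℕ) (e : Ec) : Continuous (arc q e) := by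
  rw [show arc q e = fun t => arc q e t from rfl]
  cases e with
  | v k i => have := gv_cont q k i; simp only [arc]; fun_prop
  | h i => simp only [arc]; fun_prop
  | k i => simp only [arc]; fun_prop
  | z => simp only [arc]; fun_prop

lemma arc_inj (q : ℕ) (e : Ec) : Function.Injective (arc q e) := by
  have hc := cc_pos q
  intro s t hst
  cases e with
  | v k i =>
    have h := al_lt_be k
    simp only [arc, Prod.mk.injEq] at hst
    have h2 : (s - t) * (be k - al k) = 0 := by linarith [hst.2]
    rcases mul_eq_zero.1 h2 with h3 | h3 <;> linarith
  | h i => simp only [arc, Prod.mk.injEq] at hst; linarith [hst.1]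
  | k i => simp only [arc, Prod.mk.injEq] at hst; linarith [hst.1]
  | z =>
    simp only [arc, Prod.mk.injEq] at hst
    have := mul_left_cancel₀ hc.ne' hst.1
    linarith

lemma mem_img (q : ℕ) (e : Ec) (p : ℝ × ℝ) : p ∈ arc q e '' Set.Icc (0:ℝ) 1 ↔ On q e p := by
  have hc := cc_pos q
  obtain ⟨X, y⟩ := p
  cases e with
  | v k i =>
    have h := al_lt_be k
    have hd : 0 < be k - al k := by linarith
    simp only [On, arc, Set.mem_image, Set.mem_Icc, Prod.mk.injEq]
    constructor
    · rintro ⟨t, ⟨h0, h1⟩, hX, hy⟩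
      refine ⟨⟨?_, ?_⟩, ?_⟩
      · nlinarith
      · nlinarith
      · rw [← hX, hy]
    · rintro ⟨⟨h0, h1⟩, hX⟩
      have hy : al k + (y - al k) / (be k - al k) * (be k - al k) = y := by
        field_simp; ring
      refine ⟨(y - al k) / (be k - al k), ⟨?_, ?_⟩, ?_, hy⟩
      · apply div_nonneg <;> linarith
      · rw [div_le_one hd]; linarith
      · rw [hy, hX]
  | h i =>
    simp only [On, arc, Set.mem_image, Set.mem_Icc, Prod.mk.injEq]
    constructor
    · rintro ⟨t, ⟨h0, h1⟩, hX, hy⟩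
      refine ⟨hy.symm, ?_, ?_⟩ <;> linarith
    · rintro ⟨hy, h0, h1⟩
      refine ⟨(X + cc q - 8 * i) / 8, ⟨?_, ?_⟩, ?_, hy.symm⟩ <;> linarith
  | k i =>
    simp only [On, arc, Set.mem_image, Set.mem_Icc, Prod.mk.injEq]
    constructor
    · rintro ⟨t, ⟨h0, h1⟩, hX, hy⟩
      refine ⟨hy.symm, ?_, ?_⟩ <;> linarith
    · rintro ⟨hy, h0, h1⟩
      refine ⟨(X + cc q - 8 * i) / 8, ⟨?_, ?_⟩, ?_, hy.symm⟩ <;> linarith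
  | z =>
    simp only [On, arc, Set.mem_image, Set.mem_Icc, Prod.mk.injEq]
    constructor
    · rintro ⟨t, ⟨h0, h1⟩, hX, hy⟩
      have : |X| = cc q * |2 * t - 1| := by rw [← hX, abs_mul, abs_of_pos hc]
      have h3 : |2 * t - 1| ≤ 1 := by rw [abs_le]; constructor <;> linarith
      rw [this, ← hy]
      constructor
      · nlinarith
      · ring
    · rintro ⟨h0, h1⟩
      have hX : cc q * (2 * ((X / cc q + 1) / 2) - 1) = X := by field_simp; ring
      have hX' : |X| = cc q * |2 * ((X / cc q + 1) / 2) - 1| := by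
        conv_lhs => rw [← hX, abs_mul, abs_of_pos hc]
      obtain ⟨h2, h3⟩ := abs_le.1 h0
      refine ⟨(X / cc q + 1) / 2, ⟨?_, ?_⟩, hX, ?_⟩
      · have : -1 ≤ X / cc q := by rw [le_div_iff₀ hc]; linarith
        linarith
      · have : X / cc q ≤ 1 := by rw [div_le_one hc]; linarith
        linarith
      · apply mul_left_cancel₀ hc.ne'
        rw [h1, hX']; ring

lemma arc_zero (q : ℕ) (e : Ec) : arc q e 0 = pos q (lo e) := by
  rcases e with ⟨k, i⟩ | i | i | _
  · cases k <;> norm_num [arc, pos, lo, gv, off, al, be]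
  all_goals norm_num [arc, pos, lo]

lemma arc_one (q : ℕ) (e : Ec) : arc q e 1 = pos q (hi q e) := by
  rcases e with ⟨k, i⟩ | i | i | _
  · cases k <;> norm_num [arc, pos, hi, gv, off, al, be]
  · norm_num [arc, pos, hi]; ring
  · norm_num [arc, pos, hi]; ring
  · norm_num [arc, pos, hi, cc]; ring

lemma pos_inj (q : ℕ) : Function.Injective (pos q) := by
  intro u v h
  cases u <;> cases v <;> simp only [pos, Prod.mk.injEq] at h <;> obtain ⟨h1, h2⟩ := h <;>
    first
    | rfl
    | (exfalso; norm_num at h2; done)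
    | (congr 1; apply Nat.cast_injective (R := ℝ); linarith)

/-- crossing pairs -/
inductive Cr : Ec → Ec → Prop
  | ll (i : ℕ) : Cr (.v .LA i) (.v .LB i)
  | rr (i : ℕ) : Cr (.v .RA i) (.v .RB i)
  | mh (i : ℕ) : Cr (.v .M (i+1)) (.h i)
  | mk (i : ℕ) : Cr (.v .M (i+1)) (.k i)
  | lah (i : ℕ) : Cr (.v .LA (i+1)) (.h i)
  | rah (i : ℕ) : Cr (.v .RA i) (.h i)
  | lbk (i : ℕ) : Cr (.v .LB (i+1)) (.k i)
  | rbk (i : ℕ) : Cr (.v .RB i) (.k i)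
  | mz : Cr (.v .M 0) .z
  | laz : Cr (.v .LA 0) .z

def Inc (q : ℕ) (w : Vc) (e : Ec) : Prop := w = lo e ∨ w = hi q e

def Shared (q : ℕ) (e f : Ec) (p : ℝ × ℝ) : Prop :=
  ∃ w, Inc q w e ∧ Inc q w f ∧ p = pos q w

lemma Shared.symm {q : ℕ} {e f : Ec} {p : ℝ × ℝ} (h : Shared q e f p) : Shared q f e p := by
  obtain ⟨w, h1, h2, h3⟩ := h
  exact ⟨w, h2, h1, h3⟩

def Good (q : ℕ) (e f : Ec) (p : ℝ × ℝ) : Prop := Shared q e f p ∨ Cr e f ∨ Cr f e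

lemma Good.symm {q : ℕ} {e f : Ec} {p : ℝ × ℝ} (h : Good q e f p) : Good q f e p := by
  rcases h with h | h | h
  · exact Or.inl h.symm
  · exact Or.inr (Or.inr h)
  · exact Or.inr (Or.inl h)

lemma idx_eq {i j : ℕ} {d d' : ℝ} (h : 8 * (i:ℝ) + d = 8 * j + d') (h1 : -4 ≤ d) (h2 : d ≤ 3)
    (h3 : -4 ≤ d') (h4 : d' ≤ 3) : i = j ∧ d = d' := by
  have hij : i = j := by
    have a1 : (i:ℝ) < j + 1 := by linarith
    have a2 : (j:ℝ) < i + 1 := by linarith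
    have a1' : i < j + 1 := by exact_mod_cast a1
    have a2' : j < i + 1 := by exact_mod_cast a2
    omega
  subst hij
  exact ⟨rfl, by linarith⟩

lemma off_bd {k : VK} {y : ℝ} (h1 : al k ≤ y) (h2 : y ≤ be k) : -4 ≤ off k y ∧ off k y ≤ 3 := by
  cases k <;> simp only [al, be, off] at * <;> constructor <;> linarith

lemma al_ge (k : VK) : -2 ≤ al k := by cases k <;> norm_num [al]
lemma be_le (k : VK) : be k ≤ 2 := by cases k <;> norm_num [be]

lemma hi_of_top {q : ℕ} {k : VK} {i : ℕ} (h : 2 ≤ be k) : hi q (.v k i) = .a := by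
  cases k <;> norm_num [be] at h <;> rfl
lemma lo_of_bot {k : VK} {i : ℕ} (h : al k ≤ -2) : lo (.v k i) = .b := by
  cases k <;> norm_num [al] at h <;> rfl

lemma on_x {q i : ℕ} {k : VK} {X y : ℝ} (hy : y = 1) (ho : off k y = 0)
    (hX : X = gv q k i y) : (X, y) = pos q (.x i) := by
  subst hy; simp only [gv, ho] at hX; norm_num at hX; simp [pos, hX]

lemma on_y {q i : ℕ} {k : VK} {X y : ℝ} (hy : y = -1) (ho : off k y = 0)
    (hX : X = gv q k i y) : (X, y) = pos q (.y i) := by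
  subst hy; simp only [gv, ho] at hX; norm_num at hX; simp [pos, hX]

lemma good_vv {q : ℕ} {k k' : VK} {i i' : ℕ} {p : ℝ × ℝ} (he : evl q (.v k i))
    (hf : evl q (.v k' i')) (hne : Ec.v k i ≠ Ec.v k' i')
    (h1 : On q (.v k i) p) (h2 : On q (.v k' i') p) : Good q (.v k i) (.v k' i') p := by
  obtain ⟨X, y⟩ := p
  obtain ⟨⟨ha, hb⟩, hX⟩ := h1
  obtain ⟨⟨ha', hb'⟩, hX'⟩ := h2
  simp only at ha hb hX ha' hb' hX'
  have l1 := al_ge k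
  have l2 := be_le k
  by_cases hy2 : y = 2
  · left
    refine ⟨.a, Or.inr (hi_of_top (by linarith)).symm, Or.inr (hi_of_top (by linarith)).symm, ?_⟩
    rw [hX, hy2]; norm_num [gv, pos]
  by_cases hy3 : y = -2
  · left
    refine ⟨.b, Or.inl (lo_of_bot (by linarith)).symm, Or.inl (lo_of_bot (by linarith)).symm, ?_⟩
    rw [hX, hy3]; norm_num [gv, pos]
  have hyl : y < 2 := lt_of_le_of_ne (by linarith) hy2
  have hyg : -2 < y := lt_of_le_of_ne (by linarith) (Ne.symm hy3)
  have hpos : 2 - |y| ≠ 0 := by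
    have : |y| < 2 := abs_lt.2 ⟨hyg, hyl⟩
    linarith
  have hu : 8 * (i:ℝ) + off k y - cc q = 8 * i' + off k' y - cc q := by
    apply mul_right_cancel₀ hpos
    rw [hX] at hX'; exact hX'
  obtain ⟨o1, o2⟩ := off_bd ha hb
  obtain ⟨o3, o4⟩ := off_bd ha' hb'
  obtain ⟨hii, hoo⟩ := idx_eq (i := i) (j := i') (by linarith) o1 o2 o3 o4
  subst hii
  have kx : y = 1 → off k y = 0 → Inc q (.x i) (.v k i) → Inc q (.x i) (.v k' i) →
      Good q (.v k i) (.v k' i) (X, y) :=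
    fun hy ho a b => Or.inl ⟨.x i, a, b, on_x hy ho hX⟩
  have ky : y = -1 → off k y = 0 → Inc q (.y i) (.v k i) → Inc q (.y i) (.v k' i) →
      Good q (.v k i) (.v k' i) (X, y) :=
    fun hy ho a b => Or.inl ⟨.y i, a, b, on_y hy ho hX⟩
  cases k <;> cases k' <;> simp only [off, al, be, evl] at * <;>
    first
    | exact absurd rfl hne
    | (exfalso; linarith)
    | (exfalso; omega)
    | exact Or.inr (Or.inl (Cr.ll _))
    | exact Or.inr (Or.inl (Cr.rr _))
    | exact Or.inr (Or.inr (Cr.ll _))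
    | exact Or.inr (Or.inr (Cr.rr _))
    | (refine kx ?_ ?_ ?_ ?_ <;> first | trivial | linarith | (simp [Inc, lo, hi]; done))
    | (refine ky ?_ ?_ ?_ ?_ <;> first | trivial | linarith | (simp [Inc, lo, hi]; done))

/-- two consecutive-index possibilities -/
lemma idx_h {i j : ℕ} {d : ℝ} (h1 : 8 * (j:ℝ) ≤ 8 * i + d) (h2 : 8 * (i:ℝ) + d ≤ 8 * j + 8)
    (hd : -8 < d) (hd' : d < 8) : (i = j ∧ 0 ≤ d) ∨ (i = j + 1 ∧ d ≤ 0) := by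
  have a1 : (j:ℝ) < i + 1 := by linarith
  have a2 : (i:ℝ) < j + 2 := by linarith
  have a1' : j < i + 1 := by exact_mod_cast a1
  have a2' : i < j + 2 := by exact_mod_cast a2
  have : i = j ∨ i = j + 1 := by omega
  rcases this with h | h
  · subst h; left; exact ⟨rfl, by linarith⟩
  · subst h; right; push_cast at h2; exact ⟨rfl, by linarith⟩

lemma good_vh {q : ℕ} {k : VK} {i j : ℕ} {p : ℝ × ℝ}
    (h1 : On q (.v k i) p) (h2 : On q (.h j) p) : Good q (.v k i) (.h j) p := by
  obtain ⟨X, y⟩ := p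
  obtain ⟨⟨ha, hb⟩, hX⟩ := h1
  obtain ⟨hy, hl, hr⟩ := h2
  simp only at ha hb hX hy hl hr
  subst hy
  have hX2 : X = 8 * i + off k 1 - cc q := by rw [hX]; norm_num [gv]
  obtain ⟨o1, o2⟩ := off_bd ha hb
  have hidx := idx_h (i := i) (j := j) (d := off k 1) (by linarith) (by linarith) (by linarith) (by linarith)
  have kx : off k 1 = 0 → Inc q (.x i) (.v k i) → Good q (.v k i) (.h j) (X, 1) := by
    intro ho a
    refine Or.inl ⟨.x i, a, ?_, on_x rfl ho hX⟩
    rcases hidx with ⟨h, -⟩ | ⟨h, -⟩ <;> subst h <;> simp [Inc, lo, hi]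
  cases k <;> simp only [off, al, be] at * <;>
    first
    | (exfalso; linarith)
    | (refine kx ?_ ?_ <;> first | trivial | (norm_num; done) | (simp [Inc, lo, hi]; done))
    | (rcases hidx with ⟨h, h'⟩ | ⟨h, h'⟩ <;> subst h <;> first
        | (exfalso; linarith)
        | exact Or.inr (Or.inl (Cr.mh _))
        | exact Or.inr (Or.inl (Cr.lah _))
        | exact Or.inr (Or.inl (Cr.rah _)))

lemma good_vk {q : ℕ} {k : VK} {i j : ℕ} {p : ℝ × ℝ}
    (h1 : On q (.v k i) p) (h2 : On q (.k j) p) : Good q (.v k i) (.k j) p := by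
  obtain ⟨X, y⟩ := p
  obtain ⟨⟨ha, hb⟩, hX⟩ := h1
  obtain ⟨hy, hl, hr⟩ := h2
  simp only at ha hb hX hy hl hr
  subst hy
  have hX2 : X = 8 * i + off k (-1) - cc q := by rw [hX]; norm_num [gv]
  obtain ⟨o1, o2⟩ := off_bd ha hb
  have hidx := idx_h (i := i) (j := j) (d := off k (-1)) (by linarith) (by linarith) (by linarith) (by linarith)
  have kx : off k (-1) = 0 → Inc q (.y i) (.v k i) → Good q (.v k i) (.k j) (X, -1) := by
    intro ho a
    refine Or.inl ⟨.y i, a, ?_, on_y rfl ho hX⟩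
    rcases hidx with ⟨h, -⟩ | ⟨h, -⟩ <;> subst h <;> simp [Inc, lo, hi]
  cases k <;> simp only [off, al, be] at * <;>
    first
    | (exfalso; linarith)
    | (refine kx ?_ ?_ <;> first | trivial | (norm_num; done) | (simp [Inc, lo, hi]; done))
    | (rcases hidx with ⟨h, h'⟩ | ⟨h, h'⟩ <;> subst h <;> first
        | (exfalso; linarith)
        | exact Or.inr (Or.inl (Cr.mk _))
        | exact Or.inr (Or.inl (Cr.lbk _))
        | exact Or.inr (Or.inl (Cr.rbk _)))

lemma z_ge {q : ℕ} {p : ℝ × ℝ} (h : On q .z p) : 1 ≤ p.2 := by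
  obtain ⟨h1, h2⟩ := h
  have hc := cc_pos q
  have : cc q * 1 ≤ cc q * p.2 := by linarith
  exact le_of_mul_le_mul_left this hc

lemma good_vz {q : ℕ} {k : VK} {i : ℕ} {p : ℝ × ℝ} (he : evl q (.v k i))
    (h1 : On q (.v k i) p) (h2 : On q .z p) : Good q (.v k i) .z p := by
  have hc := cc_pos q
  have hy1 := z_ge h2
  obtain ⟨X, y⟩ := p
  obtain ⟨⟨ha, hb⟩, hX⟩ := h1
  obtain ⟨hXc, hZ⟩ := h2
  simp only at ha hb hX hXc hZ hy1
  have l2 := be_le k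
  have hi' : i < 2 * q + 4 := by cases k <;> simp only [evl] at he <;> omega
  obtain ⟨o1, o2⟩ := off_bd ha hb
  simp only [gv] at hX
  rw [abs_of_nonneg (by linarith : (0:ℝ) ≤ y)] at hX
  have hy2 : y < 2 := by
    apply lt_of_le_of_ne (by linarith)
    rintro rfl
    rw [hX] at hZ; norm_num at hZ; linarith
  have hU : ((8 * (i:ℝ) + off k y ≤ 0 ∧ (8 * (i:ℝ) + off k y = 0 → y = 1)) ∨
      (2 * cc q ≤ 8 * (i:ℝ) + off k y ∧ (8 * (i:ℝ) + off k y = 2 * cc q → y = 1))) := by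
    generalize 8 * (i:ℝ) + off k y = U at *
    have h2y : 0 < 2 - y := by linarith
    rcases abs_cases X with ⟨hx, hx'⟩ | ⟨hx, hx'⟩
    · right
      rw [hx, hX] at hZ
      have e : 2 * ((U - 2 * cc q) * (2 - y)) = cc q * (y - 1) := by linarith
      constructor
      · by_contra hcon
        push Not at hcon
        have : (U - 2 * cc q) * (2 - y) < 0 := mul_neg_of_neg_of_pos (by linarith) h2y
        have : 0 ≤ cc q * (y - 1) := mul_nonneg hc.le (by linarith)
        linarith
      · intro h
        rw [h] at e
        have : cc q * (y - 1) = 0 := by linarith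
        rcases mul_eq_zero.1 this with h | h <;> linarith
    · left
      rw [hx, hX] at hZ
      have e : 2 * (U * (2 - y)) = - (cc q * (y - 1)) := by linarith
      constructor
      · by_contra hcon
        push Not at hcon
        have : 0 < U * (2 - y) := mul_pos hcon h2y
        have : 0 ≤ cc q * (y - 1) := mul_nonneg hc.le (by linarith)
        linarith
      · intro h
        rw [h] at e
        have : cc q * (y - 1) = 0 := by linarith
        rcases mul_eq_zero.1 this with h | h <;> linarith
  rcases hU with ⟨hU, hU1⟩ | ⟨hU, hU1⟩
  · have hi0 : i = 0 := by
      have : (i:ℝ) < 1 := by linarith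
      have : i < 1 := by exact_mod_cast this
      omega
    subst hi0
    have kx : off k y = 0 → Inc q (.x 0) (.v k 0) → Good q (.v k 0) .z (X, y) := by
      intro ho a
      have hy : y = 1 := hU1 (by rw [ho]; norm_num)
      refine Or.inl ⟨.x 0, a, by simp [Inc, lo], ?_⟩
      rw [ho] at hX
      simp only [pos, Prod.mk.injEq]
      exact ⟨by rw [hX, hy]; ring, hy⟩
    norm_num at hU hU1
    cases k <;> simp only [off, al, be, evl] at * <;>
      first
      | (exfalso; linarith)
      | (exfalso; omega)
      | exact Or.inr (Or.inl Cr.mz)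
      | exact Or.inr (Or.inl Cr.laz)
      | (refine kx ?_ ?_ <;> first | trivial | linarith | (simp [Inc, lo, hi]; done))
  · have hi0 : i = 2 * q + 3 := by
      have : (2 * q + 2 : ℝ) < i := by unfold cc at hU; linarith
      have : 2 * q + 2 < i := by exact_mod_cast this
      omega
    have h2c : 2 * cc q = 8 * (i:ℝ) := by rw [hi0]; unfold cc; push_cast; ring
    have kx : off k y = 0 → Inc q (.x i) (.v k i) → Good q (.v k i) .z (X, y) := by
      intro ho a
      have hy : y = 1 := hU1 (by rw [ho]; linarith)
      refine Or.inl ⟨.x i, a, by simp [Inc, hi, hi0], ?_⟩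
      rw [ho] at hX
      simp only [pos, Prod.mk.injEq]
      exact ⟨by rw [hX, hy]; ring, hy⟩
    cases k <;> simp only [off, al, be, evl] at * <;>
      first
      | (exfalso; linarith)
      | (exfalso; omega)
      | (refine kx ?_ ?_ <;> first | trivial | linarith | (simp [Inc, lo, hi]; done))

lemma good_hh {q : ℕ} {i j : ℕ} {p : ℝ × ℝ} (hne : i ≠ j)
    (h1 : On q (.h i) p) (h2 : On q (.h j) p) : Good q (.h i) (.h j) p := by
  obtain ⟨X, y⟩ := p
  obtain ⟨hy, hl, hr⟩ := h1
  obtain ⟨hy', hl', hr'⟩ := h2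
  simp only at hy hl hr hy' hl' hr'
  subst hy
  left
  have a1 : (i:ℝ) ≤ j + 1 := by linarith
  have a2 : (j:ℝ) ≤ i + 1 := by linarith
  have a1' : i ≤ j + 1 := by exact_mod_cast a1
  have a2' : j ≤ i + 1 := by exact_mod_cast a2
  have : i = j + 1 ∨ j = i + 1 := by omega
  rcases this with h | h <;> subst h <;> push_cast at *
  · refine ⟨.x (j+1), by simp [Inc, lo], by simp [Inc, hi], ?_⟩
    simp only [pos, Prod.mk.injEq]; push_cast
    exact ⟨by linarith, trivial⟩
  · refine ⟨.x (i+1), by simp [Inc, hi], by simp [Inc, lo], ?_⟩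
    simp only [pos, Prod.mk.injEq]; push_cast
    exact ⟨by linarith, trivial⟩

lemma good_kk {q : ℕ} {i j : ℕ} {p : ℝ × ℝ} (hne : i ≠ j)
    (h1 : On q (.k i) p) (h2 : On q (.k j) p) : Good q (.k i) (.k j) p := by
  obtain ⟨X, y⟩ := p
  obtain ⟨hy, hl, hr⟩ := h1
  obtain ⟨hy', hl', hr'⟩ := h2
  simp only at hy hl hr hy' hl' hr'
  subst hy
  left
  have a1 : (i:ℝ) ≤ j + 1 := by linarith
  have a2 : (j:ℝ) ≤ i + 1 := by linarith
  have a1' : i ≤ j + 1 := by exact_mod_cast a1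
  have a2' : j ≤ i + 1 := by exact_mod_cast a2
  have : i = j + 1 ∨ j = i + 1 := by omega
  rcases this with h | h <;> subst h <;> push_cast at *
  · refine ⟨.y (j+1), by simp [Inc, lo], by simp [Inc, hi], ?_⟩
    simp only [pos, Prod.mk.injEq]; push_cast
    exact ⟨by linarith, trivial⟩
  · refine ⟨.y (i+1), by simp [Inc, hi], by simp [Inc, lo], ?_⟩
    simp only [pos, Prod.mk.injEq]; push_cast
    exact ⟨by linarith, trivial⟩

lemma good_hz {q : ℕ} {i : ℕ} {p : ℝ × ℝ} (he : evl q (.h i))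
    (h1 : On q (.h i) p) (h2 : On q .z p) : Good q (.h i) .z p := by
  obtain ⟨X, y⟩ := p
  obtain ⟨hy, hl, hr⟩ := h1
  obtain ⟨hXc, hZ⟩ := h2
  simp only [evl] at hy hl hr hXc hZ he
  subst hy
  left
  rcases abs_cases X with ⟨hx, hx'⟩ | ⟨hx, hx'⟩
  · have hX : X = cc q := by linarith
    have h3 : (2 * q + 2 : ℝ) ≤ i := by unfold cc at *; linarith
    have h3' : 2 * q + 2 ≤ i := by exact_mod_cast h3
    have : i = 2 * q + 2 := by omega
    refine ⟨.x (i+1), by simp [Inc, hi], by simp [Inc, hi, this], ?_⟩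
    simp only [pos, Prod.mk.injEq]
    refine ⟨?_, trivial⟩
    rw [hX, this]; unfold cc; push_cast; ring
  · have hX : X = - cc q := by linarith
    have h3 : (i:ℝ) ≤ 0 := by linarith
    have h3' : i ≤ 0 := by exact_mod_cast h3
    have : i = 0 := by omega
    subst this
    refine ⟨.x 0, by simp [Inc, lo], by simp [Inc, lo], ?_⟩
    simp only [pos, Prod.mk.injEq]
    refine ⟨?_, trivial⟩
    rw [hX]; simp

lemma good_hk {q : ℕ} {i j : ℕ} {p : ℝ × ℝ}
    (h1 : On q (.h i) p) (h2 : On q (.k j) p) : Good q (.h i) (.k j) p := by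
  exfalso; linarith [h1.1, h2.1]

lemma good_kz {q : ℕ} {i : ℕ} {p : ℝ × ℝ}
    (h1 : On q (.k i) p) (h2 : On q .z p) : Good q (.k i) .z p := by
  exfalso; linarith [h1.1, z_ge h2]

lemma master {q : ℕ} {e f : Ec} {p : ℝ × ℝ} (he : evl q e) (hf : evl q f) (hne : e ≠ f)
    (h1 : On q e p) (h2 : On q f p) : Good q e f p := by
  cases e with
  | v k i => cases f with
    | v k' j => exact good_vv he hf hne h1 h2
    | h j => exact good_vh h1 h2
    | k j => exact good_vk h1 h2
    | z => exact good_vz he h1 h2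
  | h i => cases f with
    | v k' j => exact (good_vh h2 h1).symm
    | h j => exact good_hh (fun h => hne (by rw [h])) h1 h2
    | k j => exact good_hk h1 h2
    | z => exact good_hz he h1 h2
  | k i => cases f with
    | v k' j => exact (good_vk h2 h1).symm
    | h j => exact (good_hk h2 h1).symm
    | k j => exact good_kk (fun h => hne (by rw [h])) h1 h2
    | z => exact good_kz h1 h2
  | z => cases f with
    | v k' j => exact (good_vz hf h2 h1).symm
    | h j => exact (good_hz hf h2 h1).symm
    | k j => exact (good_kz h2 h1).symm
    | z => exact absurd rfl hne

lemma Cr.disj {q : ℕ} {e f : Ec} (h : Cr e f) (w : Vc) (h1 : Inc q w e) (h2 : Inc q w f) :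
    False := by
  cases h <;> rcases h1 with rfl | rfl <;> simp [Inc, lo, hi] at h2

lemma Cr.ne {e f : Ec} (h : Cr e f) : e ≠ f := by
  rintro rfl
  cases h

lemma z_v_unique {q : ℕ} {k : VK} (hk : k = .M ∨ k = .LA) {p p' : ℝ × ℝ}
    (h1 : On q (.v k 0) p) (h2 : On q .z p)
    (h1' : On q (.v k 0) p') (h2' : On q .z p') : p.2 = p'.2 := by
  have hc := cc_pos q
  have key : ∀ p : ℝ × ℝ, On q (.v k 0) p → On q .z p → 1 ≤ p.2 ∧ p.2 ≤ 2 ∧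
      2 * (- off k p.2 * (2 - p.2)) = cc q * (p.2 - 1) := by
    rintro ⟨X, y⟩ h1 h2
    have hy1 := z_ge h2
    obtain ⟨⟨ha, hb⟩, hX⟩ := h1
    obtain ⟨hXc, hZ⟩ := h2
    have l2 := be_le k
    simp only at ha hb hX hXc hZ hy1 ⊢
    simp only [gv] at hX
    rw [abs_of_nonneg (by linarith : (0:ℝ) ≤ y)] at hX
    have hX0 : X ≤ 0 := by
      rw [hX]
      apply mul_nonpos_of_nonpos_of_nonneg
      · rcases hk with rfl | rfl <;> simp only [off] <;> push_cast <;> linarith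
      · linarith
    rw [abs_of_nonpos hX0, hX] at hZ
    push_cast at hZ
    refine ⟨hy1, by linarith, by linarith⟩
  obtain ⟨a1, a2, a3⟩ := key p h1 h2
  obtain ⟨b1, b2, b3⟩ := key p' h1' h2'
  rcases hk with rfl | rfl <;> simp only [off] at a3 b3
  · have : (p.2 - p'.2) * (8 + cc q) = 0 := by linarith
    rcases mul_eq_zero.1 this with h | h <;> linarith
  · have : (p.2 - p'.2) * (2 * (p.2 + p'.2) - 2 + cc q) = 0 := by linarith
    rcases mul_eq_zero.1 this with h | h <;> linarith

lemma Cr.unique {q : ℕ} {e f : Ec} (h : Cr e f) {p p' : ℝ × ℝ}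
    (h1 : On q e p) (h2 : On q f p) (h1' : On q e p') (h2' : On q f p') : p = p' := by
  have vv : ∀ k i, On q (.v k i) p → On q (.v k i) p' → p.2 = p'.2 → p = p' := by
    intro k i a b hy
    exact Prod.ext (by rw [a.2, b.2, hy]) hy
  have y0 : ∀ (k k' : VK) (i : ℕ), (k = .LA ∧ k' = .LB) ∨ (k = .RA ∧ k' = .RB) →
      ∀ p : ℝ × ℝ, On q (.v k i) p → On q (.v k' i) p → p.2 = 0 := by
    rintro k k' i hk ⟨X, y⟩ ⟨⟨a1, a2⟩, a3⟩ ⟨⟨b1, b2⟩, b3⟩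
    simp only at a1 a2 a3 b1 b2 b3 ⊢
    rcases hk with ⟨rfl, rfl⟩ | ⟨rfl, rfl⟩ <;> simp only [al, be, gv, off] at * <;>
    · have hy : |y| ≤ 1 := abs_le.2 ⟨by linarith, by linarith⟩
      have h2 : (2 - |y|) ≠ 0 := by linarith
      rw [a3] at b3
      have := mul_right_cancel₀ h2 b3
      linarith
  cases h with
  | ll i => exact vv _ _ h1 h1' (by
      rw [y0 _ _ i (Or.inl ⟨rfl, rfl⟩) p h1 h2, y0 _ _ i (Or.inl ⟨rfl, rfl⟩) p' h1' h2'])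
  | rr i => exact vv _ _ h1 h1' (by
      rw [y0 _ _ i (Or.inr ⟨rfl, rfl⟩) p h1 h2, y0 _ _ i (Or.inr ⟨rfl, rfl⟩) p' h1' h2'])
  | mh i => exact vv _ _ h1 h1' (by rw [h2.1, h2'.1])
  | mk i => exact vv _ _ h1 h1' (by rw [h2.1, h2'.1])
  | lah i => exact vv _ _ h1 h1' (by rw [h2.1, h2'.1])
  | rah i => exact vv _ _ h1 h1' (by rw [h2.1, h2'.1])
  | lbk i => exact vv _ _ h1 h1' (by rw [h2.1, h2'.1])
  | rbk i => exact vv _ _ h1 h1' (by rw [h2.1, h2'.1])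
  | mz => exact vv _ _ h1 h1' (z_v_unique (Or.inl rfl) h1 h2 h1' h2')
  | laz => exact vv _ _ h1 h1' (z_v_unique (Or.inr rfl) h1 h2 h1' h2')

/-- the two candidates for edges crossing a given edge -/
def c1 : Ec → Ec
  | .v .M 0 => .z
  | .v .M (i+1) => .h i
  | .v .LA i => .v .LB i
  | .v .RA i => .v .RB i
  | .v .LB i => .v .LA i
  | .v .RB i => .v .RA i
  | .h i => .v .M (i+1)
  | .k i => .v .M (i+1)
  | .z => .v .M 0
  | e => e

def c2 : Ec → Ec
  | .v .M (i+1) => .k i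
  | .v .LA 0 => .z
  | .v .LA (i+1) => .h i
  | .v .RA i => .h i
  | .v .LB (i+1) => .k i
  | .v .RB i => .k i
  | .h i => if i % 2 = 0 then .v .RA i else .v .LA (i+1)
  | .k i => if i % 2 = 0 then .v .RB i else .v .LB (i+1)
  | .z => .v .LA 0
  | e => e

lemma Cr.cand {q : ℕ} {e f : Ec} (h : Cr e f) (he : evl q e) :
    (f = c1 e ∨ f = c2 e) ∧ (e = c1 f ∨ e = c2 f) := by
  cases h with
  | lah i =>
    have : ¬ (i % 2 = 0) := by simp only [evl] at he; omega
    simp [c1, c2, this]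
  | lbk i =>
    have : ¬ (i % 2 = 0) := by simp only [evl] at he; omega
    simp [c1, c2, this]
  | rah i =>
    have : (i % 2 = 0) := by simp only [evl] at he; omega
    simp [c1, c2, this]
  | rbk i =>
    have : (i % 2 = 0) := by simp only [evl] at he; omega
    simp [c1, c2, this]
  | _ => simp [c1, c2]

/-- vertices on edges -/
lemma on_vertex {q : ℕ} {e : Ec} {w : Vc} (he : evl q e) (hw : vval q w)
    (h : On q e (pos q w)) : Inc q w e := by
  have hc := cc_pos q
  rcases e with ⟨k, i⟩ | i | i | _
  · cases w with
    | a =>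
      obtain ⟨⟨h1, h2⟩, -⟩ := h
      exact Or.inr (hi_of_top h2).symm
    | b =>
      obtain ⟨⟨h1, h2⟩, -⟩ := h
      exact Or.inl (lo_of_bot h1).symm
    | x j =>
      obtain ⟨⟨h1, h2⟩, h3⟩ := h
      simp only [pos, gv] at h1 h2 h3
      norm_num at h3
      obtain ⟨o1, o2⟩ := off_bd h1 h2
      obtain ⟨hij, ho⟩ := idx_eq (i := j) (j := i) (d := 0) (d' := off k 1) (by linarith)
        (by norm_num) (by norm_num) o1 o2
      subst hij
      cases k <;> simp only [off, al, be] at ho h1 h2 <;>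
        first | (exfalso; linarith) | simp [Inc, lo, hi]
    | y j =>
      obtain ⟨⟨h1, h2⟩, h3⟩ := h
      simp only [pos, gv] at h1 h2 h3
      norm_num at h3
      obtain ⟨o1, o2⟩ := off_bd h1 h2
      obtain ⟨hij, ho⟩ := idx_eq (i := j) (j := i) (d := 0) (d' := off k (-1)) (by linarith)
        (by norm_num) (by norm_num) o1 o2
      subst hij
      cases k <;> simp only [off, al, be] at ho h1 h2 <;>
        first | (exfalso; linarith) | simp [Inc, lo, hi]
  · cases w with
    | x j =>
      obtain ⟨-, h2, h3⟩ := h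
      simp only [pos] at h2 h3
      rcases idx_h (i := j) (j := i) (d := 0) (by linarith) (by linarith) (by norm_num) (by norm_num)
        with ⟨h, -⟩ | ⟨h, -⟩ <;> simp [Inc, lo, hi, h]
    | _ => exfalso; have := h.1; norm_num [pos] at this
  · cases w with
    | y j =>
      obtain ⟨-, h2, h3⟩ := h
      simp only [pos] at h2 h3
      rcases idx_h (i := j) (j := i) (d := 0) (by linarith) (by linarith) (by norm_num) (by norm_num)
        with ⟨h, -⟩ | ⟨h, -⟩ <;> simp [Inc, lo, hi, h]
    | _ => exfalso; have := h.1; norm_num [pos] at this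
  · cases w with
    | a => exfalso; have := h.2; norm_num [pos] at this; linarith
    | b => exfalso; have := z_ge h; norm_num [pos] at this
    | y j => exfalso; have := z_ge h; norm_num [pos] at this
    | x j =>
      obtain ⟨h1, h2⟩ := h
      simp only [pos, vval] at h1 h2 hw
      rcases abs_cases (8 * (j:ℝ) - cc q) with ⟨hx, hx'⟩ | ⟨hx, hx'⟩
      · have : (j:ℝ) = 2 * q + 3 := by unfold cc at *; linarith
        have : j = 2 * q + 3 := by exact_mod_cast this
        simp [Inc, hi, this]
      · have : (j:ℝ) = 0 := by linarith
        have : j = 0 := by exact_mod_cast this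
        simp [Inc, lo, this]

def col : Vc → Bool
  | .a => true
  | .b => false
  | .x i => decide (i % 2 = 0)
  | .y i => decide (i % 2 = 1)

lemma col_ne {q : ℕ} {e : Ec} (he : evl q e) : col (lo e) ≠ col (hi q e) := by
  rcases e with ⟨k, i⟩ | i | i | _
  · cases k <;> simp only [evl] at he <;> simp [col, lo, hi] <;> omega
  all_goals simp [col, lo, hi] <;> try omega

lemma lo_val {q : ℕ} {e : Ec} (he : evl q e) : vval q (lo e) := by
  rcases e with ⟨k, i⟩ | i | i | _
  · cases k <;> first | trivial | (simp only [evl, vval, lo] at he ⊢; omega)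
  all_goals simp only [evl, vval, lo] at he ⊢; omega

lemma hi_val {q : ℕ} {e : Ec} (he : evl q e) : vval q (hi q e) := by
  rcases e with ⟨k, i⟩ | i | i | _
  · cases k <;> first | trivial | (simp only [evl, vval, hi] at he ⊢; omega)
  all_goals simp only [evl, vval, hi] at he ⊢; omega

/-- parallel pairs, ordered -/
inductive Par : Ec → Ec → Prop
  | m (i j : ℕ) (h : i < j) : Par (.v .M i) (.v .M j)
  | a (i : ℕ) : Par (.v .LA i) (.v .RA i)
  | b (i : ℕ) : Par (.v .LB i) (.v .RB i)

lemma par_of {q : ℕ} {e f : Ec} (he : evl q e) (hf : evl q f) (hne : e ≠ f)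
    (h : (lo e = lo f ∧ hi q e = hi q f) ∨ (lo e = hi q f ∧ hi q e = lo f)) :
    Par e f ∨ Par f e := by
  rcases e with ⟨k, i⟩ | i | i | _ <;> rcases f with ⟨k', j⟩ | j | j | _ <;>
    (try cases k) <;> (try cases k') <;> simp [lo, hi] at h hne <;>
    simp only [evl] at he hf <;>
    first
    | (exfalso; omega)
    | (subst h; exact Or.inl (Par.a _))
    | (subst h; exact Or.inr (Par.a _))
    | (subst h; exact Or.inl (Par.b _))
    | (subst h; exact Or.inr (Par.b _))
    | (rcases lt_or_gt_of_ne hne with h | h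
       · exact Or.inl (Par.m _ _ h)
       · exact Or.inr (Par.m _ _ h))

lemma two_curve (g1 g2 : ℝ → ℝ) (hc1 : Continuous g1) (hc2 : Continuous g2) {α β : ℝ}
    (hα : g1 α = g2 α) (hβ : g1 β = g2 β) (hlt : ∀ y, α < y → y < β → g1 y < g2 y)
    (C : Set (ℝ × ℝ))
    (hC : ∀ p, p ∈ C ↔ (α ≤ p.2 ∧ p.2 ≤ β) ∧ (p.1 = g1 p.2 ∨ p.1 = g2 p.2))
    (qi qo : ℝ × ℝ) (hqi : (α < qi.2 ∧ qi.2 < β) ∧ g1 qi.2 < qi.1 ∧ qi.1 < g2 qi.2)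
    (hqo : qo.2 < α ∨ β < qo.2 ∨ qo.1 < g1 qo.2 ∨ g2 qo.2 < qo.1)
    (p : ℝ × ℝ) (hp : p ∉ C) :
    qi ∈ connectedComponentIn Cᶜ p ∨ qo ∈ connectedComponentIn Cᶜ p := by
  have hle : ∀ y, α ≤ y → y ≤ β → g1 y ≤ g2 y := by
    intro y h1 h2
    rcases h1.eq_or_lt with rfl | h1
    · exact hα.le
    rcases h2.eq_or_lt with rfl | h2
    · exact hβ.le
    exact (hlt y h1 h2).le
  set I : Set (ℝ × ℝ) := {p | (α < p.2 ∧ p.2 < β) ∧ g1 p.2 < p.1 ∧ p.1 < g2 p.2} with hI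
  set T : Set (ℝ × ℝ) := {p | β < p.2} with hT
  set B : Set (ℝ × ℝ) := {p | p.2 < α} with hB
  set L : Set (ℝ × ℝ) := {p | p.1 < g1 p.2} with hL
  set R : Set (ℝ × ℝ) := {p | g2 p.2 < p.1} with hR
  have cI : IsPreconnected I := by
    have h1 : IsPreconnected ((Set.Ioo (0:ℝ) 1) ×ˢ (Set.Ioo α β)) :=
      isPreconnected_Ioo.prod isPreconnected_Ioo
    have h2 := h1.image (fun s : ℝ × ℝ => ((1 - s.1) * g1 s.2 + s.1 * g2 s.2, s.2))
      (by fun_prop)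
    convert h2 using 1
    ext ⟨X, y⟩
    simp only [hI, Set.mem_ofPred_eq, Set.mem_image, Set.mem_prod, Set.mem_Ioo, Prod.mk.injEq,
      Prod.exists]
    constructor
    · rintro ⟨⟨h1, h2⟩, h3, h4⟩
      have hd : 0 < g2 y - g1 y := by linarith
      refine ⟨(X - g1 y) / (g2 y - g1 y), y, ⟨⟨?_, ?_⟩, h1, h2⟩, ?_, rfl⟩
      · apply div_pos <;> linarith
      · rw [div_lt_one hd]; linarith
      · field_simp; ring
    · rintro ⟨s, y', ⟨⟨h1, h2⟩, h3, h4⟩, rfl, rfl⟩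
      have hd := hlt _ h3 h4
      refine ⟨⟨h3, h4⟩, ?_, ?_⟩ <;> nlinarith
  have cT : IsPreconnected T := by
    have h1 : IsPreconnected ((Set.univ : Set ℝ) ×ˢ (Set.Ioi β)) :=
      isPreconnected_univ.prod isPreconnected_Ioi
    convert h1 using 1
    ext ⟨X, y⟩; simp [hT]
  have cB : IsPreconnected B := by
    have h1 : IsPreconnected ((Set.univ : Set ℝ) ×ˢ (Set.Iio α)) :=
      isPreconnected_univ.prod isPreconnected_Iio
    convert h1 using 1
    ext ⟨X, y⟩; simp [hB]
  have cL : IsPreconnected L := by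
    have h1 : IsPreconnected ((Set.Iio (0:ℝ)) ×ˢ (Set.univ : Set ℝ)) :=
      isPreconnected_Iio.prod isPreconnected_univ
    have h2 := h1.image (fun s : ℝ × ℝ => (s.1 + g1 s.2, s.2)) (by fun_prop)
    convert h2 using 1
    ext ⟨X, y⟩
    simp only [hL, Set.mem_ofPred_eq, Set.mem_image, Set.mem_prod, Set.mem_Iio, Prod.mk.injEq,
      Prod.exists, Set.mem_univ, and_true]
    constructor
    · intro h
      exact ⟨X - g1 y, y, by linarith, by ring, rfl⟩
    · rintro ⟨s, y', h, rfl, rfl⟩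
      linarith
  have cR : IsPreconnected R := by
    have h1 : IsPreconnected ((Set.Ioi (0:ℝ)) ×ˢ (Set.univ : Set ℝ)) :=
      isPreconnected_Ioi.prod isPreconnected_univ
    have h2 := h1.image (fun s : ℝ × ℝ => (s.1 + g2 s.2, s.2)) (by fun_prop)
    convert h2 using 1
    ext ⟨X, y⟩
    simp only [hR, Set.mem_ofPred_eq, Set.mem_image, Set.mem_prod, Set.mem_Ioi, Prod.mk.injEq,
      Prod.exists, Set.mem_univ, and_true]
    constructor
    · intro h
      exact ⟨X - g2 y, y, by linarith, by ring, rfl⟩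
    · rintro ⟨s, y', h, rfl, rfl⟩
      linarith
  have cTL : IsPreconnected (T ∪ L) :=
    cT.union (g1 (β + 1) - 1, β + 1) (by simp [hT]) (by simp [hL]) cL
  have cTLR : IsPreconnected (T ∪ L ∪ R) :=
    cTL.union (g2 (β + 1) + 1, β + 1) (by simp [hT]) (by simp [hR]) cR
  have cO : IsPreconnected (T ∪ L ∪ R ∪ B) :=
    cTLR.union (g1 (α - 1) - 1, α - 1) (by simp [hL]) (by simp [hB]) cB
  have sI : I ⊆ Cᶜ := by
    rintro s ⟨h1, h2, h3⟩ hs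
    rcases ((hC s).1 hs).2 with h | h <;> linarith
  have sO : T ∪ L ∪ R ∪ B ⊆ Cᶜ := by
    intro s hs hs'
    obtain ⟨⟨h1, h2⟩, h3⟩ := (hC s).1 hs'
    have h4 := hle _ h1 h2
    rcases hs with ((h | h) | h) | h <;> simp only [hT, hL, hR, hB, Set.mem_ofPred_eq] at h <;>
      rcases h3 with h3 | h3 <;> linarith
  by_cases hpO : p ∈ T ∪ L ∪ R ∪ B
  · right
    apply cO.subset_connectedComponentIn hpO sO
    rcases hqo with h | h | h | h
    · exact Or.inr h
    · exact Or.inl (Or.inl (Or.inl h))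
    · exact Or.inl (Or.inl (Or.inr h))
    · exact Or.inl (Or.inr h)
  · left
    apply cI.subset_connectedComponentIn _ sI hqi
    simp only [hT, hL, hR, hB, Set.mem_union, Set.mem_ofPred_eq, not_or, not_lt] at hpO
    obtain ⟨⟨⟨h1, h2⟩, h3⟩, h4⟩ := hpO
    have n1 : p.1 ≠ g1 p.2 := fun h => hp ((hC p).2 ⟨⟨h4, h1⟩, Or.inl h⟩)
    have n2 : p.1 ≠ g2 p.2 := fun h => hp ((hC p).2 ⟨⟨h4, h1⟩, Or.inr h⟩)
    have l1 := lt_of_le_of_ne h2 n1.symm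
    have l2 := lt_of_le_of_ne h3 n2
    refine ⟨⟨lt_of_le_of_ne h4 ?_, lt_of_le_of_ne h1 ?_⟩, l1, l2⟩
    · intro h; rw [← h, hα] at l1; rw [← h] at l2; linarith
    · intro h; rw [h, hβ] at l1; rw [h] at l2; linarith

lemma par_sep {q : ℕ} {e f : Ec} (h : Par e f) (he : evl q e) (hf : evl q f)
    (p : ℝ × ℝ) (hp : p ∉ arc q e '' Set.Icc (0:ℝ) 1 ∪ arc q f '' Set.Icc (0:ℝ) 1) :
    ∃ w, vval q w ∧ pos q w ∈
      connectedComponentIn (arc q e '' Set.Icc (0:ℝ) 1 ∪ arc q f '' Set.Icc (0:ℝ) 1)ᶜ p := by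
  have main : ∀ (k k' : VK) (i j : ℕ) (w w' : Vc), al k = al k' → be k = be k' →
      gv q k i (al k) = gv q k' j (al k) → gv q k i (be k) = gv q k' j (be k) →
      (∀ y, al k < y → y < be k → off k y + 8 * i < off k' y + 8 * j) →
      vval q w → vval q w' →
      ((al k < (pos q w).2 ∧ (pos q w).2 < be k) ∧ gv q k i (pos q w).2 < (pos q w).1 ∧
        (pos q w).1 < gv q k' j (pos q w).2) →
      ((pos q w').2 < al k ∨ be k < (pos q w').2 ∨ (pos q w').1 < gv q k i (pos q w').2 ∨
        gv q k' j (pos q w').2 < (pos q w').1) →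
      e = .v k i → f = .v k' j → ∃ w, vval q w ∧ pos q w ∈
      connectedComponentIn (arc q e '' Set.Icc (0:ℝ) 1 ∪ arc q f '' Set.Icc (0:ℝ) 1)ᶜ p := by
    intro k k' i j w w' ha hb h1 h2 hlt hw hw' hin hout hee hff
    subst hee hff
    have l1 := al_ge k
    have l2 := be_le k
    have := two_curve (gv q k i) (gv q k' j) (gv_cont q k i) (gv_cont q k' j) h1 h2 ?_ _ ?_ _ _
      hin hout p hp
    · rcases this with h | h
      · exact ⟨w, hw, h⟩
      · exact ⟨w', hw', h⟩
    · intro y y1 y2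
      have h3 : |y| < 2 := abs_lt.2 ⟨by linarith, by linarith⟩
      have h4 := hlt y y1 y2
      unfold gv
      apply mul_lt_mul_of_pos_right <;> linarith
    · intro s
      rw [Set.mem_union, mem_img, mem_img]
      simp only [On]
      rw [← ha, ← hb]
      tauto
  cases h with
  | m i j hij =>
    have hij' : (i:ℝ) < j := by exact_mod_cast hij
    have hij1 : (i:ℝ) + 1 ≤ j := by exact_mod_cast hij
    refine main .M .M i j (.x i) (.x j) rfl rfl ?_ ?_ ?_ he hf ?_ ?_ rfl rfl
    · norm_num [gv, al]
    · norm_num [gv, be]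
    · intro y _ _; linarith
    · norm_num [pos, al, be, gv, off]; linarith
    · right; right; right; norm_num [pos, gv, off]
  | a i =>
    refine main .LA .RA i i (.x i) .b rfl rfl ?_ ?_ ?_ he.1 trivial ?_ ?_ rfl rfl
    · norm_num [gv, al, off]
    · norm_num [gv, be]
    · intro y h1 h2; simp only [off, al] at *; linarith
    · norm_num [pos, al, be, gv, off]
    · left; norm_num [pos, al]
  | b i =>
    refine main .LB .RB i i (.y i) .a rfl rfl ?_ ?_ ?_ he.1 trivial ?_ ?_ rfl rfl
    · norm_num [gv, al, off]
    · norm_num [gv, be, off]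
    · intro y h1 h2; simp only [off, be] at *; linarith
    · norm_num [pos, al, be, gv, off]
    · right; left; norm_num [pos, be]

lemma enum_of {T C : Type} [Fintype T] {n : ℕ} (hcard : Fintype.card T = n) (g : T → C)
    (hg : Function.Injective g) (P : C → Prop) (h1 : ∀ t, P (g t)) (h2 : ∀ c, P c → ∃ t, g t = c) :
    ∃ vc : Fin n → C, Function.Injective vc ∧ (∀ w, P (vc w)) ∧ ∀ c, P c → ∃ w, vc w = c := by
  let φ : Fin n ≃ T := (Fintype.equivFinOfCardEq hcard).symm
  refine ⟨g ∘ φ, hg.comp φ.injective, fun w => h1 _, fun c hc => ?_⟩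
  obtain ⟨t, ht⟩ := h2 c hc
  exact ⟨φ.symm t, by simp [ht]⟩

def gV (q : ℕ) : (Bool ⊕ Fin (2 * q + 4)) ⊕ Fin (2 * q + 4) → Vc
  | .inl (.inl true) => .a
  | .inl (.inl false) => .b
  | .inl (.inr i) => .x i
  | .inr i => .y i

lemma exists_vc (q : ℕ) : ∃ vc : Fin (4 * q + 10) → Vc, Function.Injective vc ∧
    (∀ w, vval q (vc w)) ∧ ∀ c, vval q c → ∃ w, vc w = c := by
  refine enum_of (T := (Bool ⊕ Fin (2 * q + 4)) ⊕ Fin (2 * q + 4)) ?_ (gV q) ?_ _ ?_ ?_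
  · simp; omega
  · rintro (((_ | _) | i) | i) (((_ | _) | j) | j) h <;>
      simp only [gV, Vc.x.injEq, Vc.y.injEq, reduceCtorEq] at h <;>
      first
      | rfl
      | (rw [Fin.ext h])
  · rintro (((_ | _) | i) | i) <;> simp [gV, vval]
  · rintro (_ | _ | i | i) h
    · exact ⟨.inl (.inl true), rfl⟩
    · exact ⟨.inl (.inl false), rfl⟩
    · exact ⟨.inl (.inr ⟨i, h⟩), rfl⟩
    · exact ⟨.inr ⟨i, h⟩, rfl⟩

abbrev TE (q : ℕ) := (Fin (2 * q + 4) × Bool) ⊕ (Fin (q + 2) × Fin 6) ⊕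
  (Fin (2 * q + 3) × Bool) ⊕ Unit

def kk : Fin 6 → VK := ![.LA, .RA, .LB, .RB, .A, .B]
def kp : Fin 6 → ℕ := ![0, 0, 0, 0, 1, 1]

def gE (q : ℕ) : TE q → Ec
  | .inl (i, true) => .v .S i
  | .inl (i, false) => .v .M i
  | .inr (.inl (p, t)) => .v (kk t) (2 * p + kp t)
  | .inr (.inr (.inl (i, true))) => .h i
  | .inr (.inr (.inl (i, false))) => .k i
  | .inr (.inr (.inr _)) => .z

lemma kk_inj {s t : Fin 6} (h : kk s = kk t) : s = t := by
  fin_cases s <;> fin_cases t <;> first | rfl | (simp [kk] at h; done)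

lemma kk_S (t : Fin 6) : kk t ≠ .S ∧ kk t ≠ .M := by
  fin_cases t <;> simp [kk]

lemma exists_ec (q : ℕ) : ∃ ec : Fin (14 * q + 27) → Ec, Function.Injective ec ∧
    (∀ e, evl q (ec e)) ∧ ∀ c, evl q c → ∃ e, ec e = c := by
  refine enum_of (T := TE q) ?_ (gE q) ?_ _ ?_ ?_
  · simp; omega
  · rintro (⟨i, _ | _⟩ | ⟨p, s⟩ | ⟨i, _ | _⟩ | _) (⟨j, _ | _⟩ | ⟨p', t⟩ | ⟨j, _ | _⟩ | _) h <;>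
      simp only [gE, Ec.v.injEq, Ec.h.injEq, Ec.k.injEq, reduceCtorEq, true_and, false_and] at h <;>
      first
      | rfl
      | (rw [Fin.ext h]; done)
      | exact absurd h.1 (kk_S _).1
      | exact absurd h.1 (kk_S _).2
      | exact absurd h.1.symm (kk_S _).1
      | exact absurd h.1.symm (kk_S _).2
      | (obtain ⟨h1, h2⟩ := h
         have := kk_inj h1
         subst this
         have : p = p' := Fin.ext (by omega)
         rw [this])
  · rintro (⟨i, _ | _⟩ | ⟨p, s⟩ | ⟨i, _ | _⟩ | _)
    · exact i.2
    · exact i.2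
    · have := p.2
      fin_cases s <;> simp [gE, evl, kk, kp] <;> omega
    · exact i.2
    · exact i.2
    · trivial
  · have aux : ∀ (i : ℕ) (t : Fin 6), i < 2 * q + 4 ∧ i % 2 = kp t →
        ∃ u, gE q u = .v (kk t) i := by
      rintro i t ⟨h1, h2⟩
      refine ⟨.inr (.inl (⟨i / 2, by omega⟩, t)), ?_⟩
      simp only [gE, Ec.v.injEq, true_and]
      omega
    rintro (⟨_ | _ | _ | _ | _ | _ | _ | _, i⟩ | i | i | _) h
    · exact ⟨.inl (⟨i, h⟩, true), rfl⟩
    · exact ⟨.inl (⟨i, h⟩, false), rfl⟩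
    · exact aux i 0 h
    · exact aux i 1 h
    · exact aux i 2 h
    · exact aux i 3 h
    · exact aux i 4 h
    · exact aux i 5 h
    · exact ⟨.inr (.inr (.inl (⟨i, h⟩, true))), rfl⟩
    · exact ⟨.inr (.inr (.inl (⟨i, h⟩, false))), rfl⟩
    · exact ⟨.inr (.inr (.inr ())), rfl⟩

end TPM

/-- For infinitely many values of `n`, there exists a bipartite
2-planar multigraph with `n` vertices and exactly `3.5 n - 8` edges. -/
theorem bipartite_twoplanar_multigraph_density_lower_bound :
    ∀ N : ℕ, ∃ n : ℕ, N ≤ n ∧ ∃ (m : ℕ) (ends : Fin m → Sym2 (Fin n)),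
      NoLoops ends ∧ MultiIsBipartite ends ∧ MultiIsTwoPlanar ends ∧
      (m : ℝ) = 3.5 * n - 8 := by
  intro N
  obtain ⟨vc, vinj, vv, vs⟩ := TPM.exists_vc N
  obtain ⟨ec, einj, ev, -⟩ := TPM.exists_ec N
  have hV : ∀ c, ∃ w, TPM.vval N c → vc w = c := by
    intro c
    by_cases h : TPM.vval N c
    · obtain ⟨w, hw⟩ := vs c h
      exact ⟨w, fun _ => hw⟩
    · exact ⟨⟨0, by omega⟩, fun h' => absurd h' h⟩
  choose V hV using hV
  have hlo : ∀ e, vc (V (TPM.lo (ec e))) = TPM.lo (ec e) := fun e => hV _ (TPM.lo_val (ev e))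
  have hhi : ∀ e, vc (V (TPM.hi N (ec e))) = TPM.hi N (ec e) := fun e => hV _ (TPM.hi_val (ev e))
  let ends : Fin (14 * N + 27) → Sym2 (Fin (4 * N + 10)) :=
    fun e => s(V (TPM.lo (ec e)), V (TPM.hi N (ec e)))
  have hmem : ∀ w e, w ∈ ends e ↔ TPM.Inc N (vc w) (ec e) := by
    intro w e
    simp only [ends, Sym2.mem_iff, TPM.Inc]
    rw [← hlo e, ← hhi e, vinj.eq_iff, vinj.eq_iff, hlo, hhi]
  have hends : ∀ e u v, ends e = s(u, v) →
      (TPM.lo (ec e) = vc u ∧ TPM.hi N (ec e) = vc v) ∨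
      (TPM.lo (ec e) = vc v ∧ TPM.hi N (ec e) = vc u) := by
    intro e u v h
    rcases Sym2.eq_iff.1 h with ⟨h1, h2⟩ | ⟨h1, h2⟩
    · left; rw [← h1, ← h2, hlo, hhi]; exact ⟨rfl, rfl⟩
    · right; rw [← h1, ← h2, hlo, hhi]; exact ⟨rfl, rfl⟩
  have hcode : ∀ e f c, TPM.Inc N c (ec e) → TPM.Inc N c (ec f) →
      ∃ w, vc w = c ∧ w ∈ ends e ∧ w ∈ ends f := by
    intro e f c h1 h2
    have hc : TPM.vval N c := by
      rcases h1 with h | h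
      · rw [h]; exact TPM.lo_val (ev e)
      · rw [h]; exact TPM.hi_val (ev e)
    obtain ⟨w, hw⟩ := vs c hc
    exact ⟨w, hw, (hmem w e).2 (hw ▸ h1), (hmem w f).2 (hw ▸ h2)⟩
  have hbip : MultiIsBipartite ends := by
    refine ⟨fun w => TPM.col (vc w), fun e u v h => ?_⟩
    have hc := TPM.col_ne (ev e)
    rcases hends e u v h with ⟨h1, h2⟩ | ⟨h1, h2⟩
    · rw [h1, h2] at hc; exact hc
    · rw [h1, h2] at hc; exact hc.symm
  have hloop : NoLoops ends := by
    intro e h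
    simp only [ends, Sym2.mk_isDiag_iff] at h
    have hc := TPM.col_ne (ev e)
    rw [← hlo e, ← hhi e, h] at hc
    exact hc rfl
  let D : MultiDrawing ends :=
    { vert := fun w => TPM.pos N (vc w)
      vert_inj := (TPM.pos_inj N).comp vinj
      arc := fun e => TPM.arc N (ec e)
      arc_cont := fun e => (TPM.arc_cont N (ec e)).continuousOn
      arc_inj := fun e => (TPM.arc_inj N (ec e)).injOn
      arc_ends := by
        intro e u v h
        rw [TPM.arc_zero, TPM.arc_one]
        rcases hends e u v h with ⟨h1, h2⟩ | ⟨h1, h2⟩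
        · rw [h1, h2]
        · rw [h1, h2, Set.pair_comm]
      arc_vertex := by
        intro e t ht w h
        rw [hmem]
        apply TPM.on_vertex (ev e) (vv w)
        rw [← h, ← TPM.mem_img]
        exact ⟨t, ht, rfl⟩
      adj_meet := by
        rintro e f hne ⟨w, hwe, hwf⟩ p hp hq
        rw [TPM.mem_img] at hp hq
        rw [hmem] at hwe hwf
        rcases TPM.master (ev e) (ev f) (einj.ne hne) hp hq with ⟨c, h1, h2, h3⟩ | h | h
        · obtain ⟨w', hw', a, b⟩ := hcode e f c h1 h2
          exact ⟨w', a, b, by rw [h3, hw']⟩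
        · exact (h.disj _ hwe hwf).elim
        · exact (h.disj _ hwf hwe).elim
      nonadj_meet := by
        rintro e f hna p ⟨hp, hp'⟩ r ⟨hr, hr'⟩
        rw [TPM.mem_img] at hp hp' hr hr'
        have hne : ec e ≠ ec f := by
          intro h
          apply hna
          obtain ⟨w, -, a, b⟩ := hcode e f (TPM.lo (ec e)) (Or.inl rfl) (Or.inl (by rw [h]))
          exact ⟨w, a, b⟩
        rcases TPM.master (ev e) (ev f) hne hp hp' with ⟨c, h1, h2, h3⟩ | h | h
        · obtain ⟨w', hw', a, b⟩ := hcode e f c h1 h2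
          exact (hna ⟨w', a, b⟩).elim
        · exact h.unique hp hp' hr hr'
        · exact h.unique hp' hp hr' hr
      parallel_nonhomotopic := by
        intro e f hne hef p hp
        have hpar : TPM.Par (ec e) (ec f) ∨ TPM.Par (ec f) (ec e) := by
          apply TPM.par_of (q := N) (ev e) (ev f) (einj.ne hne)
          rcases hends e _ _ hef with ⟨h1, h2⟩ | ⟨h1, h2⟩
          · left; rw [h1, h2, hlo, hhi]; exact ⟨rfl, rfl⟩
          · right; rw [h1, h2, hlo, hhi]; exact ⟨rfl, rfl⟩
        rcases hpar with h | h
        · obtain ⟨c, hc, hm⟩ := TPM.par_sep h (ev e) (ev f) p hp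
          obtain ⟨w, hw⟩ := vs c hc
          exact ⟨w, by rw [hw]; exact hm⟩
        · rw [Set.union_comm] at hp ⊢
          obtain ⟨c, hc, hm⟩ := TPM.par_sep h (ev f) (ev e) p hp
          obtain ⟨w, hw⟩ := vs c hc
          exact ⟨w, by rw [hw]; exact hm⟩ }
  have hD : D.AtMostKCrossings 2 := by
    intro e
    rw [← Set.ncard_image_of_injective _ einj]
    have hsub : ec '' {f | D.Crosses e f} ⊆ {TPM.c1 (ec e), TPM.c2 (ec e)} := by
      rintro _ ⟨f, ⟨hne, p, ⟨hp, hp'⟩, hv⟩, rfl⟩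
      have hp1 : TPM.On N (ec e) p := (TPM.mem_img N (ec e) p).1 hp
      have hp2 : TPM.On N (ec f) p := (TPM.mem_img N (ec f) p).1 hp'
      rcases TPM.master (ev e) (ev f) (einj.ne hne) hp1 hp2 with ⟨c, h1, h2, h3⟩ | h | h
      · obtain ⟨w, hw, -, -⟩ := hcode e f c h1 h2
        refine (hv w ?_).elim
        change TPM.pos N (vc w) = p
        rw [hw, h3]
      · exact (h.cand (ev e)).1
      · exact (h.cand (ev f)).2
    exact (Set.ncard_le_ncard hsub (Set.toFinite _)).trans ((Set.ncard_insert_le _ _).trans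
      (by rw [Set.ncard_singleton]))
  refine ⟨4 * N + 10, by omega, 14 * N + 27, ends, hloop, hbip, ⟨D, hD⟩, ?_⟩
  push_cast
  ring
end

section
/- Let G be a simple bipartite k-planar graph with n vertices and m edges, for some integer k ≥ 1. Then m ≤ (17/8)·√(2k)·n. -/
open Set

/-- A topological drawing of a simple graph in the plane: vertices are mapped to distinct
points, each edge to a Jordan arc (parametrized over `[0,1]`) connecting its endpoints;
no arc passes through a vertex other than its endpoints; two adjacent edges meet only at
their shared endpoint (i.e. adjacent edges do not cross); two independent edges meet in at
most one point (so no edge crosses another more than once). -/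
structure Drawing {V : Type*} (G : SimpleGraph V) where
  vert : V → ℝ × ℝ
  vert_inj : Function.Injective vert
  arc : G.edgeSet → ℝ → ℝ × ℝ
  arc_cont : ∀ e, ContinuousOn (arc e) (Set.Icc 0 1)
  arc_inj : ∀ e, Set.InjOn (arc e) (Set.Icc 0 1)
  arc_ends : ∀ (e : G.edgeSet) (u v : V), (e : Sym2 V) = s(u, v) →
      ({arc e 0, arc e 1} : Set (ℝ × ℝ)) = {vert u, vert v}
  arc_vertex : ∀ (e : G.edgeSet), ∀ t ∈ Set.Icc (0:ℝ) 1, ∀ w : V,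
      arc e t = vert w → w ∈ (e : Sym2 V)
  adj_meet : ∀ e f : G.edgeSet, e ≠ f →
      (∃ w : V, w ∈ (e : Sym2 V) ∧ w ∈ (f : Sym2 V)) →
      ∀ p ∈ arc e '' Set.Icc (0:ℝ) 1, p ∈ arc f '' Set.Icc (0:ℝ) 1 →
        ∃ w : V, w ∈ (e : Sym2 V) ∧ w ∈ (f : Sym2 V) ∧ p = vert w
  nonadj_meet : ∀ e f : G.edgeSet,
      (¬ ∃ w : V, w ∈ (e : Sym2 V) ∧ w ∈ (f : Sym2 V)) →
      ((arc e '' Set.Icc (0:ℝ) 1) ∩ (arc f '' Set.Icc (0:ℝ) 1)).Subsingleton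

/-- The image (point set) of an edge in a drawing. -/
def Drawing.img {V : Type*} {G : SimpleGraph V} (D : Drawing G) (e : G.edgeSet) :
    Set (ℝ × ℝ) :=
  D.arc e '' Set.Icc (0:ℝ) 1

/-- Two edges cross in a drawing if they are distinct and meet at a point that is not the
image of any vertex. -/
def Drawing.Crosses {V : Type*} {G : SimpleGraph V} (D : Drawing G) (e f : G.edgeSet) :
    Prop :=
  e ≠ f ∧ ∃ p ∈ D.img e ∩ D.img f, ∀ w : V, D.vert w ≠ p

/-- In the drawing `D`, every edge is crossed at most `k` times (any two edges cross at
most once, so this is the number of edges crossing it). -/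
def Drawing.AtMostKCrossings {V : Type*} {G : SimpleGraph V} (D : Drawing G) (k : ℕ) :
    Prop :=
  ∀ e : G.edgeSet, {f : G.edgeSet | D.Crosses e f}.ncard ≤ k

/-- A graph is bipartite: its vertices can be split in two parts such that every edge
joins the two parts. -/
def IsBipartite {V : Type*} (G : SimpleGraph V) : Prop :=
  ∃ c : V → Bool, ∀ u v : V, G.Adj u v → c u ≠ c v


/-- A graph is `k`-planar if it admits a drawing in which every edge is crossed at most
`k` times. -/
def IsKPlanar {V : Type*} (G : SimpleGraph V) (k : ℕ) : Prop :=
  ∃ D : Drawing G, D.AtMostKCrossings k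

set_option linter.all false

section PartA
variable {ι E Q : Type*} [Fintype ι] [Fintype E] [DecidableEq ι] [DecidableEq E] [DecidableEq Q]

/-- incidence (boundary) map of a graph over `ZMod 2` -/
def incMap (s t : E → ι) : (E → ZMod 2) →ₗ[ZMod 2] (ι → ZMod 2) where
  toFun z v := ∑ e, z e * ((if s e = v then 1 else 0) + (if t e = v then 1 else 0))
  map_add' x y := by
    ext v; simp [add_mul, Finset.sum_add_distrib]
  map_smul' c x := by
    ext v; simp [Finset.mul_sum, mul_assoc]

lemma zmod2_cases (x : ZMod 2) : x = 0 ∨ x = 1 := by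
  revert x; decide

lemma incMap_s (s t : E → ι) (hst : ∀ e f, s e ≠ t f) (z : E → ZMod 2)
    (hz : incMap s t z = 0) (e : E) (he : z e ≠ 0) :
    ∃ f, f ≠ e ∧ s f = s e ∧ z f ≠ 0 := by
  by_contra hcon
  push Not at hcon
  have h := congrFun hz (s e)
  simp only [incMap, LinearMap.coe_mk, AddHom.coe_mk, Pi.zero_apply] at h
  rw [Finset.sum_eq_single e] at h
  · have : t e ≠ s e := fun h => hst e e h.symm
    simp [this] at h
    exact he h
  · intro f _ hfe
    have h1 : t f ≠ s e := fun h => hst e f h.symm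
    by_cases h2 : s f = s e
    · simp [hcon f hfe h2]
    · simp [h1, h2]
  · simp

lemma incMap_t (s t : E → ι) (hst : ∀ e f, s e ≠ t f) (z : E → ZMod 2)
    (hz : incMap s t z = 0) (e : E) (he : z e ≠ 0) :
    ∃ f, f ≠ e ∧ t f = t e ∧ z f ≠ 0 := by
  by_contra hcon
  push Not at hcon
  have h := congrFun hz (t e)
  simp only [incMap, LinearMap.coe_mk, AddHom.coe_mk, Pi.zero_apply] at h
  rw [Finset.sum_eq_single e] at h
  · have : s e ≠ t e := hst e e
    simp [this] at h
    exact he h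
  · intro f _ hfe
    have h1 : s f ≠ t e := hst f e
    by_cases h2 : t f = t e
    · simp [hcon f hfe h2]
    · simp [h1, h2]
  · simp

lemma four_le_supp (s t : E → ι) (hst : ∀ e f, s e ≠ t f)
    (hinj : ∀ e f, s e = s f → t e = t f → e = f) (z : E → ZMod 2)
    (hz : incMap s t z = 0) (hz0 : z ≠ 0) :
    4 ≤ (Finset.univ.filter (fun e => z e ≠ 0)).card := by
  obtain ⟨e, he⟩ : ∃ e, z e ≠ 0 := by
    by_contra h; push Not at h; exact hz0 (funext h)
  obtain ⟨f, hfe, hsf, hf⟩ := incMap_s s t hst z hz e he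
  obtain ⟨g, hge, htg, hg⟩ := incMap_t s t hst z hz e he
  obtain ⟨k, hkf, htk, hk⟩ := incMap_t s t hst z hz f hf
  have htfe : t f ≠ t e := fun h => hfe (hinj _ _ hsf h)
  have h4 : ({e, f, g, k} : Finset E) ⊆ Finset.univ.filter (fun e => z e ≠ 0) := by
    intro x hx
    simp only [Finset.mem_insert, Finset.mem_singleton] at hx
    rcases hx with rfl | rfl | rfl | rfl <;> simpa
  refine le_trans ?_ (Finset.card_le_card h4)
  have hfg : f ≠ g := by rintro rfl; exact htfe htg
  have hek : e ≠ k := by rintro rfl; exact htfe htk.symm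
  have hgk : g ≠ k := by rintro rfl; exact htfe (htk.symm.trans htg)
  rw [Finset.card_insert_of_notMem, Finset.card_insert_of_notMem, Finset.card_insert_of_notMem,
    Finset.card_singleton]
  · simpa using hgk
  · simp only [Finset.mem_insert, Finset.mem_singleton, not_or]; exact ⟨hfg, hkf.symm⟩
  · simp only [Finset.mem_insert, Finset.mem_singleton, not_or]
    exact ⟨hfe.symm, hge.symm, hek⟩

/-- The face vector. -/
def faceVec (φ₁ φ₂ : E → Q) (q : Q) : E → ZMod 2 :=
  fun e => (if φ₁ e = q then 1 else 0) + (if φ₂ e = q then 1 else 0)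

theorem macLane_bound (s t : E → ι) (hst : ∀ e f, s e ≠ t f)
    (hinj : ∀ e f, s e = s f → t e = t f → e = f)
    (φ₁ φ₂ : E → Q) (h1 : ∀ q, incMap s t (faceVec φ₁ φ₂ q) = 0)
    (h2 : ∀ z, incMap s t z = 0 → ∃ w : Q → ZMod 2, ∀ e, z e = w (φ₁ e) + w (φ₂ e)) :
    Fintype.card E ≤ 2 * Fintype.card ι := by
  classical
  set Φ : Finset Q := Finset.univ.image φ₁ ∪ Finset.univ.image φ₂ with hΦ
  set Φ' : Finset Q := Φ.filter (fun q => faceVec φ₁ φ₂ q ≠ 0) with hΦ'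
  have hspan : LinearMap.ker (incMap s t) ≤
      Submodule.span (ZMod 2) ((Φ'.image (faceVec φ₁ φ₂) : Finset (E → ZMod 2)) : Set (E → ZMod 2)) := by
    intro z hz
    obtain ⟨w, hw⟩ := h2 z hz
    have : z = ∑ q ∈ Φ, w q • faceVec φ₁ φ₂ q := by
      ext e
      rw [hw e]
      simp only [Finset.sum_apply, Pi.smul_apply, faceVec, smul_eq_mul, mul_add, mul_ite, mul_one,
        mul_zero, Finset.sum_add_distrib, Finset.sum_ite_eq]
      have m1 : φ₁ e ∈ Φ := by simp [hΦ]
      have m2 : φ₂ e ∈ Φ := by simp [hΦ]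
      simp [m1, m2]
    rw [this]
    refine Submodule.sum_mem _ (fun q hq => Submodule.smul_mem _ _ ?_)
    by_cases h0 : faceVec φ₁ φ₂ q = 0
    · rw [h0]; exact Submodule.zero_mem _
    · refine Submodule.subset_span ?_
      simp only [Finset.coe_image]
      exact ⟨q, by simp [hΦ', hq, h0], rfl⟩
  have hdim : Module.finrank (ZMod 2) (LinearMap.ker (incMap s t)) ≤ Φ'.card := by
    refine (Submodule.finrank_mono hspan).trans ?_
    exact (finrank_span_finset_le_card _).trans Finset.card_image_le
  have hrk := LinearMap.finrank_range_add_finrank_ker (incMap s t)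
  have hr : Module.finrank (ZMod 2) (LinearMap.range (incMap s t)) ≤ Fintype.card ι := by
    refine (Submodule.finrank_le _).trans ?_
    simp
  rw [Module.finrank_fintype_fun_eq_card] at hrk
  have hcount : 4 * Φ'.card ≤ 2 * Fintype.card E := by
    calc 4 * Φ'.card = ∑ q ∈ Φ', 4 := by simp [mul_comm]
      _ ≤ ∑ q ∈ Φ', (Finset.univ.filter (fun e => faceVec φ₁ φ₂ q e ≠ 0)).card := by
          refine Finset.sum_le_sum (fun q hq => four_le_supp s t hst hinj _ (h1 q) ?_)
          simp [hΦ'] at hq; exact hq.2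
      _ = ∑ e : E, (Φ'.filter (fun q => faceVec φ₁ φ₂ q e ≠ 0)).card := by
          simp only [Finset.card_filter]
          exact Finset.sum_comm
      _ ≤ ∑ e : E, 2 := by
          refine Finset.sum_le_sum (fun e _ => ?_)
          refine (Finset.card_le_card (t := {φ₁ e, φ₂ e}) ?_).trans Finset.card_le_two
          intro q hq
          rw [Finset.mem_filter] at hq
          have hq2 := hq.2
          by_contra hcon
          simp only [Finset.mem_insert, Finset.mem_singleton, not_or] at hcon
          apply hq2
          simp [faceVec, Ne.symm hcon.1, Ne.symm hcon.2]
      _ = 2 * Fintype.card E := by simp [mul_comm]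
  omega
end PartA

set_option linter.all false

section PartB

/-- Grid edges: `(true,i,j)` joins `(i,j)` and `(i+1,j)`; `(false,i,j)` joins `(i,j)`, `(i,j+1)`. -/
abbrev GE := Bool × ℤ × ℤ

def gsrc (g : GE) : ℤ × ℤ := g.2
def gtgt (g : GE) : ℤ × ℤ := if g.1 then (g.2.1 + 1, g.2.2) else (g.2.1, g.2.2 + 1)

def gadj (p q : ℤ × ℤ) : Prop := ∃ g : GE, (gsrc g = p ∧ gtgt g = q) ∨ (gsrc g = q ∧ gtgt g = p)

lemma gadj_symm {p q : ℤ × ℤ} (h : gadj p q) : gadj q p := by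
  obtain ⟨g, h⟩ := h; exact ⟨g, h.symm⟩

/-- boundary of a 1-chain -/
def gbd : (GE → ZMod 2) →ₗ[ZMod 2] (ℤ × ℤ → ZMod 2) where
  toFun z p := z (true, p.1, p.2) + z (true, p.1 - 1, p.2) + z (false, p.1, p.2)
    + z (false, p.1, p.2 - 1)
  map_add' x y := by ext p; simp; ring
  map_smul' c x := by ext p; simp; ring

lemma gbd_apply (z : GE → ZMod 2) (p : ℤ × ℤ) : gbd z p =
    z (true, p.1, p.2) + z (true, p.1 - 1, p.2) + z (false, p.1, p.2)
    + z (false, p.1, p.2 - 1) := rfl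

lemma gbd_single (g : GE) (p : ℤ × ℤ) : gbd (Pi.single g 1) p =
    (if gsrc g = p then 1 else 0) + (if gtgt g = p then 1 else 0) := by
  obtain ⟨d, i, j⟩ := g
  obtain ⟨k, l⟩ := p
  rw [gbd_apply]
  simp only [Pi.single_apply, gsrc, gtgt, Prod.mk.injEq]
  cases d
  · have e1 : (k = i ∧ l - 1 = j) ↔ (i = k ∧ j + 1 = l) := by omega
    have e2 : (k = i ∧ l = j) ↔ (i = k ∧ j = l) := by omega
    simp [e1, e2]
  · have e1 : (k - 1 = i ∧ l = j) ↔ (i + 1 = k ∧ j = l) := by omega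
    have e2 : (k = i ∧ l = j) ↔ (i = k ∧ j = l) := by omega
    simp [e1, e2]

/-- coboundary-like map from functions on unit squares. -/
def gcob (w : ℤ × ℤ → ZMod 2) : GE → ZMod 2 :=
  fun g => w g.2 + w (if g.1 then (g.2.1, g.2.2 - 1) else (g.2.1 - 1, g.2.2))

lemma z2_self (x : ZMod 2) : x + x = 0 := by revert x; decide

lemma gbd_gcob (w : ℤ × ℤ → ZMod 2) : gbd (gcob w) = 0 := by
  ext p
  rw [gbd_apply]
  simp only [gcob, Bool.false_eq_true, ↓reduceIte, Prod.mk.eta, Pi.zero_apply]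
  generalize w p = a
  generalize w (p.1, p.2 - 1) = b
  generalize w (p.1 - 1, p.2) = c
  generalize w (p.1 - 1, p.2 - 1) = d
  revert a b c d; decide

lemma grid_exact (z : GE → ZMod 2) (M : ℤ) (hM : ∀ d i j, j < M → z (d, i, j) = 0)
    (hz : gbd z = 0) : ∃ w : ℤ × ℤ → ZMod 2, gcob w = z := by
  let w : ℤ × ℤ → ZMod 2 := fun p => ∑ k ∈ Finset.range (p.2 + 1 - M).toNat, z (true, p.1, M + k)
  have hlow : ∀ i j, j < M → w (i, j) = 0 := by
    intro i j hj
    have : (j + 1 - M).toNat = 0 := by omega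
    simp [w, this]
  have hstep : ∀ i j, w (i, j) = w (i, j - 1) + z (true, i, j) := by
    intro i j
    by_cases hj : j < M
    · rw [hlow i j hj, hlow i (j-1) (by omega), hM _ _ _ hj]; simp
    · have : (j + 1 - M).toNat = (j - 1 + 1 - M).toNat + 1 := by omega
      simp only [w, this, Finset.sum_range_succ]
      congr 3
      have : M + ((j - 1 + 1 - M).toNat : ℤ) = j := by omega
      rw [this]
  have hv : ∀ i j, w (i, j) + w (i - 1, j) = z (false, i, j) := by
    intro i j
    by_cases hj : j < M
    · rw [hlow i j hj, hlow (i-1) j hj, hM _ _ _ hj]; simp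
    · push Not at hj
      have base : w (i, M - 1) + w (i - 1, M - 1) = z (false, i, M - 1) := by
        rw [hlow _ _ (by omega), hlow _ _ (by omega), hM _ _ _ (by omega)]; simp
      have key : ∀ n : ℕ, w (i, M - 1 + n) + w (i - 1, M - 1 + n) = z (false, i, M - 1 + n) := by
        intro n
        induction n with
        | zero => simpa using base
        | succ n ih =>
          rw [hstep i, hstep (i-1)]
          have e : M - 1 + ((n + 1 : ℕ) : ℤ) - 1 = M - 1 + n := by push_cast; ring
          rw [e]
          have h := congrFun hz (i, M - 1 + ((n + 1 : ℕ) : ℤ))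
          rw [gbd_apply] at h
          simp only [e, Pi.zero_apply] at h
          rw [← ih] at h
          revert h
          generalize w (i, M - 1 + (n:ℤ)) = a
          generalize w (i - 1, M - 1 + (n:ℤ)) = b
          generalize z (true, i, M - 1 + ((n + 1 : ℕ) : ℤ)) = c
          generalize z (true, i - 1, M - 1 + ((n + 1 : ℕ) : ℤ)) = d
          generalize z (false, i, M - 1 + ((n + 1 : ℕ) : ℤ)) = f
          revert a b c d f; decide
      have := key (j - (M - 1)).toNat
      rwa [show M - 1 + ((j - (M - 1)).toNat : ℤ) = j by omega] at this
  refine ⟨w, ?_⟩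
  ext ⟨d, i, j⟩
  cases d
  · simpa [gcob] using hv i j
  · simp only [gcob, ↓reduceIte]
    rw [hstep i j]
    generalize w (i, j - 1) = a
    generalize z (true, i, j) = b
    revert a b; decide

lemma sum_gbd (S : Finset GE) (z : GE → ZMod 2) (hz : ∀ g, g ∉ S → z g = 0)
    (B : Finset (ℤ × ℤ)) :
    ∑ p ∈ B, gbd z p = ∑ g ∈ S, z g * ((if gsrc g ∈ B then 1 else 0) + (if gtgt g ∈ B then 1 else 0)) := by
  have hz' : z = ∑ g ∈ S, z g • (Pi.single g 1 : GE → ZMod 2) := by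
    ext k
    simp only [Finset.sum_apply, Pi.smul_apply, Pi.single_apply, smul_eq_mul, mul_ite, mul_one,
      mul_zero, Finset.sum_ite_eq]
    split_ifs with h
    · rfl
    · exact hz k h
  conv_lhs => rw [hz']
  simp only [map_sum, map_smul, Finset.sum_apply, Pi.smul_apply, smul_eq_mul, gbd_single]
  rw [Finset.sum_comm]
  refine Finset.sum_congr rfl (fun g _ => ?_)
  rw [← Finset.mul_sum, Finset.sum_add_distrib]
  simp

/-- connectivity inside a set of cells -/
def gconn (P : Set (ℤ × ℤ)) (x y : ℤ × ℤ) : Prop :=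
  Relation.ReflTransGen (fun x y => gadj x y ∧ x ∈ P ∧ y ∈ P) x y

/-- chain along a connection -/
lemma conn_chain (P : Set (ℤ × ℤ)) (x y : ℤ × ℤ) (h : gconn P x y) :
    ∃ c : GE → ZMod 2, (∀ g, c g ≠ 0 → gsrc g ∈ P ∧ gtgt g ∈ P) ∧
      gbd c = Pi.single x 1 + Pi.single y 1 := by
  induction h with
  | refl =>
    refine ⟨0, by simp, ?_⟩
    ext p; simp only [map_zero, Pi.zero_apply, Pi.add_apply, z2_self]
  | tail hxy hs ih =>
    rename_i b d
    obtain ⟨c, hc, hcb⟩ := ih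
    obtain ⟨⟨g, hg⟩, hb, hd⟩ := hs
    refine ⟨c + Pi.single g 1, ?_, ?_⟩
    · intro k hk
      by_cases hkg : k = g
      · subst hkg
        rcases hg with ⟨h1, h2⟩ | ⟨h1, h2⟩ <;> rw [h1, h2] <;> exact ⟨by assumption, by assumption⟩
      · apply hc
        simpa [Pi.single_apply, hkg] using hk
    · rw [map_add, hcb]
      ext p
      simp only [Pi.add_apply, gbd_single, Pi.single_apply]
      have eb : (if b = p then (1 : ZMod 2) else 0) = if p = b then 1 else 0 := by
        simp only [eq_comm]
      have ed : (if d = p then (1 : ZMod 2) else 0) = if p = d then 1 else 0 := by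
        simp only [eq_comm]
      rcases hg with ⟨h1, h2⟩ | ⟨h1, h2⟩
      all_goals
        rw [h1, h2, eb, ed]
        generalize (if p = x then (1 : ZMod 2) else 0) = α
        generalize (if p = b then (1 : ZMod 2) else 0) = β
        generalize (if p = d then (1 : ZMod 2) else 0) = γ
        revert α β γ; decide

end PartB

set_option linter.all false

section PartG
open Classical

/-- the other side of a grid edge -/
def gside (g : GE) : ℤ × ℤ := if g.1 then (g.2.1, g.2.2 - 1) else (g.2.1 - 1, g.2.2)

lemma gcob_side (w : ℤ × ℤ → ZMod 2) (g : GE) : gcob w g = w g.2 + w (gside g) := rfl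

def gjoin (g : GE) (P Q : Set (ℤ × ℤ)) : Prop :=
  (gsrc g ∈ P ∧ gtgt g ∈ Q) ∨ (gsrc g ∈ Q ∧ gtgt g ∈ P)

lemma z2_add_eq_zero {x y : ZMod 2} (h : x + y = 0) : x = y := by
  revert x y; decide

lemma blocks_exact {β H : Type} [Fintype β] [Fintype H] [DecidableEq β]
    (C : β → Finset (ℤ × ℤ)) (hne : ∀ x, (C x).Nonempty)
    (hconn : ∀ x, ∀ p ∈ C x, ∀ q ∈ C x, gconn (C x) p q)
    (hdisj : ∀ x y, ∀ p ∈ C x, p ∈ C y → x = y)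
    (a b : H → β) (hab : ∀ h, a h ≠ b h) (l : H → GE) (hl : Function.Injective l)
    (hj : ∀ h, gjoin (l h) (C (a h)) (C (b h))) :
    ∃ (Q : Type) (φ₁ φ₂ : H → Q), (∀ q, incMap a b (faceVec φ₁ φ₂ q) = 0) ∧
      ∀ y, incMap a b y = 0 → ∃ w : Q → ZMod 2, ∀ h, y h = w (φ₁ h) + w (φ₂ h) := by
  let inS : GE → Prop := fun g => (∃ x, gsrc g ∈ C x ∧ gtgt g ∈ C x) ∨ ∃ h, g = l h
  let U : Finset (ℤ × ℤ) := Finset.univ.biUnion C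
  have hU : ∀ g, inS g → gsrc g ∈ U := by
    rintro g (⟨x, hx, -⟩ | ⟨h, rfl⟩)
    · exact Finset.mem_biUnion.2 ⟨x, Finset.mem_univ _, hx⟩
    · rcases hj h with ⟨h1, -⟩ | ⟨h1, -⟩
      · exact Finset.mem_biUnion.2 ⟨_, Finset.mem_univ _, h1⟩
      · exact Finset.mem_biUnion.2 ⟨_, Finset.mem_univ _, h1⟩
  let S : Finset GE := ((Finset.univ : Finset Bool) ×ˢ U).filter inS
  have hS : ∀ g, g ∈ S ↔ inS g := by
    intro g
    simp only [S, Finset.mem_filter, Finset.mem_product, Finset.mem_univ, true_and]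
    exact ⟨fun h => h.2, fun h => ⟨hU g h, h⟩⟩
  have hlin : ∀ h x, ¬ (gsrc (l h) ∈ C x ∧ gtgt (l h) ∈ C x) := by
    rintro h x ⟨h1, h2⟩
    rcases hj h with ⟨h3, h4⟩ | ⟨h3, h4⟩
    · exact hab h ((hdisj _ _ _ h3 h1).trans (hdisj _ _ _ h4 h2).symm)
    · exact hab h ((hdisj _ _ _ h4 h2).trans (hdisj _ _ _ h3 h1).symm)
  let r : ℤ × ℤ → ℤ × ℤ → Prop := fun p q => ∃ g, ¬ inS g ∧ p = g.2 ∧ q = gside g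
  refine ⟨Quot r, fun h => Quot.mk r (l h).2, fun h => Quot.mk r (gside (l h)), ?_, ?_⟩
  · intro q
    let w : ℤ × ℤ → ZMod 2 := fun p => if Quot.mk r p = q then 1 else 0
    have hw : ∀ g, g ∉ S → gcob w g = 0 := by
      intro g hg
      rw [hS] at hg
      have : Quot.mk r g.2 = Quot.mk r (gside g) := Quot.sound ⟨g, hg, rfl, rfl⟩
      rw [gcob_side]
      simp only [w, this]
      exact z2_self _
    ext x
    have h1 := sum_gbd S (gcob w) hw (C x)
    rw [gbd_gcob] at h1
    simp only [Pi.zero_apply, Finset.sum_const_zero] at h1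
    have h2 : ∀ g ∈ S, gcob w g * ((if gsrc g ∈ C x then 1 else 0) + (if gtgt g ∈ C x then 1 else 0))
        = ∑ h, if g = l h then gcob w (l h) * ((if a h = x then 1 else 0) + (if b h = x then 1 else 0)) else 0 := by
      intro g hg
      rcases (hS g).1 hg with ⟨y, hy1, hy2⟩ | ⟨h, rfl⟩
      · rw [Finset.sum_eq_zero]
        · by_cases hxy : y = x
          · subst hxy; simp only [hy1, hy2, if_true, z2_self, mul_zero]
          · have h1 : gsrc g ∉ C x := fun h => hxy (hdisj _ _ _ hy1 h)
            have h2 : gtgt g ∉ C x := fun h => hxy (hdisj _ _ _ hy2 h)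
            simp [h1, h2]
        · intro h _
          rw [if_neg]
          rintro rfl
          exact hlin h y ⟨hy1, hy2⟩
      · rw [Finset.sum_eq_single h]
        · rw [if_pos rfl]
          congr 1
          have key : ∀ z p, p ∈ C z → ((if p ∈ C x then (1 : ZMod 2) else 0) = if z = x then 1 else 0) := by
            intro z p hp
            by_cases hz : z = x
            · subst hz; simp [hp]
            · rw [if_neg hz, if_neg]; exact fun h => hz (hdisj _ _ _ hp h)
          rcases hj h with ⟨h3, h4⟩ | ⟨h3, h4⟩
          · rw [key _ _ h3, key _ _ h4]
          · rw [key _ _ h3, key _ _ h4, add_comm]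
        · intro h' _ hne
          rw [if_neg]
          intro hh; exact hne (hl hh).symm
        · simp
    rw [Finset.sum_congr rfl h2, Finset.sum_comm] at h1
    simp only [Pi.zero_apply, incMap, LinearMap.coe_mk, AddHom.coe_mk]
    refine Eq.trans (Finset.sum_congr rfl fun h _ => ?_) h1.symm
    rw [Finset.sum_ite_eq', if_pos ((hS _).2 (Or.inr ⟨h, rfl⟩))]
    rfl
  · intro y hy
    choose base hbase using hne
    have hp : ∀ h, ∃ p ∈ C (a h), ∃ q ∈ C (b h), gbd (Pi.single (l h) 1) = Pi.single p 1 + Pi.single q 1 := by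
      intro h
      have e0 : ∀ u v : ℤ × ℤ, (if u = v then (1 : ZMod 2) else 0) = if v = u then 1 else 0 := by
        intro u v; simp only [eq_comm]
      rcases hj h with ⟨h3, h4⟩ | ⟨h3, h4⟩
      · refine ⟨_, h3, _, h4, ?_⟩
        ext p
        simp only [gbd_single, Pi.add_apply, Pi.single_apply]
        rw [e0, e0 _ p]
      · refine ⟨_, h4, _, h3, ?_⟩
        ext p
        simp only [gbd_single, Pi.add_apply, Pi.single_apply]
        rw [e0, e0 _ p, add_comm]
    choose p hp q hq hpq using hp
    choose α hα hα' using fun h => conn_chain _ _ _ (hconn (a h) (p h) (hp h) (base (a h)) (hbase _))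
    choose γ hγ hγ' using fun h => conn_chain _ _ _ (hconn (b h) (q h) (hq h) (base (b h)) (hbase _))
    let c : GE → ZMod 2 := ∑ h, y h • (Pi.single (l h) 1 + α h + γ h)
    have hc : ∀ g, c g = ∑ h, y h * ((if g = l h then 1 else 0) + α h g + γ h g) := by
      intro g; simp [c, Finset.sum_apply, Pi.single_apply, mul_add]
    have hα0 : ∀ h g, (¬ ∃ x, gsrc g ∈ C x ∧ gtgt g ∈ C x) → α h g = 0 := by
      intro h g hg; by_contra h0; exact hg ⟨_, hα h g h0⟩
    have hγ0 : ∀ h g, (¬ ∃ x, gsrc g ∈ C x ∧ gtgt g ∈ C x) → γ h g = 0 := by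
      intro h g hg; by_contra h0; exact hg ⟨_, hγ h g h0⟩
    have hcS : ∀ g, ¬ inS g → c g = 0 := by
      intro g hg
      have hg1 : ¬ ∃ x, gsrc g ∈ C x ∧ gtgt g ∈ C x := fun h => hg (Or.inl h)
      have hg2 : ∀ h, g ≠ l h := fun h hh => hg (Or.inr ⟨h, hh⟩)
      rw [hc]
      refine Finset.sum_eq_zero fun h _ => ?_
      simp [hg2, hα0 h g hg1, hγ0 h g hg1]
    have hcl : ∀ h, c (l h) = y h := by
      intro h
      have hg1 : ¬ ∃ x, gsrc (l h) ∈ C x ∧ gtgt (l h) ∈ C x := fun ⟨x, hx⟩ => hlin h x hx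
      rw [hc, Finset.sum_eq_single h]
      · simp [hα0 _ _ hg1, hγ0 _ _ hg1]
      · intro h' _ hne
        have : l h ≠ l h' := fun hh => hne (hl hh).symm
        simp [hα0 _ _ hg1, hγ0 _ _ hg1, this]
      · simp
    have hbd : gbd c = 0 := by
      have : gbd c = ∑ h, y h • (Pi.single (base (a h)) 1 + Pi.single (base (b h)) 1) := by
        simp only [c, map_sum, map_smul, map_add]
        refine Finset.sum_congr rfl fun h _ => ?_
        rw [hpq, hα', hγ']
        congr 1
        ext u
        simp only [Pi.add_apply]
        generalize (Pi.single (p h) 1 : ℤ × ℤ → ZMod 2) u = a1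
        generalize (Pi.single (q h) 1 : ℤ × ℤ → ZMod 2) u = a2
        generalize (Pi.single (base (a h)) 1 : ℤ × ℤ → ZMod 2) u = a3
        generalize (Pi.single (base (b h)) 1 : ℤ × ℤ → ZMod 2) u = a4
        revert a1 a2 a3 a4; decide
      rw [this]
      ext u
      simp only [Finset.sum_apply, Pi.smul_apply, Pi.add_apply, Pi.single_apply, smul_eq_mul, Pi.zero_apply]
      by_cases hu : ∃ x, u = base x
      · obtain ⟨x, rfl⟩ := hu
        have h1 := congrFun hy x
        simp only [Pi.zero_apply, incMap, LinearMap.coe_mk, AddHom.coe_mk] at h1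
        refine Eq.trans ?_ h1
        have e0 : ∀ z, (if base x = base z then (1 : ZMod 2) else 0) = if z = x then 1 else 0 := by
          intro z
          by_cases hz : z = x
          · subst hz; simp
          · rw [if_neg hz, if_neg]
            intro hh
            apply hz
            have := hbase x
            rw [hh] at this
            exact hdisj _ _ _ (hbase z) this
        refine Finset.sum_congr rfl fun h _ => ?_
        rw [e0, e0]
      · refine Finset.sum_eq_zero fun h _ => ?_
        have : ∀ z, u ≠ base z := fun z hz => hu ⟨z, hz⟩
        simp [this]
    obtain ⟨M, hM⟩ : ∃ M : ℤ, ∀ p ∈ U, M ≤ p.2 := by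
      obtain ⟨M, hM⟩ := (U.image Prod.snd).bddBelow
      exact ⟨M, fun p hp => hM (by simpa using ⟨p.1, hp⟩)⟩
    obtain ⟨w, hw⟩ := grid_exact c M (by
      intro d i j hj'
      apply hcS
      intro h
      have := hM _ (hU _ h)
      simp only [gsrc] at this
      omega) hbd
    refine ⟨Quot.lift w ?_, ?_⟩
    · rintro _ _ ⟨g, hg, rfl, rfl⟩
      have := hcS g hg
      rw [← hw, gcob_side] at this
      exact z2_add_eq_zero this
    · intro h
      refine (hcl h).symm.trans ?_
      have := congrFun hw (l h)
      rw [gcob_side] at this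
      exact this.symm

lemma grid_blocks {ι E : Type} [Fintype ι] [Fintype E]
    (s t : E → ι) (hst : ∀ e f, s e ≠ t f) (hinj : ∀ e f, s e = s f → t e = t f → e = f)
    (B : ι → Finset (ℤ × ℤ)) (M : E → Finset (ℤ × ℤ))
    (hBne : ∀ x, (B x).Nonempty) (hMne : ∀ x, (M x).Nonempty)
    (hB : ∀ x, ∀ p ∈ B x, ∀ q ∈ B x, gconn (B x) p q)
    (hM : ∀ x, ∀ p ∈ M x, ∀ q ∈ M x, gconn (M x) p q)
    (hBB : ∀ x y, ∀ p ∈ B x, p ∈ B y → x = y)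
    (hMM : ∀ x y, ∀ p ∈ M x, p ∈ M y → x = y)
    (hBM : ∀ x y, ∀ p ∈ B x, p ∉ M y)
    (ls lt : E → GE) (hls : ∀ e, gjoin (ls e) (B (s e)) (M e))
    (hlt : ∀ e, gjoin (lt e) (B (t e)) (M e)) :
    Fintype.card E ≤ 2 * Fintype.card ι := by
  let C : ι ⊕ E → Finset (ℤ × ℤ) := Sum.elim B M
  let a : E × Bool → ι ⊕ E := fun h => Sum.inl (if h.2 then s h.1 else t h.1)
  let b : E × Bool → ι ⊕ E := fun h => Sum.inr h.1
  let l : E × Bool → GE := fun h => if h.2 then ls h.1 else lt h.1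
  have hdisj : ∀ x y, ∀ p ∈ C x, p ∈ C y → x = y := by
    rintro (x | x) (y | y) p hx hy
    · rw [hBB x y p hx hy]
    · exact absurd hy (hBM x y p hx)
    · exact absurd hx (hBM y x p hy)
    · rw [hMM x y p hx hy]
  have hj : ∀ h, gjoin (l h) (C (a h)) (C (b h)) := by
    rintro ⟨e, _ | _⟩
    · exact hlt e
    · exact hls e
  have hl : Function.Injective l := by
    intro h h' hh
    have h1 := hj h
    have h2 := hj h'
    rw [hh] at h1
    have hne : ∀ h h', a h ≠ b h' := by intro h h'; simp [a, b]
    have : a h = a h' ∧ b h = b h' := by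
      rcases h1 with ⟨h3, h4⟩ | ⟨h3, h4⟩ <;> rcases h2 with ⟨h5, h6⟩ | ⟨h5, h6⟩
      · exact ⟨hdisj _ _ _ h3 h5, hdisj _ _ _ h4 h6⟩
      · exact absurd (hdisj _ _ _ h3 h5) (hne _ _)
      · exact absurd (hdisj _ _ _ h4 h6) (hne _ _)
      · exact ⟨hdisj _ _ _ h4 h6, hdisj _ _ _ h3 h5⟩
    obtain ⟨e, i⟩ := h
    obtain ⟨f, j⟩ := h'
    obtain ⟨h7, h8⟩ := this
    simp only [a, b, Sum.inl.injEq, Sum.inr.injEq] at h7 h8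
    subst h8
    cases i <;> cases j
    · rfl
    · simp at h7; exact absurd h7.symm (hst _ _)
    · simp at h7; exact absurd h7 (hst _ _)
    · rfl
  obtain ⟨Q, φ₁, φ₂, H1, H2⟩ := blocks_exact C
    (by rintro (x | x); exacts [hBne x, hMne x])
    (by rintro (x | x); exacts [hB x, hM x]) hdisj a b (by intro h; simp [a, b]) l hl hj
  have HE : ∀ (y : E × Bool → ZMod 2) (e : E), incMap a b y (Sum.inr e) = y (e, true) + y (e, false) := by
    intro y e
    simp only [incMap, LinearMap.coe_mk, AddHom.coe_mk, a, b, reduceCtorEq, if_false, zero_add, Sum.inr.injEq, Fintype.sum_prod_type, Fintype.sum_bool, mul_ite, mul_one, mul_zero]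
    simp [Finset.sum_add_distrib]
  have HV : ∀ (y : E × Bool → ZMod 2) (v : ι), incMap a b y (Sum.inl v) = ∑ e, (y (e, true) * (if s e = v then 1 else 0) + y (e, false) * (if t e = v then 1 else 0)) := by
    intro y v
    simp only [incMap, LinearMap.coe_mk, AddHom.coe_mk, a, b, reduceCtorEq, if_false, add_zero, Sum.inl.injEq, Fintype.sum_prod_type, Fintype.sum_bool]
    simp
  refine macLane_bound s t hst hinj (fun e => φ₁ (e, true)) (fun e => φ₂ (e, true)) ?_ ?_
  · intro q
    have h1 := H1 q
    ext v
    have h2 := congrFun h1 (Sum.inl v)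
    rw [HV] at h2
    simp only [incMap, LinearMap.coe_mk, AddHom.coe_mk]
    refine Eq.trans (Finset.sum_congr rfl fun e _ => ?_) h2
    have h3 := congrFun h1 (Sum.inr e)
    rw [HE] at h3
    rw [← z2_add_eq_zero h3, ← mul_add]
    rfl
  · intro z hz
    obtain ⟨w, hw⟩ := H2 (fun h => z h.1) (by
      ext x
      rcases x with v | e
      · rw [HV]
        have := congrFun hz v
        simp only [incMap, LinearMap.coe_mk, AddHom.coe_mk] at this
        refine Eq.trans (Finset.sum_congr rfl fun e _ => ?_) this
        rw [mul_add]
      · rw [HE]; exact z2_self _)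
    exact ⟨w, fun e => hw (e, true)⟩

end PartG

set_option linter.all false

section PartG2
open Classical

lemma gconn_symm {P : Set (ℤ × ℤ)} {x y : ℤ × ℤ} (h : gconn P x y) : gconn P y x := by
  unfold gconn at *
  induction h with
  | refl => exact Relation.ReflTransGen.refl
  | tail h1 h2 ih =>
    exact Relation.ReflTransGen.head ⟨gadj_symm h2.1, h2.2.2, h2.2.1⟩ ih

lemma gconn_trans {P : Set (ℤ × ℤ)} {x y z : ℤ × ℤ} (h : gconn P x y) (h' : gconn P y z) :
    gconn P x z := Relation.ReflTransGen.trans h h'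

lemma gconn_class (R : Set (ℤ × ℤ)) (z0 : ℤ × ℤ) (M : Set (ℤ × ℤ)) (hM : ∀ z, z ∈ M ↔ z ∈ R ∧ gconn R z0 z)
    (p q : ℤ × ℤ) (hp : p ∈ M) (hq : q ∈ M) : gconn M p q := by
  have key : ∀ z, gconn R z0 z → gconn M z0 z := by
    intro z hz
    unfold gconn at hz
    induction hz with
    | refl => exact Relation.ReflTransGen.refl
    | tail h1 h2 ih =>
      refine Relation.ReflTransGen.tail ih ⟨h2.1, ?_, ?_⟩
      · exact (hM _).2 ⟨h2.2.1, h1⟩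
      · exact (hM _).2 ⟨h2.2.2, Relation.ReflTransGen.tail h1 h2⟩
  exact gconn_trans (gconn_symm (key p ((hM p).1 hp).2)) (key q ((hM q).1 hq).2)

lemma gadj_join {p q : ℤ × ℤ} (h : gadj p q) {P Q : Set (ℤ × ℤ)} (hp : p ∈ P) (hq : q ∈ Q) :
    ∃ g, gjoin g P Q := by
  obtain ⟨g, ⟨rfl, rfl⟩ | ⟨rfl, rfl⟩⟩ := h
  · exact ⟨g, Or.inl ⟨hp, hq⟩⟩
  · exact ⟨g, Or.inr ⟨hq, hp⟩⟩

lemma extract_mid (W A B : Finset (ℤ × ℤ)) (hW : ∀ p ∈ W, ∀ q ∈ W, gconn W p q)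
    (hAB : ∀ p ∈ A, p ∉ B) (hAB' : ∀ p ∈ A, ∀ q ∈ B, ¬ gadj p q)
    (hA : ∃ p ∈ W, p ∈ A) (hB : ∃ p ∈ W, p ∈ B) :
    ∃ M : Finset (ℤ × ℤ), M.Nonempty ∧ (∀ p ∈ M, p ∈ W ∧ p ∉ A ∧ p ∉ B) ∧
      (∀ p ∈ M, ∀ q ∈ M, gconn M p q) ∧ (∃ g, gjoin g A M) ∧ ∃ g, gjoin g B M := by
  by_contra hcon
  obtain ⟨x, hxW, hxA⟩ := hA
  obtain ⟨y, hyW, hyB⟩ := hB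
  let R : Set (ℤ × ℤ) := {z | z ∈ W ∧ z ∉ A ∧ z ∉ B}
  have key : ∀ y, gconn W x y → (y ∈ A ∨ (y ∈ R ∧ ∃ z0 ∈ R, (∃ b ∈ A, gadj b z0) ∧ gconn R z0 y)) := by
    intro y hy
    unfold gconn at hy
    induction hy with
    | refl => exact Or.inl hxA
    | tail h1 h2 ih =>
      rename_i b d
      obtain ⟨hbd, hb, hd⟩ := h2
      by_cases hdA : d ∈ A
      · exact Or.inl hdA
      right
      by_cases hdB : d ∈ B
      · exfalso
        rcases ih with hbA | ⟨hbR, z0, hz0, ⟨b', hb'A, hb'⟩, hz⟩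
        · exact hAB' _ hbA _ hdB hbd
        · apply hcon
          let M : Finset (ℤ × ℤ) := W.filter (fun z => z ∈ R ∧ gconn R z0 z)
          have hM : ∀ z, z ∈ (M : Set (ℤ × ℤ)) ↔ z ∈ R ∧ gconn R z0 z := by
            intro z
            simp only [M, Finset.coe_filter, mem_setOf_eq]
            exact ⟨fun h => h.2, fun h => ⟨h.1.1, h⟩⟩
          have hz0M : z0 ∈ (M : Set (ℤ × ℤ)) := (hM _).2 ⟨hz0, Relation.ReflTransGen.refl⟩
          refine ⟨M, ⟨z0, hz0M⟩, ?_, ?_, ?_, ?_⟩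
          · intro p hp; exact ((hM p).1 hp).1
          · intro p hp q hq; exact gconn_class R z0 M hM p q hp hq
          · exact gadj_join hb' hb'A hz0M
          · exact gadj_join (gadj_symm hbd) hdB ((hM _).2 ⟨hbR, hz⟩)
      · have hdR : d ∈ R := ⟨hd, hdA, hdB⟩
        refine ⟨hdR, ?_⟩
        rcases ih with hbA | ⟨hbR, z0, hz0, hb', hz⟩
        · exact ⟨d, hdR, ⟨b, hbA, hbd⟩, Relation.ReflTransGen.refl⟩
        · exact ⟨z0, hz0, hb', Relation.ReflTransGen.tail hz ⟨hbd, hbR, hdR⟩⟩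
  rcases key y (hW x hxW y hyW) with h | h
  · exact hAB y h hyB
  · exact h.1.2.2 hyB

lemma grid_lemma {ι E : Type} [Fintype ι] [Fintype E]
    (s t : E → ι) (hst : ∀ e f, s e ≠ t f) (hinj : ∀ e f, s e = s f → t e = t f → e = f)
    (B : ι → Finset (ℤ × ℤ)) (W : E → Finset (ℤ × ℤ))
    (hBne : ∀ x, (B x).Nonempty)
    (hB : ∀ x, ∀ p ∈ B x, ∀ q ∈ B x, gconn (B x) p q)
    (hW : ∀ x, ∀ p ∈ W x, ∀ q ∈ W x, gconn (W x) p q)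
    (hBB : ∀ x y, ∀ p ∈ B x, p ∈ B y → x = y)
    (hBB' : ∀ x y, x ≠ y → ∀ p ∈ B x, ∀ q ∈ B y, ¬ gadj p q)
    (hs : ∀ e, ∃ p ∈ W e, p ∈ B (s e)) (ht : ∀ e, ∃ p ∈ W e, p ∈ B (t e))
    (hWB : ∀ e w, w ≠ s e → w ≠ t e → ∀ p ∈ W e, p ∉ B w)
    (hWW : ∀ e f, e ≠ f → ∀ p ∈ W e, p ∈ W f → ∃ w, p ∈ B w) :
    Fintype.card E ≤ 2 * Fintype.card ι := by
  choose M h1 h2 h3 h4 h5 using fun e => extract_mid (W e) (B (s e)) (B (t e)) (hW e)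
    (fun p hp hq => hst e e (hBB _ _ p hp hq)) (hBB' _ _ (hst e e)) (hs e) (ht e)
  choose ls hls using h4
  choose lt hlt using h5
  have hBM : ∀ x y, ∀ p ∈ B x, p ∉ M y := by
    intro x e p hp hM
    by_cases hx : x = s e
    · subst hx; exact (h2 e p hM).2.1 hp
    by_cases hx' : x = t e
    · subst hx'; exact (h2 e p hM).2.2 hp
    exact hWB e x hx hx' p (h2 e p hM).1 hp
  refine grid_blocks s t hst hinj B M hBne h1 hB h3 hBB ?_ hBM ls lt hls hlt
  intro e f p he hf
  by_contra hne
  obtain ⟨w, hw⟩ := hWW e f hne p (h2 e p he).1 (h2 f p hf).1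
  exact hBM w e p hw he

end PartG2

set_option linter.all false

section PartC
open Classical Topology

def gcell (h : ℝ) (c : ℤ × ℤ) : Set (ℝ × ℝ) :=
  Icc (c.1 * h) ((c.1 + 1) * h) ×ˢ Icc (c.2 * h) ((c.2 + 1) * h)

def gcells (h : ℝ) (X : Set (ℝ × ℝ)) : Set (ℤ × ℤ) := {c | ∃ x ∈ X, x ∈ gcell h c}

lemma gcell_dist {h : ℝ} {c : ℤ × ℤ} {x y : ℝ × ℝ} (hx : x ∈ gcell h c) (hy : y ∈ gcell h c) :
    dist x y ≤ h := by
  obtain ⟨⟨a1, a2⟩, a3, a4⟩ := hx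
  obtain ⟨⟨b1, b2⟩, b3, b4⟩ := hy
  rw [Prod.dist_eq, Real.dist_eq, Real.dist_eq]
  refine max_le ?_ ?_ <;> rw [abs_le] <;> constructor <;> linarith

lemma gcell_exists {h : ℝ} (hh : 0 < h) (x : ℝ × ℝ) : ∃ c, x ∈ gcell h c := by
  refine ⟨(⌊x.1 / h⌋, ⌊x.2 / h⌋), ⟨?_, ?_⟩, ?_, ?_⟩
  · exact (le_div_iff₀ hh).1 (Int.floor_le _)
  · exact (div_le_iff₀ hh).1 (Int.lt_floor_add_one _).le
  · exact (le_div_iff₀ hh).1 (Int.floor_le _)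
  · exact (div_le_iff₀ hh).1 (Int.lt_floor_add_one _).le

lemma gcell_adj {h : ℝ} (hh : 0 < h) {c d : ℤ × ℤ} (hcd : gadj c d) : ∃ x, x ∈ gcell h c ∧ x ∈ gcell h d := by
  have key : ∀ g : GE, (gtgt g).1 * h ∈ Icc ((gsrc g).1 * h) (((gsrc g).1 + 1) * h) ∧
      (gtgt g).2 * h ∈ Icc ((gsrc g).2 * h) (((gsrc g).2 + 1) * h) := by
    rintro ⟨d, i, j⟩
    cases d <;> simp [gsrc, gtgt] <;> constructor <;> nlinarith
  have k2 : ∀ c : ℤ × ℤ, ((c.1 * h, c.2 * h) : ℝ × ℝ) ∈ gcell h c := by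
    intro c; refine ⟨⟨le_rfl, ?_⟩, le_rfl, ?_⟩ <;> simp only <;> nlinarith
  obtain ⟨g, ⟨rfl, rfl⟩ | ⟨rfl, rfl⟩⟩ := hcd
  · exact ⟨((gtgt g).1 * h, (gtgt g).2 * h), key g, k2 _⟩
  · exact ⟨((gtgt g).1 * h, (gtgt g).2 * h), k2 _, key g⟩

lemma gcell_closed (h : ℝ) (c : ℤ × ℤ) : IsClosed (gcell h c) := isClosed_Icc.prod isClosed_Icc

lemma gcells_finite {h : ℝ} (hh : 0 < h) {X : Set (ℝ × ℝ)} (hX : IsCompact X) : (gcells h X).Finite := by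
  obtain ⟨R, hR⟩ := hX.isBounded.subset_closedBall (0 : ℝ × ℝ)
  refine Set.Finite.subset ((Set.finite_Icc (-⌈R / h⌉ - 1) ⌈R / h⌉).prod (Set.finite_Icc (-⌈R / h⌉ - 1) ⌈R / h⌉)) ?_
  rintro ⟨i, j⟩ ⟨x, hx, ⟨a1, a2⟩, a3, a4⟩
  have := hR hx
  rw [mem_closedBall_zero_iff, Prod.norm_def, max_le_iff, Real.norm_eq_abs, Real.norm_eq_abs, abs_le, abs_le] at this
  obtain ⟨⟨b1, b2⟩, b3, b4⟩ := this
  have hc : R ≤ ⌈R / h⌉ * h := (div_le_iff₀ hh).1 (Int.le_ceil _)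
  simp only at a1 a2 a3 a4
  have f1 : ∀ i : ℤ, (i : ℝ) * h ≤ R → i ≤ ⌈R / h⌉ := by
    intro i hi
    have : (i : ℝ) * h ≤ ⌈R / h⌉ * h := hi.trans hc
    exact_mod_cast le_of_mul_le_mul_right this hh
  have f2 : ∀ i : ℤ, -R ≤ ((i : ℝ) + 1) * h → -⌈R / h⌉ - 1 ≤ i := by
    intro i hi
    have : ((-⌈R / h⌉ : ℤ) : ℝ) * h ≤ ((i + 1 : ℤ) : ℝ) * h := by push_cast; linarith
    have := le_of_mul_le_mul_right this hh
    have : -⌈R / h⌉ ≤ i + 1 := by exact_mod_cast this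
    linarith
  exact ⟨⟨f2 i (by linarith), f1 i (by linarith)⟩, f2 j (by linarith), f1 j (by linarith)⟩

lemma gcell_link1 {h : ℝ} (hh : 0 < h) {P : Set (ℤ × ℤ)} {i i' j j' : ℤ} {x : ℝ × ℝ}
    (hP : ∀ c, x ∈ gcell h c → c ∈ P)
    (h1 : x ∈ gcell h (i, j)) (h2 : x ∈ gcell h (i', j')) : gconn P (i, j) (i', j') := by
  have f : ∀ (i i' : ℤ) (y : ℝ), (i : ℝ) * h ≤ y → y ≤ ((i' : ℝ) + 1) * h → i ≤ i' + 1 := by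
    intro i i' y h3 h4
    have : (i : ℝ) * h ≤ ((i' + 1 : ℤ) : ℝ) * h := by push_cast; linarith
    exact_mod_cast le_of_mul_le_mul_right this hh
  have h3 : x ∈ gcell h (i', j) := ⟨h2.1, h1.2⟩
  have i1 := f i i' x.1 h1.1.1 h2.1.2
  have i2 := f i' i x.1 h2.1.1 h1.1.2
  have j1 := f j j' x.2 h1.2.1 h2.2.2
  have j2 := f j' j x.2 h2.2.1 h1.2.2
  have s1 : gconn P (i, j) (i', j) := by
    by_cases hi : i = i'
    · subst hi; exact Relation.ReflTransGen.refl
    · refine Relation.ReflTransGen.single ⟨?_, hP _ h1, hP _ h3⟩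
      rcases lt_or_gt_of_ne hi with hi | hi
      · exact ⟨(true, i, j), Or.inl ⟨rfl, by simp [gtgt]; omega⟩⟩
      · exact ⟨(true, i', j), Or.inr ⟨rfl, by simp [gtgt]; omega⟩⟩
  have s2 : gconn P (i', j) (i', j') := by
    by_cases hi : j = j'
    · subst hi; exact Relation.ReflTransGen.refl
    · refine Relation.ReflTransGen.single ⟨?_, hP _ h3, hP _ h2⟩
      rcases lt_or_gt_of_ne hi with hi | hi
      · exact ⟨(false, i', j), Or.inl ⟨rfl, by simp [gtgt]; omega⟩⟩
      · exact ⟨(false, i', j'), Or.inr ⟨rfl, by simp [gtgt]; omega⟩⟩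
  exact gconn_trans s1 s2

lemma gcells_conn {h : ℝ} (hh : 0 < h) {X : Set (ℝ × ℝ)} (hX : IsCompact X) (hc : IsPreconnected X)
    (p q : ℤ × ℤ) (hp : p ∈ gcells h X) (hq : q ∈ gcells h X) : gconn (gcells h X) p q := by
  by_contra hpq
  have hfin := gcells_finite hh hX
  let A : Set (ℤ × ℤ) := {c | c ∈ gcells h X ∧ gconn (gcells h X) p c}
  let A' : Set (ℤ × ℤ) := {c | c ∈ gcells h X ∧ ¬ gconn (gcells h X) p c}
  have hA : A.Finite := hfin.subset fun c hc => hc.1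
  have hA' : A'.Finite := hfin.subset fun c hc => hc.1
  have hcl := hA.isClosed_biUnion (fun c _ => gcell_closed h c)
  have hcl' := hA'.isClosed_biUnion (fun c _ => gcell_closed h c)
  obtain ⟨xp, hxp, hxp'⟩ := hp
  obtain ⟨xq, hxq, hxq'⟩ := hq
  obtain ⟨x, hx, h1, h2⟩ := isPreconnected_closed_iff.1 hc _ _ hcl hcl' (by
      intro x hx
      obtain ⟨c, hxc⟩ := gcell_exists hh x
      have hcX : c ∈ gcells h X := ⟨x, hx, hxc⟩
      by_cases hgc : gconn (gcells h X) p c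
      · left; exact mem_biUnion (show c ∈ A from ⟨hcX, hgc⟩) hxc
      · right; exact mem_biUnion (show c ∈ A' from ⟨hcX, hgc⟩) hxc)
    ⟨xp, hxp, mem_biUnion (show p ∈ A from ⟨⟨xp, hxp, hxp'⟩, Relation.ReflTransGen.refl⟩) hxp'⟩
    ⟨xq, hxq, mem_biUnion (show q ∈ A' from ⟨⟨xq, hxq, hxq'⟩, hpq⟩) hxq'⟩
  simp only [mem_iUnion] at h1 h2
  obtain ⟨c, hcA, hxc⟩ := h1
  obtain ⟨d, hdA, hxd⟩ := h2
  apply hdA.2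
  refine gconn_trans hcA.2 ?_
  exact gcell_link1 hh (fun e he => ⟨x, hx, he⟩) hxc hxd

lemma ev_dist {X Y : Set (ℝ × ℝ)} (hX : IsCompact X) (hY : IsCompact Y) (hd : ∀ x ∈ X, x ∉ Y) (C : ℝ) (hC : 0 < C) :
    ∀ᶠ ε in 𝓝[>] (0 : ℝ), ∀ x ∈ X, ∀ y ∈ Y, C * ε < dist x y := by
  obtain ⟨r, hr, h⟩ := Metric.exists_pos_forall_lt_edist hX hY.isClosed (Set.disjoint_left.2 hd)
  have : Ioo (0 : ℝ) (r / C) ∈ 𝓝[>] (0 : ℝ) := Ioo_mem_nhdsGT (by positivity)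
  filter_upwards [this] with ε hε x hx y hy
  have h1 := h x hx y hy
  rw [edist_nndist, ENNReal.coe_lt_coe] at h1
  have h2 : (r : ℝ) < dist x y := by exact_mod_cast h1
  have := (lt_div_iff₀ hC).1 hε.2
  linarith

theorem topo_lemma {ι E : Type} [Fintype ι] [Fintype E]
    (s t : E → ι) (hst : ∀ e f, s e ≠ t f) (hinj : ∀ e f, s e = s f → t e = t f → e = f)
    (K : ι → Set (ℝ × ℝ)) (L : E → Set (ℝ × ℝ))
    (hKc : ∀ w, IsCompact (K w)) (hK : ∀ w, IsConnected (K w))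
    (hLc : ∀ e, IsCompact (L e)) (hL : ∀ e, IsPreconnected (L e))
    (hKK : ∀ v w, ∀ x ∈ K v, x ∈ K w → v = w)
    (hs : ∀ e, ∃ x ∈ L e, x ∈ K (s e)) (ht : ∀ e, ∃ x ∈ L e, x ∈ K (t e))
    (hLK : ∀ e w, w ≠ s e → w ≠ t e → ∀ x ∈ L e, x ∉ K w)
    (hLL : ∀ e f, e ≠ f → ∀ x ∈ L e, x ∈ L f → ∃ w, x ∈ K w) :
    Fintype.card E ≤ 2 * Fintype.card ι := by
  have ev1 : ∀ᶠ ε in 𝓝[>] (0 : ℝ), ∀ v w, v ≠ w → ∀ x ∈ K v, ∀ y ∈ K w, 2 * ε < dist x y := by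
    simp only [Filter.eventually_all]
    intro v w hvw
    exact ev_dist (hKc v) (hKc w) (fun x hx hy => hvw (hKK v w x hx hy)) 2 two_pos
  have ev2 : ∀ᶠ ε in 𝓝[>] (0 : ℝ), ∀ e w, w ≠ s e → w ≠ t e → ∀ x ∈ L e, ∀ y ∈ K w, 1 * ε < dist x y := by
    simp only [Filter.eventually_all]
    intro e w h1 h2
    exact ev_dist (hLc e) (hKc w) (hLK e w h1 h2) 1 one_pos
  obtain ⟨ε, h1, h2, hε⟩ := (ev1.and (ev2.and self_mem_nhdsWithin)).exists
  replace hε : 0 < ε := hε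
  let U : ι → Set (ℝ × ℝ) := fun w => (fun p : (ℝ × ℝ) × (ℝ × ℝ) => p.1 + p.2) '' (K w ×ˢ Metric.closedBall 0 ε)
  have hUc : ∀ w, IsCompact (U w) := fun w =>
    ((hKc w).prod (isCompact_closedBall _ _)).image (by fun_prop)
  have hU : ∀ w, IsConnected (U w) := fun w =>
    ((hK w).prod ((convex_closedBall _ _).isConnected ⟨0, by simp [hε.le]⟩)).image _ (by fun_prop)
  have hUmem : ∀ w x, x ∈ U w → ∃ y ∈ K w, dist x y ≤ ε := by
    rintro w _ ⟨⟨y, z⟩, ⟨hy, hz⟩, rfl⟩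
    refine ⟨y, hy, ?_⟩
    simpa [dist_eq_norm] using hz
  have hUmem' : ∀ w x y, y ∈ K w → dist x y ≤ ε → x ∈ U w := by
    intro w x y hy hd
    refine ⟨(y, x - y), ⟨hy, ?_⟩, by simp⟩
    simpa [dist_eq_norm] using hd
  have hUU : ∀ v w, v ≠ w → ∀ x ∈ U v, x ∉ U w := by
    intro v w hvw x hx hx'
    obtain ⟨y, hy, hxy⟩ := hUmem v x hx
    obtain ⟨z, hz, hxz⟩ := hUmem w x hx'
    have := h1 v w hvw y hy z hz
    have := dist_triangle_left y z x
    linarith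
  have hLU : ∀ e w, w ≠ s e → w ≠ t e → ∀ x ∈ L e, x ∉ U w := by
    intro e w a b x hx hy
    obtain ⟨y, hy, hxy⟩ := hUmem w x hy
    have := h2 e w a b x hx y hy
    linarith
  let L' : E → Set (ℝ × ℝ) := fun e => L e ∩ {x | ∀ w, ∀ y ∈ K w, ε ≤ dist x y}
  have hL'c : ∀ e, IsCompact (L' e) := by
    intro e
    refine (hLc e).inter_right ?_
    simp only [setOf_forall]
    refine isClosed_iInter fun w => isClosed_iInter fun y => isClosed_iInter fun hy => ?_
    exact isClosed_le continuous_const (by fun_prop)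
  have hLL' : ∀ e f, e ≠ f → ∀ x ∈ L' e, x ∉ L' f := by
    intro e f hef x hx hy
    obtain ⟨w, hw⟩ := hLL e f hef x hx.1 hy.1
    have := hx.2 w x hw
    rw [dist_self] at this
    linarith
  have ev3 : ∀ᶠ h in 𝓝[>] (0 : ℝ), ∀ v w, v ≠ w → ∀ x ∈ U v, ∀ y ∈ U w, 2 * h < dist x y := by
    simp only [Filter.eventually_all]
    intro v w hvw
    exact ev_dist (hUc v) (hUc w) (hUU v w hvw) 2 two_pos
  have ev4 : ∀ᶠ h in 𝓝[>] (0 : ℝ), ∀ e w, w ≠ s e → w ≠ t e → ∀ x ∈ L e, ∀ y ∈ U w, 1 * h < dist x y := by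
    simp only [Filter.eventually_all]
    intro e w h1 h2
    exact ev_dist (hLc e) (hUc w) (hLU e w h1 h2) 1 one_pos
  have ev5 : ∀ᶠ h in 𝓝[>] (0 : ℝ), ∀ e f, e ≠ f → ∀ x ∈ L' e, ∀ y ∈ L' f, 1 * h < dist x y := by
    simp only [Filter.eventually_all]
    intro e f hef
    exact ev_dist (hL'c e) (hL'c f) (hLL' e f hef) 1 one_pos
  obtain ⟨h, h3, h4, h5, hh⟩ := (ev3.and (ev4.and (ev5.and self_mem_nhdsWithin))).exists
  replace hh : 0 < h := hh
  let B : ι → Finset (ℤ × ℤ) := fun w => (gcells_finite hh (hUc w)).toFinset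
  let W : E → Finset (ℤ × ℤ) := fun e => (gcells_finite hh (hLc e)).toFinset
  have hB : ∀ w c, c ∈ B w ↔ c ∈ gcells h (U w) := by intro w c; simp [B]
  have hW : ∀ e c, c ∈ W e ↔ c ∈ gcells h (L e) := by intro w c; simp [W]
  have hKU : ∀ w x, x ∈ K w → x ∈ U w := fun w x hx => hUmem' w x x hx (by simp [hε.le])
  have hLnear : ∀ e x, x ∈ L e → x ∉ L' e → ∃ w, x ∈ U w := by
    intro e x hx hx'
    have : ¬ ∀ w, ∀ y ∈ K w, ε ≤ dist x y := fun h => hx' ⟨hx, h⟩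
    push Not at this
    obtain ⟨w, y, hy, hxy⟩ := this
    exact ⟨w, hUmem' w x y hy hxy.le⟩
  refine grid_lemma s t hst hinj B W ?_ ?_ ?_ ?_ ?_ ?_ ?_ ?_ ?_
  · intro w
    obtain ⟨x, hx⟩ := (hU w).nonempty
    obtain ⟨c, hc⟩ := gcell_exists hh x
    exact ⟨c, (hB _ _).2 ⟨x, hx, hc⟩⟩
  · intro w p hp q hq
    have := gcells_conn hh (hUc w) (hU w).isPreconnected p q ((hB _ _).1 hp) ((hB _ _).1 hq)
    simpa [B] using this
  · intro e p hp q hq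
    have := gcells_conn hh (hLc e) (hL e) p q ((hW _ _).1 hp) ((hW _ _).1 hq)
    simpa [W] using this
  · intro v w p hp hq
    by_contra hvw
    obtain ⟨x, hx, hxc⟩ := (hB _ _).1 hp
    obtain ⟨y, hy, hyc⟩ := (hB _ _).1 hq
    have := h3 v w hvw x hx y hy
    have := gcell_dist hxc hyc
    linarith
  · intro v w hvw p hp q hq hadj
    obtain ⟨x, hx, hxc⟩ := (hB _ _).1 hp
    obtain ⟨y, hy, hyc⟩ := (hB _ _).1 hq
    obtain ⟨z, hz, hz'⟩ := gcell_adj hh hadj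
    have := h3 v w hvw x hx y hy
    have := gcell_dist hxc hz
    have := gcell_dist hz' hyc
    have := dist_triangle x z y
    linarith
  · intro e
    obtain ⟨x, hx, hx'⟩ := hs e
    obtain ⟨c, hc⟩ := gcell_exists hh x
    exact ⟨c, (hW _ _).2 ⟨x, hx, hc⟩, (hB _ _).2 ⟨x, hKU _ _ hx', hc⟩⟩
  · intro e
    obtain ⟨x, hx, hx'⟩ := ht e
    obtain ⟨c, hc⟩ := gcell_exists hh x
    exact ⟨c, (hW _ _).2 ⟨x, hx, hc⟩, (hB _ _).2 ⟨x, hKU _ _ hx', hc⟩⟩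
  · intro e w a b p hp hq
    obtain ⟨x, hx, hxc⟩ := (hW _ _).1 hp
    obtain ⟨y, hy, hyc⟩ := (hB _ _).1 hq
    have := h4 e w a b x hx y hy
    have := gcell_dist hxc hyc
    linarith
  · intro e f hef p hp hq
    obtain ⟨x, hx, hxc⟩ := (hW _ _).1 hp
    obtain ⟨y, hy, hyc⟩ := (hW _ _).1 hq
    by_cases hx' : x ∈ L' e
    · by_cases hy' : y ∈ L' f
      · have := h5 e f hef x hx' y hy'
        have := gcell_dist hxc hyc
        linarith
      · obtain ⟨w, hw⟩ := hLnear f y hy hy'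
        exact ⟨w, (hB _ _).2 ⟨y, hw, hyc⟩⟩
    · obtain ⟨w, hw⟩ := hLnear e x hx hx'
      exact ⟨w, (hB _ _).2 ⟨x, hw, hxc⟩⟩

end PartC

set_option linter.all false

noncomputable section PartD
open Classical

/-- Bipartite system of arcs -/
structure Sys (V E : Type) where
  vert : V → ℝ × ℝ
  vert_inj : Function.Injective vert
  arc : E → ℝ → ℝ × ℝ
  cont : ∀ e, ContinuousOn (arc e) (Icc 0 1)
  inj : ∀ e, InjOn (arc e) (Icc 0 1)
  a : E → V
  b : E → V
  arc0 : ∀ e, arc e 0 = vert (a e)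
  arc1 : ∀ e, arc e 1 = vert (b e)
  inner : ∀ e, ∀ t ∈ Ioo (0 : ℝ) 1, ∀ w, arc e t ≠ vert w
  hab : ∀ e f, a e ≠ b f
  hinj : ∀ e f, a e = a f → b e = b f → e = f
  cr_a : ∀ e f, e ≠ f → ∀ s ∈ Ioo (0 : ℝ) 1, ∀ t ∈ Ioo (0 : ℝ) 1, arc e s = arc f t → a e ≠ a f
  cr_b : ∀ e f, e ≠ f → ∀ s ∈ Ioo (0 : ℝ) 1, ∀ t ∈ Ioo (0 : ℝ) 1, arc e s = arc f t → b e ≠ b f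
  cr_uniq : ∀ e f, e ≠ f → ∀ s ∈ Ioo (0 : ℝ) 1, ∀ t ∈ Ioo (0 : ℝ) 1, arc e s = arc f t →
    ∀ s' ∈ Ioo (0 : ℝ) 1, ∀ t' ∈ Ioo (0 : ℝ) 1, arc e s' = arc f t' → s = s'

namespace Sys
variable {V E : Type} (D : Sys V E)

def cr (e f : E) : Prop := e ≠ f ∧ ∃ s ∈ Ioo (0 : ℝ) 1, ∃ t ∈ Ioo (0 : ℝ) 1, D.arc e s = D.arc f t

lemma cr_symm {e f : E} (h : D.cr e f) : D.cr f e := by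
  obtain ⟨h1, s, hs, t, ht, h⟩ := h
  exact ⟨h1.symm, t, ht, s, hs, h.symm⟩

lemma cr_ne_a {e f : E} (h : D.cr e f) : D.a e ≠ D.a f := by
  obtain ⟨h1, s, hs, t, ht, h⟩ := h
  exact D.cr_a e f h1 s hs t ht h

lemma cr_ne_b {e f : E} (h : D.cr e f) : D.b e ≠ D.b f := by
  obtain ⟨h1, s, hs, t, ht, h⟩ := h
  exact D.cr_b e f h1 s hs t ht h

/-- restriction to a subsystem -/
def restrict {V' E' : Type} (i : V' → V) (hi : Function.Injective i) (j : E' → E)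
    (hj : Function.Injective j) (a' b' : E' → V') (ha : ∀ e, i (a' e) = D.a (j e))
    (hb : ∀ e, i (b' e) = D.b (j e)) : Sys V' E' where
  vert v := D.vert (i v)
  vert_inj := D.vert_inj.comp hi
  arc e := D.arc (j e)
  cont e := D.cont _
  inj e := D.inj _
  a := a'
  b := b'
  arc0 e := by rw [D.arc0, ha]
  arc1 e := by rw [D.arc1, hb]
  inner e t ht w := D.inner _ t ht _
  hab e f h := D.hab (j e) (j f) (by rw [← ha, ← hb, h])
  hinj e f h h' := hj (D.hinj _ _ (by rw [← ha, ← ha, h]) (by rw [← hb, ← hb, h']))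
  cr_a e f h s hs t ht hst h' := D.cr_a _ _ (hj.ne h) s hs t ht hst (by rw [← ha, ← ha, h'])
  cr_b e f h s hs t ht hst h' := D.cr_b _ _ (hj.ne h) s hs t ht hst (by rw [← hb, ← hb, h'])
  cr_uniq e f h := D.cr_uniq _ _ (hj.ne h)

lemma restrict_cr {V' E' : Type} (i : V' → V) (hi : Function.Injective i) (j : E' → E)
    (hj : Function.Injective j) (a' b' : E' → V') (ha : ∀ e, i (a' e) = D.a (j e))
    (hb : ∀ e, i (b' e) = D.b (j e)) (e f : E') :
    (D.restrict i hi j hj a' b' ha hb).cr e f ↔ D.cr (j e) (j f) := by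
  unfold cr
  rw [hj.ne_iff]
  rfl

lemma param_cases {t : ℝ} (ht : t ∈ Icc (0 : ℝ) 1) : t = 0 ∨ t = 1 ∨ t ∈ Ioo (0 : ℝ) 1 := by
  rcases eq_or_lt_of_le ht.1 with h | h
  · exact Or.inl h.symm
  · rcases eq_or_lt_of_le ht.2 with h' | h'
    · exact Or.inr (Or.inl h')
    · exact Or.inr (Or.inr ⟨h, h'⟩)

theorem planar [Fintype V] [Fintype E] (h : ∀ e f, ¬ D.cr e f) :
    Fintype.card E ≤ 2 * Fintype.card V := by
  refine topo_lemma D.a D.b D.hab D.hinj (fun v => {D.vert v}) (fun e => D.arc e '' Icc 0 1)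
    (fun w => isCompact_singleton) (fun w => isConnected_singleton)
    (fun e => isCompact_Icc.image_of_continuousOn (D.cont e))
    (fun e => isPreconnected_Icc.image _ (D.cont e)) ?_ ?_ ?_ ?_ ?_
  · rintro v w x hx hy
    rw [mem_singleton_iff] at hx hy
    exact D.vert_inj (hx.symm.trans hy)
  · intro e
    exact ⟨_, ⟨0, by simp, rfl⟩, D.arc0 e⟩
  · intro e
    exact ⟨_, ⟨1, by simp, rfl⟩, D.arc1 e⟩
  · rintro e w h1 h2 _ ⟨t, ht, rfl⟩ hx
    rw [mem_singleton_iff] at hx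
    rcases param_cases ht with rfl | rfl | ht
    · rw [D.arc0] at hx; exact h1 (D.vert_inj hx).symm
    · rw [D.arc1] at hx; exact h2 (D.vert_inj hx).symm
    · exact D.inner e t ht w hx
  · rintro e f hef _ ⟨t, ht, rfl⟩ ⟨u, hu, hx⟩
    rcases param_cases ht with rfl | rfl | ht
    · exact ⟨_, D.arc0 e⟩
    · exact ⟨_, D.arc1 e⟩
    rcases param_cases hu with rfl | rfl | hu
    · exact ⟨_, hx.symm.trans (D.arc0 f)⟩
    · exact ⟨_, hx.symm.trans (D.arc1 f)⟩
    exact absurd ⟨hef, t, ht, u, hu, hx.symm⟩ (h e f)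

/-- crossing parameters -/
def T (e : E) : Set ℝ := {s | s ∈ Ioo (0 : ℝ) 1 ∧ ∃ f, f ≠ e ∧ ∃ t ∈ Ioo (0 : ℝ) 1, D.arc e s = D.arc f t}

lemma T_finite [Fintype E] (e : E) : (D.T e).Finite := by
  have : D.T e ⊆ ⋃ f : E, {s | s ∈ Ioo (0 : ℝ) 1 ∧ f ≠ e ∧ ∃ t ∈ Ioo (0 : ℝ) 1, D.arc e s = D.arc f t} := by
    rintro s ⟨hs, f, hf⟩
    exact mem_iUnion.2 ⟨f, hs, hf⟩
  refine Set.Finite.subset (Set.finite_iUnion fun f => Set.Subsingleton.finite ?_) this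
  rintro s ⟨hs, hf, t, ht, hst⟩ s' ⟨hs', -, t', ht', hst'⟩
  exact D.cr_uniq e f hf.symm s hs t ht hst s' hs' t' ht' hst'

def lo (e : E) : ℝ := sInf (D.T e)
def hi (e : E) : ℝ := sSup (D.T e)

def crossed (e : E) : Prop := ∃ f, D.cr e f

variable {D} in
lemma crossed.nonempty {e : E} (h : D.crossed e) : (D.T e).Nonempty := by
  obtain ⟨f, h1, s, hs, t, ht, h⟩ := h
  exact ⟨s, hs, f, h1.symm, t, ht, h⟩

lemma lo_mem [Fintype E] {e : E} (h : D.crossed e) : D.lo e ∈ D.T e :=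
  h.nonempty.csInf_mem (D.T_finite e)
lemma hi_mem [Fintype E] {e : E} (h : D.crossed e) : D.hi e ∈ D.T e :=
  h.nonempty.csSup_mem (D.T_finite e)
lemma lo_le [Fintype E] {e : E} {s : ℝ} (h : s ∈ D.T e) : D.lo e ≤ s :=
  csInf_le (D.T_finite e).bddBelow h
lemma le_hi [Fintype E] {e : E} {s : ℝ} (h : s ∈ D.T e) : s ≤ D.hi e :=
  le_csSup (D.T_finite e).bddAbove h

def mid (e : E) : Set (ℝ × ℝ) := D.arc e '' Icc (D.lo e) (D.hi e)

def KF (F : Finset E) : Set (ℝ × ℝ) := ⋃ f ∈ F, D.mid f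

def NF [Fintype V] (F : Finset E) : Finset V := Finset.univ.filter fun v =>
  ∃ e, D.crossed e ∧ ((v = D.a e ∧ D.arc e (D.lo e) ∈ D.KF F) ∨ (v = D.b e ∧ D.arc e (D.hi e) ∈ D.KF F))

/-- connected finite sets of edges -/
inductive CrConn : Finset E → Prop
  | pair {e f : E} (h : D.cr e f) : CrConn {e, f}
  | ins {e f : E} {F : Finset E} (hF : CrConn F) (hf : f ∈ F) (h : D.cr e f) : CrConn (insert e F)

variable {D} in
lemma CrConn.crossed {F : Finset E} (h : D.CrConn F) : ∀ e ∈ F, D.crossed e := by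
  induction h with
  | pair h =>
    intro x hx
    simp only [Finset.mem_insert, Finset.mem_singleton] at hx
    rcases hx with rfl | rfl
    exacts [⟨_, h⟩, ⟨_, D.cr_symm h⟩]
  | ins hF hf h ih =>
    intro x hx
    rcases Finset.mem_insert.1 hx with rfl | hx
    exacts [⟨_, h⟩, ih x hx]

variable [Fintype E]

lemma lohi_sub {e : E} (h : D.crossed e) : Icc (D.lo e) (D.hi e) ⊆ Ioo 0 1 := fun t ht =>
  ⟨(D.lo_mem h).1.1.trans_le ht.1, ht.2.trans_lt (D.hi_mem h).1.2⟩

lemma mid_compact {e : E} (h : D.crossed e) : IsCompact (D.mid e) :=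
  isCompact_Icc.image_of_continuousOn ((D.cont e).mono ((D.lohi_sub h).trans Ioo_subset_Icc_self))

lemma mid_conn {e : E} (h : D.crossed e) : IsConnected (D.mid e) :=
  (isConnected_Icc (D.lo_le (D.hi_mem h))).image _
    ((D.cont e).mono ((D.lohi_sub h).trans Ioo_subset_Icc_self))

lemma mem_mid {e : E} {s : ℝ} (h : s ∈ D.T e) : D.arc e s ∈ D.mid e :=
  ⟨s, ⟨D.lo_le h, D.le_hi h⟩, rfl⟩

lemma mid_inter {e f : E} (h : D.cr e f) : (D.mid e ∩ D.mid f).Nonempty := by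
  obtain ⟨h1, s, hs, t, ht, h⟩ := h
  refine ⟨D.arc e s, D.mem_mid ⟨hs, f, h1.symm, t, ht, h⟩, ?_⟩
  rw [h]
  exact D.mem_mid ⟨ht, e, h1, s, hs, h.symm⟩

lemma mid_disj {e f : E} (he : D.crossed e) (hf : D.crossed f) (hef : e ≠ f) (h : ¬ D.cr e f) :
    ∀ x ∈ D.mid e, x ∉ D.mid f := by
  rintro _ ⟨s, hs, rfl⟩ ⟨t, ht, hst⟩
  exact h ⟨hef, s, D.lohi_sub he hs, t, D.lohi_sub hf ht, hst.symm⟩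

variable {D} in
lemma CrConn.conn {F : Finset E} (h : D.CrConn F) : IsConnected (D.KF F) := by
  induction h with
  | @pair e f h =>
    have : D.KF {e, f} = D.mid e ∪ D.mid f := by
      ext x; simp [KF]
    rw [this]
    exact IsConnected.union (D.mid_inter h) (D.mid_conn ⟨_, h⟩) (D.mid_conn ⟨_, D.cr_symm h⟩)
  | @ins e f F hF hf h ih =>
    have : D.KF (insert e F) = D.mid e ∪ D.KF F := by
      ext x; simp [KF]
    rw [this]
    refine IsConnected.union ?_ (D.mid_conn ⟨_, h⟩) ih
    obtain ⟨x, hx, hx'⟩ := D.mid_inter h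
    exact ⟨x, hx, mem_biUnion hf hx'⟩

/-- half arcs -/
def half (h : E × Bool) : Set (ℝ × ℝ) :=
  D.arc h.1 '' (if h.2 then Icc 0 (D.lo h.1) else Icc (D.hi h.1) 1)
def hend (h : E × Bool) : V := if h.2 then D.a h.1 else D.b h.1
def htip (h : E × Bool) : ℝ × ℝ := D.arc h.1 (if h.2 then D.lo h.1 else D.hi h.1)

lemma half_compact {h : E × Bool} (hc : D.crossed h.1) : IsCompact (D.half h) := by
  obtain ⟨e, i⟩ := h
  have h1 := (D.lo_mem hc).1
  have h2 := (D.hi_mem hc).1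
  cases i
  · exact isCompact_Icc.image_of_continuousOn ((D.cont e).mono (Icc_subset_Icc h2.1.le le_rfl))
  · exact isCompact_Icc.image_of_continuousOn ((D.cont e).mono (Icc_subset_Icc le_rfl h1.2.le))

lemma half_conn {h : E × Bool} (hc : D.crossed h.1) : IsPreconnected (D.half h) := by
  obtain ⟨e, i⟩ := h
  have h1 := (D.lo_mem hc).1
  have h2 := (D.hi_mem hc).1
  cases i
  · exact isPreconnected_Icc.image _ ((D.cont e).mono (Icc_subset_Icc h2.1.le le_rfl))
  · exact isPreconnected_Icc.image _ ((D.cont e).mono (Icc_subset_Icc le_rfl h1.2.le))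

lemma hend_mem {h : E × Bool} (hc : D.crossed h.1) : D.vert (D.hend h) ∈ D.half h := by
  obtain ⟨e, i⟩ := h
  have h1 := (D.lo_mem hc).1
  have h2 := (D.hi_mem hc).1
  cases i
  · exact ⟨1, ⟨h2.2.le, le_rfl⟩, D.arc1 e⟩
  · exact ⟨0, ⟨le_rfl, h1.1.le⟩, D.arc0 e⟩

lemma htip_mem {h : E × Bool} (hc : D.crossed h.1) : D.htip h ∈ D.half h := by
  obtain ⟨e, i⟩ := h
  have h1 := (D.lo_mem hc).1
  have h2 := (D.hi_mem hc).1
  cases i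
  · exact ⟨_, ⟨le_rfl, h2.2.le⟩, rfl⟩
  · exact ⟨_, ⟨h1.1.le, le_rfl⟩, rfl⟩

lemma half_cases {h : E × Bool} (hc : D.crossed h.1) {x : ℝ × ℝ} (hx : x ∈ D.half h) :
    x = D.vert (D.hend h) ∨ ∃ s ∈ Ioo (0 : ℝ) 1, x = D.arc h.1 s ∧
      (if h.2 then s ≤ D.lo h.1 else D.hi h.1 ≤ s) := by
  obtain ⟨e, i⟩ := h
  have h1 := (D.lo_mem hc).1
  have h2 := (D.hi_mem hc).1
  cases i
  · obtain ⟨s, ⟨hs1, hs2⟩, rfl⟩ := hx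
    rcases eq_or_lt_of_le hs2 with rfl | hs2
    · left; exact D.arc1 e
    · right; exact ⟨s, ⟨h2.1.trans_le hs1, hs2⟩, rfl, hs1⟩
  · obtain ⟨s, ⟨hs1, hs2⟩, rfl⟩ := hx
    rcases eq_or_lt_of_le hs1 with rfl | hs1
    · left; exact D.arc0 e
    · right; exact ⟨s, ⟨hs1, hs2.trans_lt h1.2⟩, rfl, hs2⟩

lemma half_tip {h : E × Bool} {s : ℝ} (hs : s ∈ D.T h.1)
    (hs' : if h.2 then s ≤ D.lo h.1 else D.hi h.1 ≤ s) : D.arc h.1 s = D.htip h := by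
  obtain ⟨e, i⟩ := h
  cases i
  · have : s = D.hi e := le_antisymm (D.le_hi hs) hs'
    simp [htip, this]
  · have : s = D.lo e := le_antisymm hs' (D.lo_le hs)
    simp [htip, this]

lemma half_mid {h : E × Bool} (hc : D.crossed h.1) {f : E} (hf : D.crossed f) {x : ℝ × ℝ}
    (hx : x ∈ D.half h) (hxf : x ∈ D.mid f) : x = D.htip h := by
  obtain ⟨t, ht, rfl⟩ := hxf
  have ht' := D.lohi_sub hf ht
  rcases D.half_cases hc hx with h1 | ⟨s, hs, h1, h2⟩
  · exact absurd h1 (D.inner _ _ ht' _)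
  · by_cases hne : f = h.1
    · subst hne
      have : t = s := D.inj _ (Ioo_subset_Icc_self ht') (Ioo_subset_Icc_self hs) h1
      subst this
      obtain ⟨e, i⟩ := h
      cases i
      · have : t = D.hi e := le_antisymm ht.2 h2
        simp [htip, this]
      · have : t = D.lo e := le_antisymm h2 ht.1
        simp [htip, this]
    · rw [h1]
      exact D.half_tip ⟨hs, f, hne, t, ht', h1.symm⟩ h2

lemma half_half {h k : E × Bool} (hc : D.crossed h.1) (kc : D.crossed k.1) (hk : h ≠ k) {x : ℝ × ℝ}
    (hx : x ∈ D.half h) (hxk : x ∈ D.half k) : (∃ v, x = D.vert v) ∨ x = D.htip h := by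
  rcases D.half_cases hc hx with h1 | ⟨s, hs, h1, h2⟩
  · exact Or.inl ⟨_, h1⟩
  rcases D.half_cases kc hxk with k1 | ⟨t, ht, k1, k2⟩
  · exact Or.inl ⟨_, k1⟩
  right
  by_cases hne : k.1 = h.1
  · obtain ⟨e, i⟩ := h
    obtain ⟨f, j⟩ := k
    simp only at hne
    subst hne
    have : s = t := D.inj _ (Ioo_subset_Icc_self hs) (Ioo_subset_Icc_self ht) (h1.symm.trans k1)
    subst this
    have hlh := D.lo_le (D.hi_mem hc)
    cases i <;> cases j
    · exact absurd rfl hk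
    · simp at h2 k2 hlh
      have : s = D.hi f := by linarith
      rw [h1, this]; rfl
    · simp at h2 k2 hlh
      have : s = D.lo f := by linarith
      rw [h1, this]; rfl
    · exact absurd rfl hk
  · rw [h1]
    exact D.half_tip ⟨hs, k.1, hne, t, ht, h1.symm.trans k1⟩ h2

variable [Fintype V]

lemma mem_NF {F : Finset E} {v : V} (hv : v ∈ D.NF F) : ∃ h : E × Bool, D.crossed h.1 ∧ D.hend h = v ∧ D.htip h ∈ D.KF F := by
  simp only [NF, Finset.mem_filter, Finset.mem_univ, true_and] at hv
  obtain ⟨e, he, ⟨rfl, h⟩ | ⟨rfl, h⟩⟩ := hv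
  · exact ⟨(e, true), he, rfl, h⟩
  · exact ⟨(e, false), he, rfl, h⟩

lemma KF_disj {F F' : Finset E} (hF : D.CrConn F) (hF' : D.CrConn F')
    (hsep : ∀ e ∈ F, ∀ f ∈ F', e ≠ f ∧ ¬ D.cr e f) : ∀ x ∈ D.KF F, x ∉ D.KF F' := by
  intro x hx hx'
  simp only [KF, mem_iUnion] at hx hx'
  obtain ⟨e, he, hx⟩ := hx
  obtain ⟨f, hf, hx'⟩ := hx'
  exact D.mid_disj (hF.crossed e he) (hF'.crossed f hf) (hsep e he f hf).1 (hsep e he f hf).2 x hx hx'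

theorem pieces (P : Finset (Finset E)) (hconn : ∀ F ∈ P, D.CrConn F)
    (hsep : ∀ F ∈ P, ∀ F' ∈ P, F ≠ F' → ∀ e ∈ F, ∀ f ∈ F', e ≠ f ∧ ¬ D.cr e f) :
    ∑ F ∈ P, (D.NF F).card ≤ 2 * (Fintype.card V + P.card) := by
  let E' : Type := (F : P) × D.NF F.1
  have hcard : Fintype.card E' = ∑ F ∈ P, (D.NF F).card := by
    simp only [E', Fintype.card_sigma, Fintype.card_coe]
    exact Finset.sum_coe_sort P (fun F => (D.NF F).card)
  have hdis : ∀ F F' : P, ∀ x ∈ D.KF F.1, x ∈ D.KF F'.1 → F = F' := by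
    intro F F' x hx hx'
    by_contra hne
    exact D.KF_disj (hconn _ F.2) (hconn _ F'.2) (hsep _ F.2 _ F'.2 (fun h => hne (Subtype.ext h))) x hx hx'
  choose hf hf1 hf2 hf3 using fun e : E' => D.mem_NF e.2.2
  have hin : ∀ (F : P) x, x ∈ D.KF F.1 → ∀ v, x ≠ D.vert v := by
    intro F x hx v
    simp only [KF, mem_iUnion] at hx
    obtain ⟨e, he, t, ht, rfl⟩ := hx
    exact D.inner _ _ (D.lohi_sub ((hconn _ F.2).crossed e he) ht) v
  have := topo_lemma (ι := V ⊕ P) (E := E') (fun e => Sum.inl e.2.1) (fun e => Sum.inr e.1)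
    (by intro e f; simp) (by
      rintro ⟨F, v⟩ ⟨F', v'⟩ h h'
      simp only [Sum.inl.injEq, Sum.inr.injEq] at h h'
      subst h'
      have : v = v' := Subtype.ext h
      subst this
      rfl)
    (Sum.elim (fun v => {D.vert v}) (fun F => D.KF F.1)) (fun e => D.half (hf e))
    (by
      rintro (v | F)
      · exact isCompact_singleton
      · exact F.1.finite_toSet.isCompact_biUnion fun f hf => D.mid_compact ((hconn _ F.2).crossed f hf))
    (by
      rintro (v | F)
      · exact isConnected_singleton
      · exact (hconn _ F.2).conn)
    (fun e => D.half_compact (hf1 e)) (fun e => D.half_conn (hf1 e))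
    (by
      rintro (v | F) (w | F') x hx hy
      · simp only [Sum.elim_inl, mem_singleton_iff] at hx hy
        rw [D.vert_inj (hx.symm.trans hy)]
      · exact absurd hx (hin F' x hy v)
      · exact absurd hy (hin F x hx w)
      · rw [hdis F F' x hx hy])
    (fun e => ⟨_, D.hend_mem (hf1 e), by simp [hf2 e]⟩)
    (fun e => ⟨_, D.htip_mem (hf1 e), hf3 e⟩)
    (by
      rintro e (w | F') h1 h2 x hx hxw
      · simp only [Sum.elim_inl, mem_singleton_iff] at hxw
        rcases D.half_cases (hf1 e) hx with h | ⟨s, hs, h, -⟩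
        · rw [hxw, hf2 e] at h
          exact h1 (by rw [D.vert_inj h])
        · exact D.inner _ _ hs w (h.symm.trans hxw)
      · simp only [Sum.elim_inr] at hxw
        have hxw' := hxw
        simp only [KF, mem_iUnion] at hxw'
        obtain ⟨f, hfF, hxf⟩ := hxw'
        have := D.half_mid (hf1 e) ((hconn _ F'.2).crossed f hfF) hx hxf
        rw [this] at hxw
        exact h2 (by rw [hdis _ _ _ (hf3 e) hxw]))
    (by
      intro e f hne x hx hxf
      by_cases hh : hf e = hf f
      · exfalso
        apply hne
        have h1 := hf2 e
        have h2 := hf3 e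
        rw [hh] at h1 h2
        have h3 := hdis _ _ _ h2 (hf3 f)
        rw [hf2 f] at h1
        obtain ⟨F, v⟩ := e
        obtain ⟨F', v'⟩ := f
        simp only at h3 h1
        subst h3
        have : v' = v := Subtype.ext h1
        rw [this]
      · rcases D.half_half (hf1 e) (hf1 f) hh hx hxf with ⟨v, hv⟩ | h
        · exact ⟨Sum.inl v, hv⟩
        · exact ⟨Sum.inr e.1, by rw [h]; exact hf3 e⟩)
  rw [hcard] at this
  simpa using this

lemma NF_mono {F F' : Finset E} (h : F ⊆ F') : D.NF F ⊆ D.NF F' := by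
  intro v hv
  simp only [NF, Finset.mem_filter, Finset.mem_univ, true_and] at hv ⊢
  have : D.KF F ⊆ D.KF F' := biUnion_subset_biUnion_left h
  obtain ⟨e, he, ⟨rfl, h⟩ | ⟨rfl, h⟩⟩ := hv
  · exact ⟨e, he, Or.inl ⟨rfl, this h⟩⟩
  · exact ⟨e, he, Or.inr ⟨rfl, this h⟩⟩

lemma a_mem_NF {F : Finset E} {e : E} (he : D.crossed e) (h : e ∈ F) : D.a e ∈ D.NF F := by
  simp only [NF, Finset.mem_filter, Finset.mem_univ, true_and]
  exact ⟨e, he, Or.inl ⟨rfl, mem_biUnion h (D.mem_mid (D.lo_mem he))⟩⟩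

lemma b_mem_NF {F : Finset E} {e : E} (he : D.crossed e) (h : e ∈ F) : D.b e ∈ D.NF F := by
  simp only [NF, Finset.mem_filter, Finset.mem_univ, true_and]
  exact ⟨e, he, Or.inr ⟨rfl, mem_biUnion h (D.mem_mid (D.hi_mem he))⟩⟩

lemma a_reach {e : E} (he : D.crossed e) : ∃ f, D.cr e f ∧ ∀ F : Finset E, f ∈ F → D.a e ∈ D.NF F := by
  obtain ⟨hs, f, hfe, t, ht, h⟩ := D.lo_mem he
  refine ⟨f, ⟨hfe.symm, _, hs, t, ht, h⟩, fun F hF => ?_⟩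
  simp only [NF, Finset.mem_filter, Finset.mem_univ, true_and]
  refine ⟨e, he, Or.inl ⟨rfl, mem_biUnion hF ?_⟩⟩
  rw [h]
  exact D.mem_mid ⟨ht, e, hfe.symm, _, hs, h.symm⟩

lemma b_reach {e : E} (he : D.crossed e) : ∃ f, D.cr e f ∧ ∀ F : Finset E, f ∈ F → D.b e ∈ D.NF F := by
  obtain ⟨hs, f, hfe, t, ht, h⟩ := D.hi_mem he
  refine ⟨f, ⟨hfe.symm, _, hs, t, ht, h⟩, fun F hF => ?_⟩
  simp only [NF, Finset.mem_filter, Finset.mem_univ, true_and]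
  refine ⟨e, he, Or.inr ⟨rfl, mem_biUnion hF ?_⟩⟩
  rw [h]
  exact D.mem_mid ⟨ht, e, hfe.symm, _, hs, h.symm⟩

end Sys
end PartD

set_option linter.all false

noncomputable section PartE1
open Classical

namespace Sys
variable {V E : Type} [Fintype V] [Fintype E] (D : Sys V E)

/-- a separated family of connected blocks inside `A` with total gain at least `g` -/
def Fam (A : Set E) (g : ℕ) : Prop := ∃ P : Finset (Finset E),
  (∀ F ∈ P, D.CrConn F ∧ ∀ e ∈ F, e ∈ A) ∧
  (∀ F ∈ P, ∀ F' ∈ P, F ≠ F' → ∀ e ∈ F, ∀ f ∈ F', e ≠ f ∧ ¬ D.cr e f) ∧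
  g + 2 * P.card ≤ ∑ F ∈ P, (D.NF F).card

variable {D}

lemma CrConn.nonempty {F : Finset E} (h : D.CrConn F) : F.Nonempty := by
  cases h <;> simp

lemma Fam.zero (A : Set E) : D.Fam A 0 := ⟨∅, by simp, by simp, by simp⟩

lemma Fam.mono {A B : Set E} {g : ℕ} (h : D.Fam A g) (hAB : A ⊆ B) : D.Fam B g := by
  obtain ⟨P, h1, h2, h3⟩ := h
  exact ⟨P, fun F hF => ⟨(h1 F hF).1, fun e he => hAB ((h1 F hF).2 e he)⟩, h2, h3⟩

lemma Fam.le {A : Set E} {g g' : ℕ} (h : D.Fam A g) (hg : g' ≤ g) : D.Fam A g' := by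
  obtain ⟨P, h1, h2, h3⟩ := h
  exact ⟨P, h1, h2, by omega⟩

lemma Fam.single {A : Set E} {F : Finset E} (hF : D.CrConn F) (hFA : ∀ e ∈ F, e ∈ A) {g : ℕ}
    (hg : g + 2 ≤ (D.NF F).card) : D.Fam A g := by
  refine ⟨{F}, ?_, ?_, ?_⟩
  · intro F' h; rw [Finset.mem_singleton] at h; subst h; exact ⟨hF, hFA⟩
  · intro F1 h1 F2 h2 hne
    rw [Finset.mem_singleton] at h1 h2
    exact absurd (h1.trans h2.symm) hne
  · simpa using hg

lemma Fam.union {A B : Set E} {g g' : ℕ} (hA : D.Fam A g) (hB : D.Fam B g')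
    (hAB : ∀ a ∈ A, ∀ b ∈ B, a ≠ b ∧ ¬ D.cr a b) : D.Fam (A ∪ B) (g + g') := by
  obtain ⟨P, h1, h2, h3⟩ := hA
  obtain ⟨Q, k1, k2, k3⟩ := hB
  have hdis : Disjoint P Q := by
    rw [Finset.disjoint_left]
    intro F hF hF'
    obtain ⟨e, he⟩ := (h1 F hF).1.nonempty
    exact (hAB e ((h1 F hF).2 e he) e ((k1 F hF').2 e he)).1 rfl
  refine ⟨P ∪ Q, ?_, ?_, ?_⟩
  · intro F hF
    rcases Finset.mem_union.1 hF with hF | hF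
    · exact ⟨(h1 F hF).1, fun e he => Or.inl ((h1 F hF).2 e he)⟩
    · exact ⟨(k1 F hF).1, fun e he => Or.inr ((k1 F hF).2 e he)⟩
  · intro F hF F' hF' hne e he f hf
    rcases Finset.mem_union.1 hF with hF | hF <;> rcases Finset.mem_union.1 hF' with hF' | hF'
    · exact h2 F hF F' hF' hne e he f hf
    · exact hAB e ((h1 F hF).2 e he) f ((k1 F' hF').2 f hf)
    · have := hAB f ((h1 F' hF').2 f hf) e ((k1 F hF).2 e he)
      exact ⟨this.1.symm, fun h => this.2 (D.cr_symm h)⟩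
    · exact k2 F hF F' hF' hne e he f hf
  · rw [Finset.sum_union hdis, Finset.card_union_of_disjoint hdis]
    omega

variable (D) in
def Good (c d : ℕ) (A : Finset E) : Prop := ∃ (R : Finset E) (g : ℕ), D.Fam A g ∧ c * R.card ≤ d * g ∧
  ∀ x ∈ A, ∀ y ∈ A, D.cr x y → x ∈ R ∨ y ∈ R

lemma good_step {c d : ℕ} (A X Y R0 : Finset E) (hX : X ⊆ A) (hY : Y ⊆ X) (g0 : ℕ)
    (hF : D.Fam Y g0) (h4 : c * R0.card ≤ d * g0)
    (hcov : ∀ x ∈ X, ∀ y ∈ A, D.cr x y → x ∈ R0 ∨ y ∈ R0)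
    (hsep : ∀ y ∈ Y, ∀ z ∈ A, z ∉ X → ¬ D.cr y z) (hG : D.Good c d (A \ X)) : D.Good c d A := by
  obtain ⟨R, g, h1, h2, h3⟩ := hG
  refine ⟨R0 ∪ R, g0 + g, ?_, ?_, ?_⟩
  · refine (hF.union h1 ?_).mono ?_
    · intro a ha b hb
      simp only [Finset.coe_sdiff, mem_diff, Finset.mem_coe] at ha hb
      refine ⟨?_, hsep a ha b hb.1 hb.2⟩
      rintro rfl; exact hb.2 (hY ha)
    · rintro x (hx | hx)
      · exact hX (hY hx)
      · simp only [Finset.coe_sdiff, mem_diff, Finset.mem_coe] at hx; exact hx.1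
  · calc c * (R0 ∪ R).card ≤ c * (R0.card + R.card) := Nat.mul_le_mul_left _ (Finset.card_union_le _ _)
      _ ≤ d * (g0 + g) := by rw [mul_add, mul_add]; omega
  · intro x hx y hy hxy
    simp only [Finset.mem_union]
    by_cases hxX : x ∈ X
    · rcases hcov x hxX y hy hxy with h | h <;> simp [h]
    · by_cases hyX : y ∈ X
      · rcases hcov y hyX x hx (D.cr_symm hxy) with h | h <;> simp [h]
      · rcases h3 x (by simp [hx, hxX]) y (by simp [hy, hyX]) hxy with h | h <;> simp [h]

lemma good_none {c d : ℕ} (A : Finset E) (h : ∀ x ∈ A, ∀ y ∈ A, ¬ D.cr x y) : D.Good c d A :=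
  ⟨∅, 0, Fam.zero _, by simp, fun x hx y hy hxy => absurd hxy (h x hx y hy)⟩

lemma conn_pair {x y : E} (h : D.cr x y) : D.CrConn {x, y} := CrConn.pair h

lemma conn_triple {x y z : E} (h : D.cr x y) (h' : D.cr y z) : D.CrConn {x, y, z} :=
  CrConn.ins (CrConn.pair h') (by simp) h

lemma NF_pair {x y : E} (h : D.cr x y) {F : Finset E} (hx : x ∈ F) (hy : y ∈ F) : 4 ≤ (D.NF F).card := by
  have hxc : D.crossed x := ⟨y, h⟩
  have hyc : D.crossed y := ⟨x, D.cr_symm h⟩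
  have : ({D.a x, D.b x, D.a y, D.b y} : Finset V) ⊆ D.NF F := by
    intro v hv
    simp only [Finset.mem_insert, Finset.mem_singleton] at hv
    rcases hv with rfl | rfl | rfl | rfl
    exacts [D.a_mem_NF hxc hx, D.b_mem_NF hxc hx, D.a_mem_NF hyc hy, D.b_mem_NF hyc hy]
  refine le_trans (le_of_eq ?_) (Finset.card_le_card this)
  have h1 := D.cr_ne_a h
  have h2 := D.cr_ne_b h
  have h3 := D.hab
  rw [Finset.card_insert_of_notMem, Finset.card_insert_of_notMem, Finset.card_insert_of_notMem, Finset.card_singleton]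
  · simp [h3]
  · simp [h2, (h3 _ _).symm]
  · simp [h1, h3]

lemma NF_five {x y : E} (h : D.cr x y) {F : Finset E} (hx : x ∈ F) (hy : y ∈ F) (v : V)
    (hv : v ∈ D.NF F) (h1 : v ≠ D.a x) (h2 : v ≠ D.b x) (h3 : v ≠ D.a y) (h4 : v ≠ D.b y) :
    5 ≤ (D.NF F).card := by
  have hxc : D.crossed x := ⟨y, h⟩
  have hyc : D.crossed y := ⟨x, D.cr_symm h⟩
  have : ({v, D.a x, D.b x, D.a y, D.b y} : Finset V) ⊆ D.NF F := by
    intro w hw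
    simp only [Finset.mem_insert, Finset.mem_singleton] at hw
    rcases hw with rfl | rfl | rfl | rfl | rfl
    exacts [hv, D.a_mem_NF hxc hx, D.b_mem_NF hxc hx, D.a_mem_NF hyc hy, D.b_mem_NF hyc hy]
  refine le_trans (le_of_eq ?_) (Finset.card_le_card this)
  have k1 := D.cr_ne_a h
  have k2 := D.cr_ne_b h
  have k3 := D.hab
  rw [Finset.card_insert_of_notMem, Finset.card_insert_of_notMem, Finset.card_insert_of_notMem, Finset.card_insert_of_notMem, Finset.card_singleton]
  · simp [k3]
  · simp [k2, (k3 _ _).symm]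
  · simp [k1, k3]
  · simp [h1, h2, h3, h4]

lemma NF_triple {x y z : E} (h : D.cr x y) (h' : D.cr y z) (hxz : x ≠ z) {F : Finset E}
    (hx : x ∈ F) (hy : y ∈ F) (hz : z ∈ F) : 5 ≤ (D.NF F).card := by
  have hzc : D.crossed z := ⟨y, D.cr_symm h'⟩
  by_cases ha : D.a x = D.a z
  · have hb : D.b x ≠ D.b z := fun hb => hxz (D.hinj _ _ ha hb)
    exact NF_five h hx hy (D.b z) (D.b_mem_NF hzc hz) (D.hab _ _).symm hb.symm (D.hab _ _).symm (D.cr_ne_b h').symm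
  · exact NF_five h hx hy (D.a z) (D.a_mem_NF hzc hz) (Ne.symm ha) (D.hab _ _) (D.cr_ne_a h').symm (D.hab _ _)

lemma fam_pair {x y : E} (h : D.cr x y) {A : Set E} (hx : x ∈ A) (hy : y ∈ A) : D.Fam A 2 :=
  Fam.single (conn_pair h) (by
    intro e he; simp only [Finset.mem_insert, Finset.mem_singleton] at he
    rcases he with rfl | rfl <;> assumption) (NF_pair h (by simp) (by simp))

lemma fam_triple {x y z : E} (h : D.cr x y) (h' : D.cr y z) (hxz : x ≠ z) {A : Set E}
    (hx : x ∈ A) (hy : y ∈ A) (hz : z ∈ A) : D.Fam A 3 :=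
  Fam.single (conn_triple h h') (by
    intro e he; simp only [Finset.mem_insert, Finset.mem_singleton] at he
    rcases he with rfl | rfl | rfl <;> assumption) (NF_triple h h' hxz (by simp) (by simp) (by simp))

/-- isolated crossing pair step -/
lemma good_pair {c d : ℕ} (hcd : c ≤ d * 2) (A : Finset E) (x y : E) (hx : x ∈ A) (hy : y ∈ A) (h : D.cr x y)
    (h1 : ∀ z ∈ A, D.cr x z → z = y) (h2 : ∀ z ∈ A, D.cr y z → z = x)
    (hG : D.Good c d (A \ {x, y})) : D.Good c d A := by
  refine good_step A {x, y} {x, y} {y} ?_ (Finset.Subset.refl _) 2 (fam_pair h (by simp) (by simp)) (by simpa using hcd) ?_ ?_ hG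
  · intro z hz; simp only [Finset.mem_insert, Finset.mem_singleton] at hz
    rcases hz with rfl | rfl <;> assumption
  · intro u hu v hv huv
    simp only [Finset.mem_insert, Finset.mem_singleton] at hu ⊢
    rcases hu with rfl | rfl
    · exact Or.inr (h1 v hv huv)
    · exact Or.inl rfl
  · intro u hu v hv hvX huv
    simp only [Finset.mem_insert, Finset.mem_singleton] at hu hvX
    rcases hu with rfl | rfl
    · exact hvX (Or.inr (h1 v hv huv))
    · exact hvX (Or.inl (h2 v hv huv))

lemma good_deg1 (hdeg : ∀ e x y, D.cr e x → D.cr e y → x = y) (N : ℕ) :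
    ∀ A : Finset E, A.card ≤ N → D.Good 2 1 A := by
  induction N with
  | zero =>
    intro A hA
    have : A = ∅ := by simpa using hA
    subst this
    exact good_none _ (by simp)
  | succ N ih =>
    intro A hA
    by_cases h : ∃ x ∈ A, ∃ y ∈ A, D.cr x y
    · obtain ⟨x, hx, y, hy, hxy⟩ := h
      refine good_pair (by norm_num) A x y hx hy hxy (fun z hz hxz => hdeg _ _ _ hxz hxy)
        (fun z hz hyz => hdeg _ _ _ hyz (D.cr_symm hxy)) (ih _ ?_)
      have : (A \ {x, y}).card < A.card :=
        Finset.card_lt_card ⟨Finset.sdiff_subset, fun h => by have := h hx; simp at this⟩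
      omega
    · push Not at h
      exact good_none A h

/-- peeling from a path end -/
lemma good_end (A : Finset E) (hdeg : ∀ e x y z, D.cr e x → D.cr e y → D.cr e z → x = y ∨ x = z ∨ y = z)
    (ih : ∀ B : Finset E, B.card < A.card → D.Good 4 3 B)
    (x y : E) (hx : x ∈ A) (hy : y ∈ A) (h : D.cr x y) (h1 : ∀ z ∈ A, D.cr x z → z = y) : D.Good 4 3 A := by
  have hlt : ∀ X : Finset E, x ∈ X → (A \ X).card < A.card := fun X hX =>
    Finset.card_lt_card ⟨Finset.sdiff_subset, fun h => by have := h hx; simp [hX] at this⟩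
  by_cases h2 : ∀ z ∈ A, D.cr y z → z = x
  · exact good_pair (by norm_num) A x y hx hy h h1 h2 (ih _ (hlt _ (by simp)))
  push Not at h2
  obtain ⟨z, hz, hyz, hzx⟩ := h2
  have hy' : ∀ w, D.cr y w → w = x ∨ w = z := by
    intro w hw
    rcases hdeg y w x z hw (D.cr_symm h) hyz with h | h | h
    exacts [Or.inl h, Or.inr h, absurd h.symm hzx]
  by_cases h3 : ∀ w ∈ A, D.cr z w → w = y
  · refine good_step A {x, y, z} {x, y, z} {y} ?_ (Finset.Subset.refl _) 3
      (fam_triple h hyz hzx.symm (by simp) (by simp) (by simp)) (by simp) ?_ ?_ (ih _ (hlt _ (by simp)))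
    · intro w hw; simp only [Finset.mem_insert, Finset.mem_singleton] at hw
      rcases hw with rfl | rfl | rfl <;> assumption
    · intro u hu v hv huv
      simp only [Finset.mem_insert, Finset.mem_singleton] at hu ⊢
      rcases hu with rfl | rfl | rfl
      · exact Or.inr (h1 v hv huv)
      · exact Or.inl rfl
      · exact Or.inr (h3 v hv huv)
    · intro u hu v hv hvX huv
      simp only [Finset.mem_insert, Finset.mem_singleton] at hu hvX
      rcases hu with rfl | rfl | rfl
      · exact hvX (Or.inr (Or.inl (h1 v hv huv)))
      · rcases hy' v huv with h | h <;> simp [h] at hvX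
      · exact hvX (Or.inr (Or.inl (h3 v hv huv)))
  push Not at h3
  obtain ⟨t, ht, hzt, hty⟩ := h3
  have hz' : ∀ w, D.cr z w → w = y ∨ w = t := by
    intro w hw
    rcases hdeg z w y t hw (D.cr_symm hyz) hzt with h | h | h
    exacts [Or.inl h, Or.inr h, absurd h.symm hty]
  refine good_step A {x, y, z, t} {x, y, z} {y, t} ?_ ?_ 3
      (fam_triple h hyz hzx.symm (by simp) (by simp) (by simp)) ?_ ?_ ?_ (ih _ (hlt _ (by simp)))
  · intro w hw; simp only [Finset.mem_insert, Finset.mem_singleton] at hw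
    rcases hw with rfl | rfl | rfl | rfl <;> assumption
  · intro w hw; simp only [Finset.mem_insert, Finset.mem_singleton] at hw ⊢
    tauto
  · have : ({y, t} : Finset E).card ≤ 2 := Finset.card_le_two
    omega
  · intro u hu v hv huv
    simp only [Finset.mem_insert, Finset.mem_singleton] at hu ⊢
    rcases hu with rfl | rfl | rfl | rfl
    · exact Or.inr (Or.inl (h1 v hv huv))
    · exact Or.inl (Or.inl rfl)
    · exact Or.inr (hz' v huv)
    · exact Or.inl (Or.inr rfl)
  · intro u hu v hv hvX huv
    simp only [Finset.mem_insert, Finset.mem_singleton] at hu hvX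
    rcases hu with rfl | rfl | rfl
    · exact hvX (Or.inr (Or.inl (h1 v hv huv)))
    · rcases hy' v huv with h | h <;> simp [h] at hvX
    · rcases hz' v huv with h | h <;> simp [h] at hvX

/-- consequence of a good cover of everything -/
lemma good_bound {c d : ℕ} (h : D.Good c d Finset.univ) :
    c * Fintype.card E ≤ (2 * c + 2 * d) * Fintype.card V := by
  obtain ⟨R, g, ⟨P, h1, h2, h3⟩, h4, h5⟩ := h
  have h6 := D.pieces P (fun F hF => (h1 F hF).1) h2
  have h7 : g ≤ 2 * Fintype.card V := by omega
  have h8 := (D.restrict (V' := V) (E' := {e // e ∉ R}) id Function.injective_id (fun e => e.1)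
    Subtype.val_injective (fun e => D.a e.1) (fun e => D.b e.1) (fun _ => rfl) (fun _ => rfl)).planar (by
      intro e f
      rw [restrict_cr]
      intro hcr
      rcases h5 _ (Finset.mem_univ _) _ (Finset.mem_univ _) hcr with h | h
      exacts [e.2 h, f.2 h])
  have h9 : Fintype.card {e // e ∉ R} = Fintype.card E - R.card := by
    rw [Fintype.card_subtype_compl]; simp
  have h10 : Fintype.card E ≤ 2 * Fintype.card V + R.card := by omega
  calc c * Fintype.card E ≤ c * (2 * Fintype.card V + R.card) := Nat.mul_le_mul_left _ h10
    _ ≤ c * (2 * Fintype.card V) + d * g := by rw [mul_add]; omega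
    _ ≤ c * (2 * Fintype.card V) + d * (2 * Fintype.card V) := by gcongr
    _ = _ := by ring

theorem deg1_bound (hdeg : ∀ e x y, D.cr e x → D.cr e y → x = y) :
    Fintype.card E ≤ 3 * Fintype.card V := by
  have := good_bound (good_deg1 hdeg _ Finset.univ le_rfl)
  omega

end Sys
end PartE1

set_option linter.all false

noncomputable section PartE2
open Classical

namespace Sys
variable {V E : Type} [Fintype V] [Fintype E] (D : Sys V E)

/-- a crossing cycle, closed under crossings -/
structure Cyc (j : ℕ) (e : ℕ → E) : Prop where
  hj : 3 ≤ j
  per : ∀ i, e (i + j) = e i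
  inj : ∀ i k, i < k → k < i + j → e i ≠ e k
  adj : ∀ i, D.cr (e i) (e (i + 1))
  nb : ∀ i x, D.cr (e i) x → x = e (i + 1) ∨ x = e (i + j - 1)

variable {D} {j : ℕ} {e : ℕ → E}

lemma Cyc.sep (h : D.Cyc j e) {i k : ℕ} (h1 : i + 1 < k) (h2 : k + 1 < i + j) :
    e i ≠ e k ∧ ¬ D.cr (e i) (e k) := by
  refine ⟨h.inj i k (by omega) (by omega), fun hc => ?_⟩
  rcases h.nb i _ hc with h' | h'
  · exact h.inj (i+1) k (by omega) (by omega) h'.symm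
  · exact h.inj k (i + j - 1) (by omega) (by omega) h'

lemma Cyc.seg (h : D.Cyc j e) (L : ℕ) : 2 ≤ L → L + 1 ≤ j → ∀ m,
    D.Fam (e '' Ico m (m + L)) (3 * (L + 1) / 4) := by
  induction L using Nat.strong_induction_on with
  | _ L ih =>
    intro h2 hL m
    have hj := h.hj
    have key : ∀ p q g, m ≤ p → p + 1 < q → q < m + L → D.Fam (e '' Ico m (p + 1)) 0 → 
        ∀ g1 g2, D.Fam (e '' Ico m (p+1)) g1 → D.Fam (e '' Ico q (m + L)) g2 → g ≤ g1 + g2 →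
        D.Fam (e '' Ico m (m + L)) g := by
      intro p q g hp hpq hq _ g1 g2 f1 f2 hg
      refine ((f1.union f2 ?_).mono ?_).le hg
      · rintro _ ⟨i, hi, rfl⟩ _ ⟨k, hk, rfl⟩
        simp only [mem_Ico] at hi hk
        exact h.sep (by omega) (by omega)
      · rintro _ (⟨i, hi, rfl⟩ | ⟨i, hi, rfl⟩)
        · simp only [mem_Ico] at hi
          exact ⟨i, by simp only [mem_Ico]; omega, rfl⟩
        · simp only [mem_Ico] at hi
          exact ⟨i, by simp only [mem_Ico]; omega, rfl⟩
    by_cases hL2 : L = 2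
    · subst hL2
      exact (fam_pair (A := e '' Ico m (m + 2)) (h.adj m) ⟨m, by simp, rfl⟩ ⟨m+1, by simp, rfl⟩).le (by norm_num)
    have htri : ∀ n, m + 2 < n → D.Fam (e '' Ico m n) 3 := fun n hn =>
      fam_triple (h.adj m) (h.adj (m+1)) (h.inj m (m+1+1) (by omega) (by omega))
        ⟨m, by simp only [mem_Ico]; omega, rfl⟩ ⟨m+1, by simp only [mem_Ico]; omega, rfl⟩ ⟨m+1+1, by simp only [mem_Ico]; omega, rfl⟩
    by_cases hL4 : L ≤ 4
    · exact (htri (m + L) (by omega)).le (by omega)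
    by_cases hL5 : L = 5
    · subst hL5
      refine key (m+1) (m+3) _ (by omega) (by omega) (by omega) (Fam.zero _) 2 2 ?_ ?_ (by norm_num)
      · exact fam_pair (h.adj m) ⟨m, by simp only [mem_Ico]; omega, rfl⟩ ⟨m+1, by simp only [mem_Ico]; omega, rfl⟩
      · exact fam_pair (h.adj (m+3)) ⟨m+3, by simp only [mem_Ico]; omega, rfl⟩ ⟨m+3+1, by simp only [mem_Ico]; omega, rfl⟩
    have h6 := ih (L - 4) (by omega) (by omega) (by omega) (m + 4)
    rw [show m + 4 + (L - 4) = m + L by omega] at h6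
    exact key (m+2) (m+4) _ (by omega) (by omega) (by omega) (Fam.zero _) 3 _ (htri _ (by omega)) h6 (by omega)

lemma NF_six {x y : E} (h : D.cr x y) {F : Finset E} (hx : x ∈ F) (hy : y ∈ F) {z w : E}
    (hz : z ∈ F) (hw : w ∈ F) (hzc : D.crossed z) (hwc : D.crossed w)
    (h1 : D.a z ≠ D.a x) (h2 : D.a z ≠ D.a y) (h3 : D.b w ≠ D.b x) (h4 : D.b w ≠ D.b y) :
    6 ≤ (D.NF F).card := by
  have hxc : D.crossed x := ⟨y, h⟩
  have hyc : D.crossed y := ⟨x, D.cr_symm h⟩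
  have : ({D.a z, D.b w, D.a x, D.b x, D.a y, D.b y} : Finset V) ⊆ D.NF F := by
    intro u hu
    simp only [Finset.mem_insert, Finset.mem_singleton] at hu
    rcases hu with rfl | rfl | rfl | rfl | rfl | rfl
    exacts [D.a_mem_NF hzc hz, D.b_mem_NF hwc hw, D.a_mem_NF hxc hx, D.b_mem_NF hxc hx, D.a_mem_NF hyc hy, D.b_mem_NF hyc hy]
  refine le_trans (le_of_eq ?_) (Finset.card_le_card this)
  have k1 := D.cr_ne_a h
  have k2 := D.cr_ne_b h
  have k3 := D.hab
  rw [Finset.card_insert_of_notMem, Finset.card_insert_of_notMem, Finset.card_insert_of_notMem, Finset.card_insert_of_notMem, Finset.card_insert_of_notMem, Finset.card_singleton]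
  · simp [k3]
  · simp [k2, (k3 _ _).symm]
  · simp [k1, k3]
  · simp [h3, h4, (k3 _ _).symm]
  · simp [h1, h2, k3]

lemma Cyc.crossed (h : D.Cyc j e) (i : ℕ) : D.crossed (e i) := ⟨_, h.adj i⟩

lemma Cyc.five (h : D.Cyc 5 e) : D.Fam (e '' Ico 0 5) 4 := by
  have h5 : e 5 = e 0 := h.per 0
  have ha : ∀ i, D.a (e i) ≠ D.a (e (i+1)) := fun i => D.cr_ne_a (h.adj i)
  have hb : ∀ i, D.b (e i) ≠ D.b (e (i+1)) := fun i => D.cr_ne_b (h.adj i)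
  let F : Finset E := {e 0, e 1, e 2, e 3, e 4}
  have hc : D.CrConn F :=
    CrConn.ins (CrConn.ins (CrConn.ins (CrConn.pair (h.adj 3)) (by simp) (h.adj 2)) (by simp) (h.adj 1)) (by simp) (h.adj 0)
  have key : ∀ f : ℕ → V, f 5 = f 0 → (∀ i, f i ≠ f (i+1)) → ∃ k, (k = 2 ∨ k = 3 ∨ k = 4) ∧ f k ≠ f 0 ∧ f k ≠ f 1 := by
    intro f h5 hf
    by_contra hcon
    push Not at hcon
    have c2 := hcon 2 (by simp)
    have c3 := hcon 3 (by simp)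
    have c4 := hcon 4 (by simp)
    have d0 := hf 0
    have d1 := hf 1
    have d2 := hf 2
    have d3 := hf 3
    have d4 := hf 4
    norm_num at d0 d1 d2 d3 d4
    grind
  obtain ⟨k, hk, k1, k2⟩ := key (fun i => D.a (e i)) (by simp only [h5]) ha
  obtain ⟨l, hl, l1, l2⟩ := key (fun i => D.b (e i)) (by simp only [h5]) hb
  refine Fam.single hc ?_ (NF_six (h.adj 0) (z := e k) (w := e l) (by simp [F]) (by simp [F]) ?_ ?_ (h.crossed _) (h.crossed _) k1 k2 l1 l2)
  · intro x hx
    simp only [F, Finset.mem_insert, Finset.mem_singleton] at hx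
    rcases hx with rfl | rfl | rfl | rfl | rfl
    exacts [⟨0, by simp, rfl⟩, ⟨1, by simp, rfl⟩, ⟨2, by simp, rfl⟩, ⟨3, by simp, rfl⟩, ⟨4, by simp, rfl⟩]
  · rcases hk with rfl | rfl | rfl <;> simp [F]
  · rcases hl with rfl | rfl | rfl <;> simp [F]

lemma Cyc.odd_pair (h : D.Cyc j e) (hodd : j % 2 = 1) : ∃ s, 5 ≤ (D.NF {e s, e (s+1)}).card := by
  by_contra hcon
  push Not at hcon
  have hj := h.hj
  have hA : ∀ i, D.a (e (i+2)) = D.a (e (i+4)) ∨ D.a (e (i+2)) = D.a (e i) := by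
    intro i
    obtain ⟨f, hf, hf'⟩ := D.a_reach (h.crossed (i+2))
    by_contra hc
    push Not at hc
    rcases h.nb _ _ hf with h' | h'
    · have := NF_five (h.adj (i+3)) (F := {e (i+3), e (i+3+1)}) (by simp) (by simp) (D.a (e (i+2)))
        (hf' _ (by simp [h'])) (D.cr_ne_a (h.adj (i+2))) (D.hab _ _) hc.1 (D.hab _ _)
      exact absurd (hcon (i+3)) (by omega)
    · rw [show i + 2 + j - 1 = i + 1 + j by omega, h.per] at h'
      have := NF_five (h.adj i) (F := {e i, e (i+1)}) (by simp) (by simp) (D.a (e (i+2)))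
        (hf' _ (by simp [h'])) hc.2 (D.hab _ _) (D.cr_ne_a (h.adj (i+1))).symm (D.hab _ _)
      exact absurd (hcon i) (by omega)
  have hB : ∀ i, D.b (e (i+2)) = D.b (e (i+4)) ∨ D.b (e (i+2)) = D.b (e i) := by
    intro i
    obtain ⟨f, hf, hf'⟩ := D.b_reach (h.crossed (i+2))
    by_contra hc
    push Not at hc
    rcases h.nb _ _ hf with h' | h'
    · have := NF_five (h.adj (i+3)) (F := {e (i+3), e (i+3+1)}) (by simp) (by simp) (D.b (e (i+2)))
        (hf' _ (by simp [h'])) (D.hab _ _).symm (D.cr_ne_b (h.adj (i+2))) (D.hab _ _).symm hc.1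
      exact absurd (hcon (i+3)) (by omega)
    · rw [show i + 2 + j - 1 = i + 1 + j by omega, h.per] at h'
      have := NF_five (h.adj i) (F := {e i, e (i+1)}) (by simp) (by simp) (D.b (e (i+2)))
        (hf' _ (by simp [h'])) (D.hab _ _).symm hc.2 (D.hab _ _).symm (D.cr_ne_b (h.adj (i+1))).symm
      exact absurd (hcon i) (by omega)
  have hN : ∀ i, ¬ (D.a (e i) = D.a (e (i+2)) ∧ D.b (e i) = D.b (e (i+2))) := fun i hi =>
    h.inj i (i+2) (by omega) (by omega) (D.hinj _ _ hi.1 hi.2)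
  have hS : ∀ i, (D.a (e (i+2)) = D.a (e (i+4))) ↔ ¬ (D.a (e i) = D.a (e (i+2))) := by
    intro i
    have n1 := hN i
    have n2 := hN (i+2)
    rw [show i + 2 + 2 = i + 4 by omega] at n2
    have := hA i
    have := hB i
    grind
  have hP : ∀ t, (D.a (e (2*t)) = D.a (e (2*t+2))) ↔ ((t % 2 = 0) ↔ (D.a (e 0) = D.a (e 2))) := by
    intro t
    induction t with
    | zero => simp
    | succ t ih =>
      have := hS (2*t)
      rw [show 2 * (t+1) = 2 * t + 2 by ring, show 2 * t + 2 + 2 = 2 * t + 4 by ring, this, ih]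
      have : (t+1) % 2 = 0 ↔ ¬ (t % 2 = 0) := by omega
      rw [this]
      tauto
  have := hP j
  rw [show 2 * j = 0 + j + j by ring, h.per, h.per, show 0 + j + j + 2 = 2 + j + j by ring, h.per, h.per] at this
  have : j % 2 ≠ 0 := by omega
  tauto

lemma Cyc.fam (h : D.Cyc j e) : ∃ g m, 4 * ((j + 1) / 2) ≤ 3 * g ∧ D.Fam (e '' Ico m (m + j)) g := by
  have hj := h.hj
  by_cases h3 : j = 3
  · subst h3
    exact ⟨3, 0, by norm_num, fam_triple (h.adj 0) (h.adj 1) (h.inj 0 2 (by norm_num) (by norm_num))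
      ⟨0, by simp, rfl⟩ ⟨1, by simp, rfl⟩ ⟨2, by simp, rfl⟩⟩
  by_cases h5 : j = 5
  · subst h5
    exact ⟨4, 0, by norm_num, h.five⟩
  by_cases he : j % 2 = 0
  · refine ⟨_, 0, ?_, (h.seg (j-1) (by omega) (by omega) 0).mono ?_⟩
    · omega
    · exact image_mono (Ico_subset_Ico le_rfl (by omega))
  · obtain ⟨s, hs⟩ := h.odd_pair (by omega)
    refine ⟨3 + 3 * (j - 4 + 1) / 4, s, by omega, ((Fam.single (A := e '' Ico s (s + 2)) (g := 3) (conn_pair (h.adj s)) ?_ hs).union (h.seg (j-4) (by omega) (by omega) (s+3)) ?_).mono ?_⟩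
    · intro x hx
      simp only [Finset.mem_insert, Finset.mem_singleton] at hx
      rcases hx with rfl | rfl
      exacts [⟨s, by simp, rfl⟩, ⟨s+1, by simp, rfl⟩]
    · rintro _ ⟨i, hi, rfl⟩ _ ⟨k, hk, rfl⟩
      simp only [mem_Ico] at hi hk
      exact h.sep (by omega) (by omega)
    · rw [← image_union]
      refine image_mono ?_
      intro i hi
      simp only [mem_union, mem_Ico] at hi ⊢
      omega

lemma Cyc.per_mod (h : D.Cyc j e) (i : ℕ) : e (i % j) = e i := by
  have : ∀ q r, e (r + j * q) = e r := by
    intro q r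
    induction q with
    | zero => simp
    | succ q ih => rw [mul_add, mul_one, ← add_assoc, h.per, ih]
  conv_rhs => rw [← Nat.mod_add_div i j]
  rw [this]

lemma good_cyc (A : Finset E) (h : D.Cyc j e) (hA : ∀ i, e i ∈ A)
    (ih : ∀ B : Finset E, B.card < A.card → D.Good 4 3 B) : D.Good 4 3 A := by
  obtain ⟨g, m, hg, hF⟩ := h.fam
  have hj := h.hj
  let X : Finset E := (Finset.range j).image e
  have hXm : ∀ i, e i ∈ X := fun i => by
    rw [← h.per_mod i]
    exact Finset.mem_image_of_mem _ (Finset.mem_range.2 (Nat.mod_lt _ (by omega)))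
  let R0 : Finset E := (Finset.range ((j+1)/2)).image fun i => e (2 * i)
  have hR : ∀ i, i < j → i % 2 = 0 → e i ∈ R0 := fun i hi hi2 =>
    Finset.mem_image.2 ⟨i / 2, Finset.mem_range.2 (by omega), by rw [show 2 * (i/2) = i by omega]⟩
  refine good_step A X X R0 ?_ (Finset.Subset.refl _) g (hF.mono ?_) ?_ ?_ ?_ (ih _ ?_)
  · intro x hx
    obtain ⟨i, _, rfl⟩ := Finset.mem_image.1 hx
    exact hA i
  · rintro _ ⟨i, _, rfl⟩
    exact hXm i
  · have : R0.card ≤ (j+1)/2 := Finset.card_image_le.trans (by simp)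
    omega
  · intro x hx y hy hxy
    obtain ⟨i, hi, rfl⟩ := Finset.mem_image.1 hx
    have hi := Finset.mem_range.1 hi
    by_cases hi2 : i % 2 = 0
    · exact Or.inl (hR i hi hi2)
    · right
      rcases h.nb i y hxy with rfl | rfl
      · by_cases hij : i + 1 < j
        · exact hR _ hij (by omega)
        · rw [show i + 1 = 0 + j by omega, h.per]
          exact hR 0 (by omega) rfl
      · rw [show i + j - 1 = (i - 1) + j by omega, h.per]
        exact hR _ (by omega) (by omega)
  · intro x hx z hz hzX hxz
    obtain ⟨i, hi, rfl⟩ := Finset.mem_image.1 hx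
    rcases h.nb i z hxz with rfl | rfl <;> exact hzX (hXm _)
  · exact Finset.card_lt_card ⟨Finset.sdiff_subset, fun h => by have := h (hA 0); simp [hXm] at this⟩

/-- a nonbacktracking infinite walk yields a cycle -/
lemma exists_cyc (hdeg : ∀ e x y z, D.cr e x → D.cr e y → D.cr e z → x = y ∨ x = z ∨ y = z)
    (w : ℕ → E) (hw : ∀ i, D.cr (w i) (w (i+1))) (hw2 : ∀ i, w (i+2) ≠ w i) :
    ∃ j i0, D.Cyc j (fun t => w (i0 + t % j)) := by
  have hex : ∃ d, 0 < d ∧ ∃ i, w i = w (i + d) := by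
    obtain ⟨x, y, hxy, hw'⟩ := Finite.exists_ne_map_eq_of_infinite w
    rcases lt_or_gt_of_ne hxy with h | h
    · exact ⟨y - x, by omega, x, by rw [hw']; congr 1; omega⟩
    · exact ⟨x - y, by omega, y, by rw [← hw']; congr 1; omega⟩
  obtain ⟨hd0, i0, hi0⟩ := Nat.find_spec hex
  have hmin : ∀ d, d < Nat.find hex → 0 < d → ∀ i, w i ≠ w (i + d) := fun d hd hd0 i hi =>
    Nat.find_min hex hd ⟨hd0, i, hi⟩
  generalize Nat.find hex = d at hd0 hi0 hmin
  have hd3 : 3 ≤ d := by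
    by_contra hlt
    have : d = 1 ∨ d = 2 := by omega
    rcases this with rfl | rfl
    · exact (hw i0).1 hi0
    · exact hw2 i0 hi0.symm
  have hinj : ∀ i k, i < k → k < i + d → w (i0 + i % d) ≠ w (i0 + k % d) := by
    intro i k hik hkd
    have h1 : i % d ≠ k % d := by
      intro h
      have : d ∣ k - i := (Nat.modEq_iff_dvd' hik.le).1 h
      have := Nat.le_of_dvd (by omega) this
      omega
    have hi := Nat.mod_lt i hd0
    have hk := Nat.mod_lt k hd0
    rcases lt_or_gt_of_ne h1 with h | h
    · have := hmin (k % d - i % d) (by omega) (by omega) (i0 + i % d)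
      rwa [show i0 + i % d + (k % d - i % d) = i0 + k % d by omega] at this
    · have := hmin (i % d - k % d) (by omega) (by omega) (i0 + k % d)
      rw [show i0 + k % d + (i % d - k % d) = i0 + i % d by omega] at this
      exact this.symm
  have hadj : ∀ i, D.cr (w (i0 + i % d)) (w (i0 + (i+1) % d)) := by
    intro i
    have hi := Nat.mod_lt i hd0
    by_cases hlt : i % d + 1 < d
    · have : (i+1) % d = i % d + 1 := by
        rw [Nat.add_mod, Nat.mod_eq_of_lt (show 1 < d by omega), Nat.mod_eq_of_lt hlt]
      rw [this]; exact hw _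
    · have : (i+1) % d = 0 := by
        rw [Nat.add_mod, Nat.mod_eq_of_lt (show 1 < d by omega), show i % d + 1 = d by omega, Nat.mod_self]
      rw [this, add_zero, hi0]
      have := hw (i0 + i % d)
      rwa [show i0 + i % d + 1 = i0 + d by omega] at this
  refine ⟨d, i0, hd3, ?_, hinj, hadj, ?_⟩
  · intro i; simp
  · intro i x hx
    have h2 := hadj (i + d - 1)
    rw [show i + d - 1 + 1 = i + d by omega, Nat.add_mod_right] at h2
    rcases hdeg _ _ _ _ hx (hadj i) (D.cr_symm h2) with h | h | h
    · exact Or.inl h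
    · exact Or.inr h
    · exact absurd h (hinj (i+1) (i+d-1) (by omega) (by omega))

lemma good_deg2 (hdeg : ∀ e x y z, D.cr e x → D.cr e y → D.cr e z → x = y ∨ x = z ∨ y = z) (N : ℕ) :
    ∀ A : Finset E, A.card < N → D.Good 4 3 A := by
  induction N with
  | zero => intro A hA; omega
  | succ N ih =>
    intro A hA
    have ih' : ∀ B : Finset E, B.card < A.card → D.Good 4 3 B := fun B hB => ih B (by omega)
    by_cases h : ∀ x ∈ A, ∀ y ∈ A, ¬ D.cr x y
    · exact good_none A h
    push Not at h
    obtain ⟨x, hx, y, hy, hxy⟩ := h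
    by_cases he : ∃ x ∈ A, ∃ y ∈ A, D.cr x y ∧ ∀ z ∈ A, D.cr x z → z = y
    · obtain ⟨x, hx, y, hy, h, h1⟩ := he
      exact good_end A hdeg ih' x y hx hy h h1
    push Not at he
    let T := {p : E × E // p.1 ∈ A ∧ p.2 ∈ A ∧ D.cr p.1 p.2}
    have hnext : ∀ p : T, ∃ q : T, q.1.1 = p.1.2 ∧ q.1.2 ≠ p.1.1 := by
      rintro ⟨⟨u, v⟩, hu, hv, huv⟩
      obtain ⟨z, hz, hvz, hne⟩ := he v hv u hu (D.cr_symm huv)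
      exact ⟨⟨(v, z), hv, hz, hvz⟩, rfl, hne⟩
    choose nx n1 n2 using hnext
    let p0 : T := ⟨(x, y), hx, hy, hxy⟩
    let w : ℕ → E := fun i => (nx^[i] p0).1.1
    have w1 : ∀ i, w (i+1) = (nx^[i] p0).1.2 := fun i => by
      simp only [w, Function.iterate_succ_apply', n1]
    obtain ⟨j, i0, hc⟩ := exists_cyc hdeg w (fun i => by rw [w1]; exact (nx^[i] p0).2.2.2) (fun i => by
      rw [w1 (i+1), Function.iterate_succ_apply']; exact n2 _)
    exact good_cyc A hc (fun i => (nx^[_] p0).2.1) ih'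

theorem deg2_bound (hdeg : ∀ e x y z, D.cr e x → D.cr e y → D.cr e z → x = y ∨ x = z ∨ y = z) :
    2 * Fintype.card E ≤ 7 * Fintype.card V := by
  have := good_bound (good_deg2 hdeg _ Finset.univ (Nat.lt_succ_self _))
  omega

end Sys
end PartE2

set_option linter.all false

noncomputable section PartF
open Classical

namespace Sys
variable {V E : Type} [Fintype V] [Fintype E] (D : Sys V E)

/-- number of ordered crossing pairs in `A` -/
def cs (A : Finset E) : ℕ := ((A ×ˢ A).filter fun p => D.cr p.1 p.2).card

lemma cs_erase (A : Finset E) (e : E) (he : e ∈ A) (T : Finset E) (hT : T ⊆ A) (hc : ∀ t ∈ T, D.cr e t) :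
    D.cs (A.erase e) + 2 * T.card ≤ D.cs A := by
  have heT : e ∉ T := fun h => (hc e h).1 rfl
  have h1 : (T.image fun t => (e, t)).card = T.card := Finset.card_image_of_injective _ (fun x y h => by simpa using h)
  have h2 : (T.image fun t => (t, e)).card = T.card := Finset.card_image_of_injective _ (fun x y h => by simpa using h)
  have d1 : Disjoint (T.image fun t => (e, t)) (T.image fun t => (t, e)) := by
    rw [Finset.disjoint_left]
    intro p hp hq
    obtain ⟨t, ht, rfl⟩ := Finset.mem_image.1 hp
    obtain ⟨u, hu, huu⟩ := Finset.mem_image.1 hq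
    simp only [Prod.mk.injEq] at huu
    exact heT (huu.1 ▸ hu)
  have d2 : Disjoint (((A.erase e) ×ˢ (A.erase e)).filter fun p => D.cr p.1 p.2)
      ((T.image fun t => (e, t)) ∪ (T.image fun t => (t, e))) := by
    rw [Finset.disjoint_left]
    intro p hp hq
    simp only [Finset.mem_filter, Finset.mem_product, Finset.mem_erase] at hp
    rcases Finset.mem_union.1 hq with hq | hq <;> obtain ⟨t, ht, rfl⟩ := Finset.mem_image.1 hq
    · exact hp.1.1.1 rfl
    · exact hp.1.2.1 rfl
  have : D.cs (A.erase e) + 2 * T.card = ((((A.erase e) ×ˢ (A.erase e)).filter fun p => D.cr p.1 p.2) ∪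
      ((T.image fun t => (e, t)) ∪ (T.image fun t => (t, e)))).card := by
    rw [Finset.card_union_of_disjoint d2, Finset.card_union_of_disjoint d1, h1, h2, cs]; ring
  rw [this]
  refine Finset.card_le_card ?_
  intro p hp
  simp only [Finset.mem_union, Finset.mem_filter, Finset.mem_product, Finset.mem_erase, Finset.mem_image] at hp ⊢
  rcases hp with hp | ⟨t, ht, rfl⟩ | ⟨t, ht, rfl⟩
  · exact ⟨⟨hp.1.1.2, hp.1.2.2⟩, hp.2⟩
  · exact ⟨⟨he, hT ht⟩, hc t ht⟩
  · exact ⟨⟨hT ht, he⟩, D.cr_symm (hc t ht)⟩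

variable (S : Finset V)

def sub (A : Finset E) (hA : ∀ e ∈ A, D.a e ∈ S ∧ D.b e ∈ S) : Sys {v // v ∈ S} {e // e ∈ A} :=
  D.restrict (fun v => v.1) Subtype.val_injective (fun e => e.1) Subtype.val_injective
    (fun e => ⟨D.a e.1, (hA e.1 e.2).1⟩) (fun e => ⟨D.b e.1, (hA e.1 e.2).2⟩) (fun _ => rfl) (fun _ => rfl)

lemma sub_cr (A : Finset E) (hA : ∀ e ∈ A, D.a e ∈ S ∧ D.b e ∈ S) (e f) :
    (D.sub S A hA).cr e f ↔ D.cr e.1 f.1 := by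
  unfold sub; rw [restrict_cr]

lemma count1 (N : ℕ) : ∀ A : Finset E, A.card ≤ N → (∀ e ∈ A, D.a e ∈ S ∧ D.b e ∈ S) →
    2 * A.card ≤ 4 * S.card + D.cs A := by
  induction N with
  | zero => intro A hA; omega
  | succ N ih =>
    intro A hN hA
    by_cases h : ∀ e ∈ A, ∀ f ∈ A, ¬ D.cr e f
    · have := (D.sub S A hA).planar (fun e f => by rw [sub_cr]; exact h _ e.2 _ f.2)
      simp only [Fintype.card_coe] at this
      omega
    · push Not at h
      obtain ⟨e, he, f, hf, hc⟩ := h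
      have h1 := D.cs_erase A e he {f} (by simpa using hf) (by simpa using hc)
      have hcard := Finset.card_erase_add_one he
      have := ih (A.erase e) (by omega) (fun e he => hA e (Finset.mem_of_mem_erase he))
      simp at h1
      omega

lemma count2 (N : ℕ) : ∀ A : Finset E, A.card ≤ N → (∀ e ∈ A, D.a e ∈ S ∧ D.b e ∈ S) →
    4 * A.card ≤ 10 * S.card + D.cs A := by
  induction N with
  | zero => intro A hA; omega
  | succ N ih =>
    intro A hN hA
    by_cases h : ∀ e ∈ A, ∀ f ∈ A, ∀ g ∈ A, D.cr e f → D.cr e g → f = g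
    · have := (D.sub S A hA).deg1_bound (fun e f g => by
        rw [sub_cr, sub_cr]; exact fun h1 h2 => Subtype.ext (h _ e.2 _ f.2 _ g.2 h1 h2))
      simp only [Fintype.card_coe] at this
      have := D.count1 S _ A le_rfl hA
      omega
    · push Not at h
      obtain ⟨e, he, f, hf, g, hg, hc, hc', hne⟩ := h
      have h1 := D.cs_erase A e he {f, g} (by
          intro x hx; simp only [Finset.mem_insert, Finset.mem_singleton] at hx
          rcases hx with rfl | rfl <;> assumption) (by
          intro x hx; simp only [Finset.mem_insert, Finset.mem_singleton] at hx
          rcases hx with rfl | rfl <;> assumption)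
      rw [Finset.card_pair hne] at h1
      have hcard := Finset.card_erase_add_one he
      have := ih (A.erase e) (by omega) (fun e he => hA e (Finset.mem_of_mem_erase he))
      omega

lemma count3 (N : ℕ) : ∀ A : Finset E, A.card ≤ N → (∀ e ∈ A, D.a e ∈ S ∧ D.b e ∈ S) →
    6 * A.card ≤ 17 * S.card + D.cs A := by
  induction N with
  | zero => intro A hA; omega
  | succ N ih =>
    intro A hN hA
    by_cases h : ∀ e ∈ A, ∀ f ∈ A, ∀ g ∈ A, ∀ k ∈ A, D.cr e f → D.cr e g → D.cr e k → f = g ∨ f = k ∨ g = k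
    · have := (D.sub S A hA).deg2_bound (fun e f g k => by
        rw [sub_cr, sub_cr, sub_cr]
        simp only [Subtype.ext_iff]
        exact h _ e.2 _ f.2 _ g.2 _ k.2)
      simp only [Fintype.card_coe] at this
      have := D.count2 S _ A le_rfl hA
      omega
    · push Not at h
      obtain ⟨e, he, f, hf, g, hg, k, hk, hc, hc', hc'', hne, hne', hne''⟩ := h
      have h1 := D.cs_erase A e he {f, g, k} (by
          intro x hx; simp only [Finset.mem_insert, Finset.mem_singleton] at hx
          rcases hx with rfl | rfl | rfl <;> assumption) (by
          intro x hx; simp only [Finset.mem_insert, Finset.mem_singleton] at hx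
          rcases hx with rfl | rfl | rfl <;> assumption)
      rw [Finset.card_eq_three.2 ⟨f, g, k, hne, hne', hne'', rfl⟩] at h1
      have hcard := Finset.card_erase_add_one he
      have := ih (A.erase e) (by omega) (fun e he => hA e (Finset.mem_of_mem_erase he))
      omega

end Sys

def wt {V : Type} [Fintype V] (p : ℝ) (S : Finset V) : ℝ := (∏ v ∈ S, p) * ∏ v ∈ Finset.univ \ S, (1 - p)

lemma wt_nonneg {V : Type} [Fintype V] {p : ℝ} (h0 : 0 ≤ p) (h1 : p ≤ 1) (S : Finset V) : 0 ≤ wt p S :=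
  mul_nonneg (Finset.prod_nonneg fun _ _ => h0) (Finset.prod_nonneg fun _ _ => by linarith)

lemma wt_sum {V : Type} [Fintype V] (p : ℝ) (T : Finset V) :
    ∑ S : Finset V, wt p S * (if T ⊆ S then 1 else 0) = p ^ T.card := by
  have h := Finset.prod_add (fun _ : V => p) (fun v => if v ∈ T then 0 else 1 - p) Finset.univ
  have hl : ∏ v : V, (p + if v ∈ T then 0 else 1 - p) = p ^ T.card := by
    have : ∀ v : V, (p + if v ∈ T then 0 else 1 - p) = if v ∈ T then p else 1 := by
      intro v; split_ifs <;> ring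
    simp only [this]
    rw [Finset.prod_ite]
    simp
  rw [← hl, h, Finset.powerset_univ]
  refine Finset.sum_congr rfl fun S _ => ?_
  unfold wt
  by_cases hTS : T ⊆ S
  · rw [if_pos hTS, mul_one]
    congr 1
    refine Finset.prod_congr rfl fun v hv => ?_
    rw [if_neg (fun hvT => (Finset.mem_sdiff.1 hv).2 (hTS hvT))]
  · rw [if_neg hTS, mul_zero]
    obtain ⟨v, hv, hvS⟩ := Finset.not_subset.1 hTS
    have hz : (∏ i ∈ Finset.univ \ S, if i ∈ T then (0:ℝ) else 1 - p) = 0 :=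
      Finset.prod_eq_zero (i := v) (by simp [hvS]) (by simp [hv])
    rw [hz, mul_zero]

namespace Sys
variable {V E : Type} [Fintype V] [Fintype E] (D : Sys V E)

lemma sampling (p : ℝ) (h0 : 0 ≤ p) (h1 : p ≤ 1) :
    6 * (Fintype.card E * p ^ 2) ≤ 17 * (Fintype.card V * p) + D.cs Finset.univ * p ^ 4 := by
  let AS : Finset V → Finset E := fun S => Finset.univ.filter fun e => ({D.a e, D.b e} : Finset V) ⊆ S
  have hAS : ∀ S, ∀ e ∈ AS S, D.a e ∈ S ∧ D.b e ∈ S := by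
    intro S e he
    have := (Finset.mem_filter.1 he).2
    exact ⟨this (by simp), this (by simp)⟩
  have hE : ∑ S : Finset V, wt p S * ((AS S).card : ℝ) = Fintype.card E * p ^ 2 := by
    have : ∀ S, ((AS S).card : ℝ) = ∑ e : E, if ({D.a e, D.b e} : Finset V) ⊆ S then (1:ℝ) else 0 := by
      intro S; rw [Finset.sum_boole]
    simp only [this, Finset.mul_sum]
    rw [Finset.sum_comm]
    simp only [wt_sum]
    have : ∀ e, ({D.a e, D.b e} : Finset V).card = 2 := fun e => Finset.card_pair (D.hab e e)
    simp [this]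
  have hV : ∑ S : Finset V, wt p S * (S.card : ℝ) = Fintype.card V * p := by
    have : ∀ S : Finset V, (S.card : ℝ) = ∑ v : V, if ({v} : Finset V) ⊆ S then (1:ℝ) else 0 := by
      intro S; rw [Finset.sum_boole]; simp
    simp only [this, Finset.mul_sum]
    rw [Finset.sum_comm]
    simp only [wt_sum]
    simp
  have hC : ∑ S : Finset V, wt p S * (D.cs (AS S) : ℝ) = D.cs Finset.univ * p ^ 4 := by
    have : ∀ S : Finset V, (D.cs (AS S) : ℝ) = ∑ q ∈ ((Finset.univ : Finset E) ×ˢ (Finset.univ : Finset E)).filter (fun q => D.cr q.1 q.2),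
        if ({D.a q.1, D.b q.1, D.a q.2, D.b q.2} : Finset V) ⊆ S then (1:ℝ) else 0 := by
      intro S; rw [Finset.sum_boole, cs]
      congr 2
      ext q
      simp only [AS, Finset.mem_filter, Finset.mem_product, Finset.mem_univ, true_and, Finset.insert_subset_iff, Finset.singleton_subset_iff]
      tauto
    simp only [this, Finset.mul_sum]
    rw [Finset.sum_comm]
    simp only [wt_sum]
    rw [Finset.sum_congr rfl (g := fun _ => p ^ 4)]
    · simp [cs]
    · intro q hq
      have hq := (Finset.mem_filter.1 hq).2
      have k1 := D.cr_ne_a hq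
      have k2 := D.cr_ne_b hq
      have k3 := D.hab
      congr 1
      rw [Finset.card_insert_of_notMem, Finset.card_insert_of_notMem, Finset.card_insert_of_notMem, Finset.card_singleton]
      · simp [k3]
      · simp [k2, (k3 _ _).symm]
      · simp [k1, k3]
  rw [← hE, ← hV, ← hC, Finset.mul_sum, Finset.mul_sum, ← Finset.sum_add_distrib]
  refine Finset.sum_le_sum fun S _ => ?_
  have h := D.count3 S _ (AS S) le_rfl (hAS S)
  have h' : (6:ℝ) * (AS S).card ≤ 17 * S.card + D.cs (AS S) := by exact_mod_cast h
  nlinarith [mul_le_mul_of_nonneg_left h' (wt_nonneg h0 h1 S)]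

theorem sys_bound (k : ℕ) (hk : 1 ≤ k) (h : ∀ e, (Finset.univ.filter fun f => D.cr e f).card ≤ k) :
    (Fintype.card E : ℝ) ≤ 17 / 8 * Real.sqrt (2 * k) * Fintype.card V := by
  have hcs : D.cs Finset.univ ≤ Fintype.card E * k := by
    have : D.cs Finset.univ = ∑ e : E, (Finset.univ.filter fun f => D.cr e f).card := by
      rw [cs, Finset.card_filter, Finset.sum_product]
      simp only [Finset.card_filter]
    rw [this]
    refine (Finset.sum_le_sum fun e _ => h e).trans ?_
    simp
  have hcs' : (D.cs Finset.univ : ℝ) ≤ Fintype.card E * k := by exact_mod_cast hcs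
  have hsam := D.sampling
  have hn0 : (0:ℝ) ≤ Fintype.card V := by positivity
  have hkk : (1:ℝ) ≤ k := by exact_mod_cast hk
  by_cases hbig : (17:ℝ) / 4 * Fintype.card V < Fintype.card E
  · have hm : (0:ℝ) < Fintype.card E := by linarith
    generalize (Fintype.card E : ℝ) = m at *
    generalize (Fintype.card V : ℝ) = n at *
    rcases hn0.eq_or_lt with hn | hn
    · subst hn
      exfalso
      have hp := hsam (1 / Real.sqrt k) (by positivity) (by
        rw [div_le_one (by positivity)]; exact Real.one_le_sqrt.2 hkk)
      have hs : (1 / Real.sqrt k) ^ 2 = 1 / k := by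
        rw [div_pow, one_pow, Real.sq_sqrt (by linarith)]
      rw [show (1 / Real.sqrt k) ^ 4 = ((1 / Real.sqrt k) ^ 2) ^ 2 by ring, hs] at hp
      have : (D.cs Finset.univ : ℝ) * (1 / (k:ℝ)) ^ 2 ≤ m * k * (1 / (k:ℝ)) ^ 2 := by gcongr
      have h2 : m * k * (1 / (k:ℝ)) ^ 2 = m * (1 / k) := by field_simp
      have : 0 < m * (1 / (k:ℝ)) := by positivity
      linarith
    · have hp0 : 0 < 17 * n / (4 * m) := by positivity
      have hp := hsam (17 * n / (4 * m)) hp0.le (by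
        rw [div_le_one (by positivity)]; linarith)
      have h2 : (D.cs Finset.univ : ℝ) * (17 * n / (4 * m)) ^ 4 ≤ m * k * (17 * n / (4 * m)) ^ 4 := by gcongr
      have h3 : 32 * m ^ 2 ≤ 289 * k * n ^ 2 := by
        have h4 := hp.trans (add_le_add_right h2 _)
        have e1 : 6 * (m * (17 * n / (4 * m)) ^ 2) = 6 * (17 * n) ^ 2 / (16 * m) := by field_simp; ring
        have e2 : 17 * (n * (17 * n / (4 * m))) + m * k * (17 * n / (4 * m)) ^ 4
          = (17 * n) ^ 2 * (64 * m ^ 2 + k * (17 * n) ^ 2) / (256 * m ^ 3) := by field_simp; ring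
        rw [e1, e2, div_le_div_iff₀ (by positivity) (by positivity)] at h4
        have h5 : 0 < (17 * n) ^ 2 * (16 * m) := by positivity
        have h6 : (17 * n) ^ 2 * (16 * m) * (6 * 16 * m ^ 2) ≤ (17 * n) ^ 2 * (16 * m) * (64 * m ^ 2 + k * (17 * n) ^ 2) := by
          nlinarith [h4]
        have := le_of_mul_le_mul_left h6 h5
        nlinarith [this]
      have hs : (17 / 8 * Real.sqrt (2 * k) * n) ^ 2 = 289 / 32 * k * n ^ 2 := by
        rw [mul_pow, mul_pow, Real.sq_sqrt (by positivity)]; ring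
      refine abs_le_of_sq_le_sq' ?_ (by positivity) |>.2
      rw [hs]; linarith
  · push Not at hbig
    rcases hk.eq_or_lt with rfl | hk2
    · have hd := D.deg1_bound (fun e x y hx hy => by
        have := h e
        rw [Finset.card_le_one] at this
        exact this x (by simp [hx]) y (by simp [hy]))
      have hd' : (Fintype.card E : ℝ) ≤ 3 * Fintype.card V := by exact_mod_cast hd
      have hs : (24:ℝ) / 17 ≤ Real.sqrt (2 * (1:ℕ)) := by
        apply Real.le_sqrt_of_sq_le; norm_num
      nlinarith [mul_le_mul_of_nonneg_right hs hn0]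
    · have hk2' : (2:ℝ) ≤ k := by exact_mod_cast hk2
      have hs : (2:ℝ) ≤ Real.sqrt (2 * k) := by
        apply Real.le_sqrt_of_sq_le; linarith
      nlinarith [mul_le_mul_of_nonneg_right hs hn0]

end Sys
end PartF

set_option linter.all false

noncomputable section PartH
open Classical

/-- oriented system of arcs coming from a drawing of a bipartite graph -/
theorem exists_sys {n : ℕ} {G : SimpleGraph (Fin n)} (D : Drawing G) (hbip : IsBipartite G) :
    ∃ S : Sys (Fin n) G.edgeSet, ∀ e f, S.cr e f → D.Crosses e f := by
  obtain ⟨c, hc⟩ := hbip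
  have hor : ∀ e : G.edgeSet, ∃ u v, (e : Sym2 (Fin n)) = s(u, v) ∧ c u = true ∧ c v = false := by
    rintro ⟨e, he⟩
    induction e using Sym2.ind with
    | _ u v =>
      have h := hc u v he
      rcases hu : c u with _ | _
      · refine ⟨v, u, Sym2.eq_swap, ?_, hu⟩
        rw [hu] at h
        rcases hv : c v with _ | _
        · exact absurd hv.symm h
        · rfl
      · refine ⟨u, v, rfl, hu, ?_⟩
        rw [hu] at h
        rcases hv : c v with _ | _
        · rfl
        · exact absurd hv.symm h
  choose a b hab ha hb using hor
  have hae : ∀ e : G.edgeSet, a e ∈ (e : Sym2 (Fin n)) := fun e => by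
    rw [hab e]; exact Sym2.mem_mk_left _ _
  have hbe : ∀ e : G.edgeSet, b e ∈ (e : Sym2 (Fin n)) := fun e => by
    rw [hab e]; exact Sym2.mem_mk_right _ _
  have hne : ∀ e f, a e ≠ b f := fun e f h => by
    have := ha e; rw [h, hb f] at this; simp at this
  have h01 : ∀ t : ℝ, t ∈ Icc (0:ℝ) 1 → 1 - t ∈ Icc (0:ℝ) 1 := fun t ht => ⟨by linarith [ht.2], by linarith [ht.1]⟩
  have hpar : ∀ e : G.edgeSet, ∃ γ : ℝ → ℝ × ℝ, ContinuousOn γ (Icc 0 1) ∧ InjOn γ (Icc 0 1) ∧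
      γ 0 = D.vert (a e) ∧ γ 1 = D.vert (b e) ∧ ∀ t ∈ Icc (0:ℝ) 1, γ t ∈ D.arc e '' Icc (0:ℝ) 1 := by
    intro e
    have hends := D.arc_ends e (a e) (b e) (hab e)
    have hneq : D.arc e 0 ≠ D.arc e 1 := fun h => by
      have := D.arc_inj e (by simp) (by simp) h
      norm_num at this
    have hva : D.vert (a e) ∈ ({D.arc e 0, D.arc e 1} : Set (ℝ × ℝ)) := by rw [hends]; simp
    have hvb : D.vert (b e) ∈ ({D.arc e 0, D.arc e 1} : Set (ℝ × ℝ)) := by rw [hends]; simp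
    have hvne : D.vert (a e) ≠ D.vert (b e) := fun h => hne e e (D.vert_inj h)
    simp only [mem_insert_iff, mem_singleton_iff] at hva hvb
    rcases hva with h1 | h1
    · refine ⟨D.arc e, D.arc_cont e, D.arc_inj e, h1.symm, ?_, fun t ht => ⟨t, ht, rfl⟩⟩
      rcases hvb with h2 | h2
      · exact absurd (h1.trans h2.symm) hvne
      · exact h2.symm
    · refine ⟨fun t => D.arc e (1 - t), ?_, ?_, ?_, ?_, fun t ht => ⟨1 - t, h01 t ht, rfl⟩⟩
      · exact (D.arc_cont e).comp (by fun_prop) (fun t ht => h01 t ht)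
      · intro s hs t ht hst
        have := D.arc_inj e (h01 s hs) (h01 t ht) hst
        linarith
      · simp [h1]
      · rcases hvb with h2 | h2
        · simp [h2]
        · exact absurd (h1.trans h2.symm) hvne
  choose γ g1 g2 g3 g4 g5 using hpar
  have hIoo : ∀ t : ℝ, t ∈ Ioo (0:ℝ) 1 → t ∈ Icc (0:ℝ) 1 := fun t ht => Ioo_subset_Icc_self ht
  have hinner : ∀ e, ∀ t ∈ Ioo (0 : ℝ) 1, ∀ w, γ e t ≠ D.vert w := by
    intro e t ht w hw
    obtain ⟨t', ht', h⟩ := g5 e t (hIoo t ht)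
    have hwe := D.arc_vertex e t' ht' w (h.trans hw)
    rw [hab e, Sym2.mem_iff] at hwe
    rcases hwe with rfl | rfl
    · have := g2 e (hIoo t ht) (by simp) (hw.trans (g3 e).symm)
      exact ht.1.ne' this
    · have := g2 e (hIoo t ht) (by simp) (hw.trans (g4 e).symm)
      exact ht.2.ne this
  have hshare : ∀ e f : G.edgeSet, e ≠ f → ∀ s ∈ Ioo (0 : ℝ) 1, ∀ t ∈ Ioo (0 : ℝ) 1, γ e s = γ f t →
      ¬ ∃ w, w ∈ (e : Sym2 (Fin n)) ∧ w ∈ (f : Sym2 (Fin n)) := by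
    intro e f hef s hs t ht hst hw
    obtain ⟨w, _, _, h⟩ := D.adj_meet e f hef hw _ (g5 e s (hIoo s hs)) (hst ▸ g5 f t (hIoo t ht))
    exact hinner e s hs w h
  let S : Sys (Fin n) G.edgeSet :=
    { vert := D.vert
      vert_inj := D.vert_inj
      arc := γ
      cont := g1
      inj := g2
      a := a
      b := b
      arc0 := g3
      arc1 := g4
      inner := hinner
      hab := hne
      hinj := fun e f h1 h2 => Subtype.ext (by rw [hab e, hab f, h1, h2])
      cr_a := fun e f hef s hs t ht hst h => hshare e f hef s hs t ht hst ⟨a e, hae e, h ▸ hae f⟩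
      cr_b := fun e f hef s hs t ht hst h => hshare e f hef s hs t ht hst ⟨b e, hbe e, h ▸ hbe f⟩
      cr_uniq := fun e f hef s hs t ht hst s' hs' t' ht' hst' => by
        have := D.nonadj_meet e f (hshare e f hef s hs t ht hst)
          ⟨g5 e s (hIoo s hs), hst ▸ g5 f t (hIoo t ht)⟩
          ⟨g5 e s' (hIoo s' hs'), hst' ▸ g5 f t' (hIoo t' ht')⟩
        exact g2 e (hIoo s hs) (hIoo s' hs') this }
  refine ⟨S, ?_⟩
  rintro e f ⟨hef, s, hs, t, ht, hst⟩
  have hst' : γ e s = γ f t := hst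
  exact ⟨hef, γ e s, ⟨g5 e s (hIoo s hs), hst' ▸ g5 f t (hIoo t ht)⟩, fun w hw => hinner e s hs w hw.symm⟩

end PartH

/-- Let `G` be a simple bipartite `k`-planar graph with `n` vertices
and `m` edges, for some integer `k ≥ 1`. Then `m ≤ (17/8) √(2k) n`. -/
theorem bipartite_kplanar_density_upper_bound (n k : ℕ) (hk : 1 ≤ k)
    (G : SimpleGraph (Fin n)) (hbip : IsBipartite G) (hkp : IsKPlanar G k) :
    (G.edgeSet.ncard : ℝ) ≤ 17 / 8 * Real.sqrt (2 * k) * n := by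
  classical
  obtain ⟨D, hD⟩ := hkp
  obtain ⟨S, hS⟩ := exists_sys D hbip
  have h := S.sys_bound k hk (fun e => by
    refine le_trans ?_ (hD e)
    rw [← Set.ncard_coe_finset]
    refine Set.ncard_le_ncard ?_ (Set.toFinite _)
    intro f hf
    simp only [Finset.coe_filter, Finset.mem_univ, true_and, Set.mem_setOf_eq] at hf ⊢
    exact hS e f hf)
  rw [Fintype.card_fin] at h
  rwa [← _root_.Nat.card_coe_set_eq, Nat.card_eq_fintype_card]
end
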